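/- Fix A ∈ ℝ, set β = 1 + γ²(𝔠_γ + A), and let γ ↦ b_γ ≥ 0 be any family of nonnegative external fields. Let m_γ = E^γ_{β,b_γ}[σ_x] (independent of x ∈ Λ_N) and X̃_γ(x) = γ^{−1}(σ_{⌊ε^{−1}x⌋} − m_γ) for x ∈ 𝕋². Then there is a constant C such that for every continuously differentiable φ: 𝕋² → ℝ, limsup_{γ→0} E^γ_{β,b_γ}[ ( ∫_{𝕋²} X̃_γ(x) φ(x) dx )² ] ≤ C ( ‖φ‖_{L¹(𝕋²)} + ‖∇φ‖_{L^∞(𝕋²)} )². -/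

import Mathlib

open scoped BigOperators ENNReal
open MeasureTheory

noncomputable section

namespace IsingKac

/-- The periodic lattice `Λ_N = {1-N, …, N}²`, realised as `(ℤ/2Nℤ)²`. -/
abbrev Lat (N : ℕ) : Type := ZMod (2*N) × ZMod (2*N)

instance latNeZero (N : ℕ) [NeZero N] : NeZero (2*N) := ⟨by have := NeZero.ne N; omega⟩

/-- The representative of `v ∈ ℤ/2Nℤ` lying in `{1-N, …, N}`. -/
def latRep (N : ℕ) (v : ZMod (2*N)) : ℤ :=
  if (v.val : ℤ) ≤ (N : ℤ) then (v.val : ℤ) else (v.val : ℤ) - 2*N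

def latRep2 (N : ℕ) (z : Lat N) : ℤ × ℤ := (latRep N z.1, latRep N z.2)

/-- The character `e_w(x) = exp(iπ w·x)`. -/
def eW (w : ℤ × ℤ) (x : ℝ × ℝ) : ℂ :=
  Complex.exp ((Real.pi : ℂ) * Complex.I * ((w.1 : ℂ) * (x.1 : ℂ) + (w.2 : ℂ) * (x.2 : ℂ)))

/-- The point `ε z ∈ Λ_ε ⊂ 𝕋²` corresponding to `z ∈ Λ_N` (with `ε = 1/N`). -/
def latPt (N : ℕ) (z : Lat N) : ℝ × ℝ :=
  ((latRep N z.1 : ℝ) / N, (latRep N z.2 : ℝ) / N)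

/-- Discrete Fourier coefficient `f̂(w) = Σ_{x ∈ Λ_ε} ε² f(x) e^{-iπ w·x}`. -/
def dFT (N : ℕ) [NeZero N] (f : Lat N → ℂ) (w : ℤ × ℤ) : ℂ :=
  ∑ z : Lat N, ((N : ℂ)^2)⁻¹ * f z * (starRingEnd ℂ) (eW w (latPt N z))

/-- The extension operator `(Ex f)(x) = (1/4) Σ_{w ∈ Λ_N} f̂(w) e^{iπ w·x}` for `x ∈ 𝕋²`. -/
def Ex (N : ℕ) [NeZero N] (f : Lat N → ℂ) (x : ℝ × ℝ) : ℂ :=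
  (1/4 : ℂ) * ∑ z : Lat N, dFT N f (latRep2 N z) * eW (latRep2 N z) x

/-- Discrete `L^p` norm on `Λ_ε`, `p ∈ [1,∞]`. -/
def dLp (N : ℕ) [NeZero N] (p : ℝ≥0∞) {E : Type*} [NormedAddCommGroup E]
    (f : Lat N → E) : ℝ :=
  if p = ∞ then ⨆ z : Lat N, ‖f z‖
  else (∑ z : Lat N, ((N : ℝ)^2)⁻¹ * ‖f z‖ ^ p.toReal) ^ (1/p.toReal)

/-- Fundamental domain of the torus `𝕋² = [-1,1]²`. -/
def box : Set (ℝ × ℝ) := Set.Icc (-1 : ℝ) 1 ×ˢ Set.Icc (-1 : ℝ) 1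

/-- `L^p(𝕋²)` norm, `p ∈ [1,∞]`. -/
def cLp (p : ℝ≥0∞) {E : Type*} [NormedAddCommGroup E] (g : ℝ × ℝ → E) : ℝ≥0∞ :=
  eLpNorm g p (volume.restrict box)

/-- Euclidean norm on `ℝ²`. -/
def enorm2 (r : ℝ × ℝ) : ℝ := Real.sqrt (r.1^2 + r.2^2)

/-- A Littlewood–Paley partition of unity `(χ̃, χ)` on `ℝ²`. -/
structure LPpartition : Type where
  chit : ℝ × ℝ → ℝ
  chi : ℝ × ℝ → ℝ
  cont_t : Continuous chit
  cont : Continuous chi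
  mem_t : ∀ r, chit r ∈ Set.Icc (0:ℝ) 1
  mem : ∀ r, chi r ∈ Set.Icc (0:ℝ) 1
  supp_t : ∀ r : ℝ × ℝ, 4/3 < enorm2 r → chit r = 0
  supp : ∀ r : ℝ × ℝ, enorm2 r < 3/4 ∨ 8/3 < enorm2 r → chi r = 0
  partition : ∀ r : ℝ × ℝ, chit r + ∑' k : ℕ, chi ((2:ℝ)^(-(k:ℤ)) • r) = 1

/-- `χ_k`, for `k ≥ -1`. -/
def LPchi (P : LPpartition) (k : ℤ) : ℝ × ℝ → ℝ :=
  if k = -1 then P.chit else fun r => P.chi ((2:ℝ)^(-k) • r)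

/-- The Littlewood–Paley block `δ_k (Ex f)` of (the extension of) a lattice function. -/
def dBlock (N : ℕ) [NeZero N] (P : LPpartition) (k : ℤ) (f : Lat N → ℂ) (x : ℝ × ℝ) : ℂ :=
  (1/4 : ℂ) * ∑ z : Lat N,
    ((LPchi P k ((latRep N z.1 : ℝ), (latRep N z.2 : ℝ)) : ℝ) : ℂ) *
      dFT N f (latRep2 N z) * eW (latRep2 N z) x

/-- Discrete Besov norm `‖f‖_{B^ν_{p,q}(Λ_ε)}`. -/
def dBesov (N : ℕ) [NeZero N] (P : LPpartition) (ν : ℝ) (p q : ℝ≥0∞) (f : Lat N → ℂ) : ℝ :=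
  if q = ∞ then
    ⨆ k : ℕ, (2:ℝ)^(ν * ((k:ℝ) - 1)) * dLp N p (fun z => dBlock N P ((k:ℤ)-1) f (latPt N z))
  else
    (∑' k : ℕ, ((2:ℝ)^(ν * ((k:ℝ) - 1)) *
      dLp N p (fun z => dBlock N P ((k:ℤ)-1) f (latPt N z))) ^ q.toReal) ^ (1/q.toReal)

/-- The `C^{-ν}` (Besov–Hölder) norm of the extension `Ex f`:
`sup_{k ≥ -1} 2^{-νk} ‖δ_k (Ex f)‖_{L^∞(𝕋²)}`. -/
def holderNeg (N : ℕ) [NeZero N] (P : LPpartition) (ν : ℝ) (f : Lat N → ℂ) : ℝ :=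
  ⨆ k : ℕ, (2:ℝ)^(-ν * ((k:ℝ) - 1)) * ⨆ x : ℝ × ℝ, ‖dBlock N P ((k:ℤ)-1) f x‖

/-- Spin values. -/
def spin (s : Bool) : ℝ := if s then 1 else -1

/-- Hamiltonian `H(σ) = (β/2) Σ_{x,y} k(x-y) σ_x σ_y + b Σ_x σ_x`. -/
def hamil (N : ℕ) [NeZero N] (kk : Lat N → ℝ) (β b : ℝ) (σ : Lat N → ℝ) : ℝ :=
  β/2 * ∑ x : Lat N, ∑ y : Lat N, kk (x - y) * σ x * σ y + b * ∑ x : Lat N, σ x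

/-- Gibbs expectation `E^γ_{β,b}[F]`. -/
def gibbsE (N : ℕ) [NeZero N] (kk : Lat N → ℝ) (β b : ℝ) (F : (Lat N → ℝ) → ℝ) : ℝ :=
  (∑ s : Lat N → Bool, Real.exp (hamil N kk β b (fun x => spin (s x))) * F (fun x => spin (s x))) /
  (∑ s : Lat N → Bool, Real.exp (hamil N kk β b (fun x => spin (s x))))

/-- The profile `𝔎 : ℝ² → [0,1]`, twice differentiable, radial, supported in `B(0,3)`,
not identically zero. -/
structure KacProfile : Type where
  f : ℝ × ℝ → ℝ
  smooth : ContDiff ℝ 2 f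
  mem : ∀ x, f x ∈ Set.Icc (0:ℝ) 1
  radial : ∀ x y : ℝ × ℝ, enorm2 x = enorm2 y → f x = f y
  supp : ∀ x : ℝ × ℝ, 3 < enorm2 x → f x = 0
  nontriv : ∃ x, f x ≠ 0

/-- The Kac kernel `k_γ(z) = c γ² 𝔎(γ·z)` (shortest periodic representative), `k_γ(0)=0`. -/
def kGamma (𝔎 : KacProfile) (N : ℕ) (c γ : ℝ) (z : Lat N) : ℝ :=
  if z = 0 then 0 else c * γ^2 * 𝔎.f (γ * (latRep N z.1 : ℝ), γ * (latRep N z.2 : ℝ))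

/-- `γ = N^{-1/2}`, so that `γ² = ε = 1/N`. -/
def gam (N : ℕ) : ℝ := Real.sqrt ((N : ℝ)⁻¹)

/-- Fourier transform `K̂_γ(ω) = Σ_z k_γ(z) e^{-iπ ω·(εz)}` of the macroscopic kernel
(real, since the kernel is even). -/
def kHat (N : ℕ) [NeZero N] (kk : Lat N → ℝ) (ω : ℤ × ℤ) : ℝ :=
  ∑ z : Lat N, kk z *
    Real.cos (Real.pi * ((ω.1 : ℝ) * (latRep N z.1 : ℝ) / N + (ω.2 : ℝ) * (latRep N z.2 : ℝ) / N))

/-- The renormalisation constant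
`𝔠_γ = (1/4) Σ_{ω ∈ Λ_N \ {0}} |K̂_γ(ω)|² / (γ^{-2} (1-K̂_γ(ω)))`. -/
def cGamma (N : ℕ) [NeZero N] (kk : Lat N → ℝ) (γ : ℝ) : ℝ :=
  (1/4) * ∑ z : Lat N, if z = (0 : Lat N) then 0 else
    (kHat N kk (latRep2 N z))^2 / ((γ^2)⁻¹ * (1 - kHat N kk (latRep2 N z)))

/-- Critical inverse temperature `β = 1 + γ²(𝔠_γ + A)`. -/
def betaCrit (𝔎 : KacProfile) (N : ℕ) [NeZero N] (c A : ℝ) : ℝ :=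
  1 + (gam N)^2 * (cGamma N (kGamma 𝔎 N c (gam N)) (gam N) + A)

/-- The fluctuation field `X_γ(x) = γ^{-1} Σ_z k_γ(ε^{-1}x - z) σ_z`, as a function on `Λ_N`. -/
def fluct (N : ℕ) [NeZero N] (kk : Lat N → ℝ) (γ : ℝ) (σ : Lat N → ℝ) (z : Lat N) : ℝ :=
  γ⁻¹ * ∑ y : Lat N, kk (z - y) * σ y

/-- The rescaled step field `γ^{-1} σ_{⌊ε^{-1}x⌋}` on the torus (without the `γ^{-1}`). -/
def stepField (N : ℕ) (σ : Lat N → ℝ) (x : ℝ × ℝ) : ℝ :=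
  σ (((⌊(N : ℝ) * x.1⌋ : ℤ) : ZMod (2*N)), ((⌊(N : ℝ) * x.2⌋ : ℤ) : ZMod (2*N)))

/-- Fourier coefficient on the torus: `ĝ(ω) = ∫_{𝕋²} g(x) e^{-iπω·x} dx`. -/
def cFT (g : ℝ × ℝ → ℂ) (ω : ℤ × ℤ) : ℂ :=
  ∫ x in box, g x * (starRingEnd ℂ) (eW ω x)


/-! ### Additional definitions -/

/-- Nearest-neighbour Dirichlet sum `Σ_{x,y ∈ Λ_ε, |x-y|=ε} ε² (f(y)-f(x))²`. -/
def nnSum (N : ℕ) [NeZero N] (f : Lat N → ℝ) : ℝ :=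
  ∑ x : Lat N, ((N : ℝ)^2)⁻¹ *
    ((f (x + (1, 0)) - f x)^2 + (f (x + (0, 1)) - f x)^2 +
     (f (x - (1, 0)) - f x)^2 + (f (x - (0, 1)) - f x)^2)

/-- The `d`-dimensional periodic lattice `Λ_N^d`. -/
abbrev LatD (d N : ℕ) : Type := Fin d → ZMod (2*N)

/-- Discrete `L^p` norm on `Λ_ε^d`, `p ∈ [1,∞]`. -/
def dLpD (d N : ℕ) [NeZero N] (p : ℝ≥0∞) (f : LatD d N → ℂ) : ℝ :=
  if p = ∞ then ⨆ z : LatD d N, ‖f z‖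
  else (∑ z : LatD d N, ((N : ℝ)^d)⁻¹ * ‖f z‖ ^ p.toReal) ^ (1/p.toReal)

/-- `Σ_{w ∈ Λ_N^d} χ(λ w) e_w`, evaluated at the lattice point `ε z ∈ Λ_ε^d`. -/
def gLam (d N : ℕ) [NeZero N] (χ : (Fin d → ℝ) → ℝ) (lam : ℝ) (z : LatD d N) : ℂ :=
  ∑ w : LatD d N, ((χ (fun i => lam * (latRep N (w i) : ℝ)) : ℝ) : ℂ) *
    Complex.exp ((Real.pi : ℂ) * Complex.I *
      ((∑ i : Fin d, (latRep N (w i) : ℝ) * ((latRep N (z i) : ℝ) / N) : ℝ) : ℂ))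

/-- Second partial derivative of `φ` in directions `v, w`. -/
def pd2 (φ : ℝ × ℝ → ℝ) (v w : ℝ × ℝ) : ℝ × ℝ → ℝ :=
  fun x => fderiv ℝ (fun y => fderiv ℝ φ y v) x w

/-- `max_{i,j ∈ {1,2}} ‖∂_i ∂_j φ‖_{L^∞}`. -/
def secondDerivBound (φ : ℝ × ℝ → ℝ) : ℝ :=
  max (max (⨆ x : ℝ × ℝ, |pd2 φ (1,0) (1,0) x|) (⨆ x : ℝ × ℝ, |pd2 φ (1,0) (0,1) x|))
      (max (⨆ x : ℝ × ℝ, |pd2 φ (0,1) (1,0) x|) (⨆ x : ℝ × ℝ, |pd2 φ (0,1) (0,1) x|))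

/-- The Littlewood–Paley block `δ_k g` of a function on the torus. -/
def cBlock (P : LPpartition) (k : ℤ) (g : ℝ × ℝ → ℂ) (x : ℝ × ℝ) : ℂ :=
  (1/4 : ℂ) * ∑' ω : ℤ × ℤ, ((LPchi P k ((ω.1 : ℝ), (ω.2 : ℝ)) : ℝ) : ℂ) * cFT g ω * eW ω x

/-- Besov norm `‖g‖_{B^ν_{1,1}(𝕋²)} = Σ_{k ≥ -1} 2^{νk} ‖δ_k g‖_{L¹(𝕋²)}`. -/
def cBesov11 (P : LPpartition) (ν : ℝ) (g : ℝ × ℝ → ℂ) : ℝ :=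
  ∑' k : ℕ, (2:ℝ) ^ (ν * ((k:ℝ) - 1)) * ∫ x in box, ‖cBlock P ((k:ℤ)-1) g x‖

set_option linter.all false

section PartP1
section Ising
variable {V : Type} [Fintype V] [DecidableEq V]

/-- spin at a site -/
def sp (s : V → Bool) (x : V) : ℝ := spin (s x)

lemma spin_mul (a b : Bool) : spin (a == b) = spin a * spin b := by
  cases a <;> cases b <;> simp [spin]

lemma spin_sq (a : Bool) : spin a * spin a = 1 := by cases a <;> simp [spin]

lemma sp_sq (s : V → Bool) (x : V) : sp s x * sp s x = 1 := spin_sq _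

lemma sp_cases (s : V → Bool) (x : V) : sp s x = 1 ∨ sp s x = -1 := by
  unfold sp spin; cases s x <;> simp

lemma abs_sp (s : V → Bool) (x : V) : |sp s x| = 1 := by
  rcases sp_cases s x with h | h <;> simp [h]

/-- pointwise product of configurations -/
def cmul (s t : V → Bool) : V → Bool := fun x => s x == t x

lemma sp_cmul (s t : V → Bool) (x : V) : sp (cmul s t) x = sp s x * sp t x := spin_mul _ _

lemma cmul_cmul (s t : V → Bool) : cmul s (cmul s t) = t := by
  funext x; unfold cmul; cases s x <;> cases t x <;> rfl

/-- change of variables -/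
lemma sum_cmul (s : V → Bool) (F : (V → Bool) → ℝ) : ∑ t, F (cmul s t) = ∑ t, F t :=
  Equiv.sum_comp (⟨cmul s, cmul s, cmul_cmul s, cmul_cmul s⟩ : (V → Bool) ≃ (V → Bool)) F

/-- monomials -/
def mono (A : List V) (s : V → Bool) : ℝ := (A.map (sp s)).prod

lemma mono_nil (s : V → Bool) : mono [] s = 1 := by simp [mono]
lemma mono_cons (a : V) (A : List V) (s : V → Bool) : mono (a :: A) s = sp s a * mono A s := by
  simp [mono]
lemma mono_append (A B : List V) (s : V → Bool) : mono (A ++ B) s = mono A s * mono B s := by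
  simp [mono]
lemma mono_cmul (A : List V) (s t : V → Bool) : mono A (cmul s t) = mono A s * mono A t := by
  induction A with
  | nil => simp [mono_nil]
  | cons a A ih => rw [mono_cons, mono_cons, mono_cons, ih, sp_cmul]; ring
lemma mono_cases (A : List V) (s : V → Bool) : mono A s = 1 ∨ mono A s = -1 := by
  induction A with
  | nil => simp [mono_nil]
  | cons a A ih =>
    rw [mono_cons]
    rcases ih with h | h <;> rcases sp_cases s a with h' | h' <;> simp [h, h']

lemma sum_mono_nonneg (A : List V) : 0 ≤ ∑ s : V → Bool, mono A s := by
  have h : ∀ s : V → Bool, mono A s = ∏ x : V, spin (s x) ^ A.count x := by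
    intro s
    unfold mono
    rw [Finset.prod_list_map_count]
    apply Finset.prod_subset (Finset.subset_univ _)
    intro x _ hx
    rw [List.mem_toFinset] at hx
    rw [List.count_eq_zero_of_not_mem hx, pow_zero]
  simp_rw [h]
  rw [← Fintype.piFinset_univ, ← Finset.prod_univ_sum (fun _ => Finset.univ) (fun x b => spin b ^ A.count x)]
  apply Finset.prod_nonneg
  intro x _
  rcases Nat.even_or_odd (A.count x) with he | ho
  · simp [spin, he.neg_one_pow]
  · simp [spin, ho.neg_one_pow]

/-- functions with nonnegative correlations with all monomials -/
def PD (F : (V → Bool) → ℝ) : Prop := ∀ A : List V, 0 ≤ ∑ s, mono A s * F s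

lemma PD_one : PD (V := V) (fun _ => 1) := fun A => by simpa using sum_mono_nonneg A

lemma PD_mul {F : (V → Bool) → ℝ} (h : PD F) (B : List V) {p q : ℝ} (hp : 0 ≤ p) (hq : 0 ≤ q) :
    PD (fun s => (p + q * mono B s) * F s) := by
  intro A
  have : ∑ s, mono A s * ((p + q * mono B s) * F s)
      = p * ∑ s, mono A s * F s + q * ∑ s, mono (A ++ B) s * F s := by
    rw [Finset.mul_sum, Finset.mul_sum, ← Finset.sum_add_distrib]
    refine Finset.sum_congr rfl fun s _ => ?_
    rw [mono_append]; ring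
  rw [this]
  exact add_nonneg (mul_nonneg hp (h A)) (mul_nonneg hq (h _))

lemma PD_prod {ι : Type*} (S : Finset ι) (B : ι → List V) (p q : ι → ℝ) (hp : ∀ i, 0 ≤ p i)
    (hq : ∀ i, 0 ≤ q i) : PD (fun s => ∏ i ∈ S, (p i + q i * mono (B i) s)) := by
  classical
  induction S using Finset.induction_on with
  | empty => simpa using PD_one
  | insert a S ha ih =>
    have := PD_mul ih (B a) (hp a) (hq a)
    simpa [Finset.prod_insert ha] using this

lemma exp_sgn (c : ℝ) {x : ℝ} (h : x = 1 ∨ x = -1) :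
    Real.exp (c * x) = Real.cosh c + Real.sinh c * x := by
  rcases h with h | h <;> subst h
  · simp [Real.cosh_add_sinh]
  · simp [← Real.cosh_sub_sinh]; ring

/-- the bond variable -/
def bd (s : V → Bool) (e : V × V) : ℝ := sp s e.1 * sp s e.2

lemma bd_eq (s : V → Bool) (e : V × V) : bd s e = mono [e.1, e.2] s := by
  simp [bd, mono]

lemma bd_cases (s : V → Bool) (e : V × V) : bd s e = 1 ∨ bd s e = -1 := by
  rw [bd_eq]; exact mono_cases _ _

/-- Boltzmann weight -/
def wt (J : V × V → ℝ) (s : V → Bool) : ℝ := Real.exp (∑ e, J e * bd s e)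

def Zp (J : V × V → ℝ) : ℝ := ∑ s, wt J s

/-- Gibbs average -/
def av (J : V × V → ℝ) (F : (V → Bool) → ℝ) : ℝ := (∑ s, wt J s * F s) / Zp J

lemma wt_pos (J : V × V → ℝ) (s : V → Bool) : 0 < wt J s := Real.exp_pos _

lemma Zp_pos (J : V × V → ℝ) : 0 < Zp J := by
  apply Finset.sum_pos (fun s _ => wt_pos J s) Finset.univ_nonempty

lemma sum_eq_av (J : V × V → ℝ) (F : (V → Bool) → ℝ) : ∑ s, wt J s * F s = Zp J * av J F := by
  unfold av; field_simp [(Zp_pos J).ne']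

lemma PD_wt {J : V × V → ℝ} (hJ : ∀ e, 0 ≤ J e) : PD (wt J) := by
  have : wt J = fun s => ∏ e : V × V, (Real.cosh (J e) + Real.sinh (J e) * mono [e.1, e.2] s) := by
    funext s
    unfold wt
    rw [Real.exp_sum]
    refine Finset.prod_congr rfl fun e _ => ?_
    rw [exp_sgn _ (bd_cases s e), bd_eq]
  rw [this]
  exact PD_prod _ _ _ _ (fun e => (Real.cosh_pos _).le) (fun e => Real.sinh_nonneg_iff.2 (hJ e))

lemma av_add (J : V × V → ℝ) (F G : (V → Bool) → ℝ) :
    av J (fun s => F s + G s) = av J F + av J G := by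
  simp [av, mul_add, Finset.sum_add_distrib, add_div]
lemma av_sub (J : V × V → ℝ) (F G : (V → Bool) → ℝ) :
    av J (fun s => F s - G s) = av J F - av J G := by
  simp [av, mul_sub, Finset.sum_sub_distrib, sub_div]
lemma av_const_mul (J : V × V → ℝ) (c : ℝ) (F : (V → Bool) → ℝ) :
    av J (fun s => c * F s) = c * av J F := by
  simp only [av, mul_div_assoc', Finset.mul_sum]
  congr 1
  exact Finset.sum_congr rfl fun s _ => by ring
lemma av_sum {ι : Type*} (J : V × V → ℝ) (I : Finset ι) (F : ι → (V → Bool) → ℝ) :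
    av J (fun s => ∑ i ∈ I, F i s) = ∑ i ∈ I, av J (F i) := by
  simp only [av, Finset.mul_sum, ← Finset.sum_div]
  rw [Finset.sum_comm]
lemma av_const (J : V × V → ℝ) (c : ℝ) : av J (fun _ => c) = c := by
  unfold av
  rw [← Finset.sum_mul]
  exact mul_div_cancel_left₀ c (Zp_pos J).ne'
lemma av_nonneg {J : V × V → ℝ} {F : (V → Bool) → ℝ} (h : ∀ s, 0 ≤ F s) : 0 ≤ av J F :=
  div_nonneg (Finset.sum_nonneg fun s _ => mul_nonneg (wt_pos J s).le (h s)) (Zp_pos J).le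
lemma av_le {J : V × V → ℝ} {F G : (V → Bool) → ℝ} (h : ∀ s, F s ≤ G s) : av J F ≤ av J G := by
  have := av_nonneg (J := J) (F := fun s => G s - F s) (fun s => sub_nonneg.2 (h s))
  rw [av_sub] at this; linarith
lemma abs_av_le {J : V × V → ℝ} {F G : (V → Bool) → ℝ} (h : ∀ s, |F s| ≤ G s) :
    |av J F| ≤ av J G := by
  rw [abs_le]
  constructor
  · have := av_le (J := J) (F := fun s => (-1) * G s) (G := F)
      (fun s => by have := (abs_le.1 (h s)).1; linarith)
    rw [av_const_mul] at this; linarith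
  · exact av_le fun s => (abs_le.1 (h s)).2

lemma gks1 {J : V × V → ℝ} (hJ : ∀ e, 0 ≤ J e) (A : List V) : 0 ≤ av J (mono A) := by
  unfold av
  refine div_nonneg ?_ (Zp_pos J).le
  have := PD_wt hJ A
  simpa only [mul_comm] using this

/-- Griffiths: two replica positivity -/
lemma griffiths_two {J J' : V × V → ℝ} (hJ' : ∀ e, 0 ≤ J' e) (h : ∀ e, J' e ≤ J e) (A B : List V) :
    0 ≤ ∑ s, ∑ t, wt J s * wt J' t * (mono A s * (mono B s - mono B t)) := by
  have e1 : ∀ s : V → Bool, ∑ t, wt J s * wt J' t * (mono A s * (mono B s - mono B t))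
      = ∑ t, wt J s * wt J' (cmul s t) * (mono A s * (mono B s - mono B s * mono B t)) := by
    intro s
    rw [← sum_cmul s]
    simp_rw [mono_cmul]
  simp_rw [e1]
  rw [Finset.sum_comm]
  refine Finset.sum_nonneg fun t _ => ?_
  have hw : ∀ s : V → Bool, wt J s * wt J' (cmul s t) = wt (fun e => J e + J' e * bd t e) s := by
    intro s
    unfold wt
    rw [← Real.exp_add, ← Finset.sum_add_distrib]
    congr 1
    refine Finset.sum_congr rfl fun e _ => ?_
    simp only [bd, sp_cmul]; ring
  have hpos : ∀ e, 0 ≤ J e + J' e * bd t e := by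
    intro e
    have := hJ' e; have := h e
    rcases bd_cases t e with h | h <;> rw [h] <;> linarith
  have := PD_wt hpos (A ++ B)
  have e2 : ∑ s, wt J s * wt J' (cmul s t) * (mono A s * (mono B s - mono B s * mono B t))
      = (1 - mono B t) * ∑ s, mono (A ++ B) s * wt (fun e => J e + J' e * bd t e) s := by
    rw [Finset.mul_sum]
    refine Finset.sum_congr rfl fun s _ => ?_
    rw [hw, mono_append]; ring
  rw [e2]
  refine mul_nonneg ?_ this
  rcases mono_cases B t with h | h <;> rw [h] <;> norm_num

lemma two_rep (J J' : V × V → ℝ) (F G : (V → Bool) → ℝ) :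
    ∑ s, ∑ t, wt J s * wt J' t * (F s * G t) = (Zp J * Zp J') * (av J F * av J' G) := by
  have : ∑ s, ∑ t, wt J s * wt J' t * (F s * G t)
      = (∑ s, wt J s * F s) * ∑ t, wt J' t * G t := by
    rw [Finset.sum_mul_sum]
    refine Finset.sum_congr rfl fun s _ => Finset.sum_congr rfl fun t _ => by ring
  rw [this, sum_eq_av, sum_eq_av]; ring

lemma griffiths_aux {J J' : V × V → ℝ} (hJ' : ∀ e, 0 ≤ J' e) (h : ∀ e, J' e ≤ J e) (A B : List V) :
    av J (mono A) * av J' (mono B) ≤ av J (mono (A ++ B)) := by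
  have h1 := griffiths_two hJ' h A B
  have e : ∑ s, ∑ t, wt J s * wt J' t * (mono A s * (mono B s - mono B t))
     = ∑ s, ∑ t, wt J s * wt J' t * (mono (A ++ B) s * 1)
       - ∑ s, ∑ t, wt J s * wt J' t * (mono A s * mono B t) := by
    simp_rw [← Finset.sum_sub_distrib, mono_append]
    refine Finset.sum_congr rfl fun s _ => Finset.sum_congr rfl fun t _ => by ring
  rw [e, two_rep J J' (mono (A ++ B)) (fun _ => 1), two_rep J J' (mono A) (mono B), av_const,
    ← mul_sub] at h1
  have hz := mul_pos (Zp_pos J) (Zp_pos J')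
  have := nonneg_of_mul_nonneg_right h1 hz
  linarith

lemma gks2 {J : V × V → ℝ} (hJ : ∀ e, 0 ≤ J e) (A B : List V) :
    av J (mono A) * av J (mono B) ≤ av J (mono (A ++ B)) :=
  griffiths_aux hJ (fun _ => le_rfl) A B

lemma griffiths_mono {J J' : V × V → ℝ} (hJ' : ∀ e, 0 ≤ J' e) (h : ∀ e, J' e ≤ J e) (A : List V) :
    av J' (mono A) ≤ av J (mono A) := by
  have := griffiths_aux hJ' h [] A
  simp only [List.nil_append] at this
  have e : av J (mono []) = 1 := by
    have : (mono [] : (V → Bool) → ℝ) = fun _ => 1 := by funext s; simp [mono]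
    rw [this, av_const]
  rw [e, one_mul] at this
  exact this

end Ising

end PartP1

section PartP2
section Switch
variable {V : Type} [Fintype V] [DecidableEq V]

/-- bond excess -/
def gb (J : V × V → ℝ) (e : V × V) (s : V → Bool) : ℝ := Real.exp (2 * J e * bd s e) - 1

def ind (S : Finset (V × V)) (t : V → Bool) : ℝ := ∏ e ∈ S, if t e.1 = t e.2 then 1 else 0

def vS (J : V × V → ℝ) (S : Finset (V × V)) (F : (V → Bool) → ℝ) : ℝ :=
  ∑ s, F s * ∏ e ∈ S, gb J e s

def nS (S : Finset (V × V)) (F : (V → Bool) → ℝ) : ℝ := ∑ t, F t * ind S t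

lemma ind_nonneg (S : Finset (V × V)) (t : V → Bool) : 0 ≤ ind S t := by
  apply Finset.prod_nonneg; intro e _; split_ifs <;> norm_num

lemma nS_one_nonneg (S : Finset (V × V)) : 0 ≤ nS S (fun _ => 1) :=
  Finset.sum_nonneg fun t _ => by simpa using ind_nonneg S t

lemma vS_nonneg {J : V × V → ℝ} (hJ : ∀ e, 0 ≤ J e) (S : Finset (V × V)) (A : List V) :
    0 ≤ vS J S (mono A) := by
  have h : ∀ s : V → Bool, ∏ e ∈ S, gb J e s =
      ∏ e ∈ S, ((Real.cosh (2 * J e) - 1) + Real.sinh (2 * J e) * mono [e.1, e.2] s) := by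
    intro s
    refine Finset.prod_congr rfl fun e _ => ?_
    unfold gb
    rw [exp_sgn _ (bd_cases s e), bd_eq]; ring
  unfold vS
  simp_rw [h]
  refine PD_prod S (fun e => [e.1, e.2]) _ _ (fun e => ?_) (fun e => ?_) A
  · have := Real.one_le_cosh (2 * J e); linarith
  · exact Real.sinh_nonneg_iff.2 (by have := hJ e; linarith)

/-- the switching identity -/
lemma switching (J : V × V → ℝ) (F : (V → Bool) → ℝ) (B : List V) :
    (Zp J * Zp J) * (av J F * av J (mono B)) =
      ∑ S : Finset (V × V), vS J S (fun s => F s * mono B s) * nS S (mono B) := by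
  rw [← two_rep]
  have e1 : ∀ s : V → Bool, ∑ t, wt J s * wt J t * (F s * mono B t)
      = ∑ t, wt J s * wt J (cmul s t) * (F s * (mono B s * mono B t)) := by
    intro s
    rw [← sum_cmul s]
    simp_rw [mono_cmul]
  simp_rw [e1]
  have hw : ∀ s t : V → Bool, wt J s * wt J (cmul s t) =
      ∑ S : Finset (V × V), (∏ e ∈ S, gb J e s) * ind S t := by
    intro s t
    unfold wt ind
    rw [← Real.exp_add, ← Finset.sum_add_distrib, Real.exp_sum]
    simp_rw [← Finset.prod_mul_distrib]
    rw [← Finset.powerset_univ, ← Finset.prod_one_add]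
    refine Finset.prod_congr rfl fun e _ => ?_
    have : bd (cmul s t) e = bd s e * bd t e := by simp only [bd, sp_cmul]; ring
    rw [this]
    unfold gb
    split_ifs with h
    · have : bd t e = 1 := by unfold bd sp; rw [h]; exact spin_sq _
      rw [this]; ring_nf
    · have : bd t e = -1 := by
        unfold bd sp spin
        revert h
        cases t e.1 <;> cases t e.2 <;> simp
      rw [this]; ring_nf; simp
  simp_rw [hw, Finset.sum_mul]
  rw [Finset.sum_comm' (t' := Finset.univ) (s' := fun _ => Finset.univ) (by simp)]
  simp_rw [fun y : V → Bool => Finset.sum_comm (s := (Finset.univ : Finset (V → Bool))) (t := (Finset.univ : Finset (Finset (V × V))))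
    (f := fun x i => ((∏ e ∈ i, gb J e x) * ind i y) * (F x * (mono B x * mono B y)))]
  rw [Finset.sum_comm]
  refine Finset.sum_congr rfl fun S _ => ?_
  unfold vS nS
  rw [Finset.sum_mul_sum, Finset.sum_comm]
  refine Finset.sum_congr rfl fun s _ => Finset.sum_congr rfl fun t _ => by ring

/-- adjacency -/
def adj (S : Finset (V × V)) (a b : V) : Prop := (a, b) ∈ S ∨ (b, a) ∈ S

open Classical in
/-- cluster of `w` -/
def clu (S : Finset (V × V)) (w : V) : Finset V :=
  Finset.univ.filter fun x => Relation.ReflTransGen (adj S) w x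

/-- no edge of `S` leaves `C` -/
def clo (S : Finset (V × V)) (C : Finset V) : Prop := ∀ e ∈ S, e.1 ∈ C ↔ e.2 ∈ C

lemma mem_clu {S : Finset (V × V)} {w x : V} : x ∈ clu S w ↔ Relation.ReflTransGen (adj S) w x := by
  simp [clu]

lemma self_mem_clu (S : Finset (V × V)) (w : V) : w ∈ clu S w := mem_clu.2 Relation.ReflTransGen.refl

lemma clo_clu (S : Finset (V × V)) (w : V) : clo S (clu S w) := by
  intro e he
  rw [mem_clu, mem_clu]
  exact ⟨fun h => h.tail (Or.inl he), fun h => h.tail (Or.inr he)⟩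

lemma clu_sub {S : Finset (V × V)} {C : Finset V} (h : clo S C) {w : V} (hw : w ∈ C) : clu S w ⊆ C := by
  intro x hx
  rw [mem_clu] at hx
  induction hx with
  | refl => exact hw
  | tail _ hbc ih =>
    rcases hbc with hbc | hbc
    · exact (h _ hbc).1 ih
    · exact (h _ hbc).2 ih

lemma clu_symm {S : Finset (V × V)} {w x : V} : x ∈ clu S w ↔ w ∈ clu S x := by
  rw [mem_clu, mem_clu]
  haveI : Std.Symm (adj S) := ⟨fun a b h => h.symm⟩
  constructor <;> intro h <;> exact Relation.ReflTransGen.symmetric.symm _ _ h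

/-- flip the spins in `C` -/
def flp (C : Finset V) (s : V → Bool) : V → Bool := fun x => if x ∈ C then !(s x) else s x

lemma flp_flp (C : Finset V) (s : V → Bool) : flp C (flp C s) = s := by
  funext x; unfold flp; split_ifs <;> simp

lemma sum_flp (C : Finset V) (F : (V → Bool) → ℝ) : ∑ t, F (flp C t) = ∑ t, F t :=
  Equiv.sum_comp (⟨flp C, flp C, flp_flp C, flp_flp C⟩ : (V → Bool) ≃ (V → Bool)) F

lemma sp_flp (C : Finset V) (s : V → Bool) (x : V) :
    sp (flp C s) x = if x ∈ C then - sp s x else sp s x := by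
  unfold sp flp
  split_ifs <;> cases s x <;> simp [spin]

lemma bd_flp {S : Finset (V × V)} {C : Finset V} (h : clo S C) (s : V → Bool) {e : V × V} (he : e ∈ S) :
    bd (flp C s) e = bd s e := by
  have := h e he
  unfold bd
  rw [sp_flp, sp_flp]
  by_cases h1 : e.1 ∈ C
  · rw [if_pos h1, if_pos (this.1 h1)]; ring
  · rw [if_neg h1, if_neg (fun h2 => h1 (this.2 h2))]

lemma gprod_flp (J : V × V → ℝ) {S : Finset (V × V)} {C : Finset V} (h : clo S C) (s : V → Bool) :
    ∏ e ∈ S, gb J e (flp C s) = ∏ e ∈ S, gb J e s :=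
  Finset.prod_congr rfl fun e he => by unfold gb; rw [bd_flp h s he]

lemma ind_flp {S : Finset (V × V)} {C : Finset V} (h : clo S C) (s : V → Bool) :
    ind S (flp C s) = ind S s := by
  refine Finset.prod_congr rfl fun e he => ?_
  have : (flp C s e.1 = flp C s e.2) ↔ (s e.1 = s e.2) := by
    have := h e he
    unfold flp
    by_cases h1 : e.1 ∈ C
    · rw [if_pos h1, if_pos (this.1 h1)]; simp
    · rw [if_neg h1, if_neg (fun h2 => h1 (this.2 h2))]
  simp only [this]

lemma vS_zero (J : V × V → ℝ) {S : Finset (V × V)} {C : Finset V} (h : clo S C)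
    {F : (V → Bool) → ℝ} (hF : ∀ s, F (flp C s) = - F s) : vS J S F = 0 := by
  have : vS J S F = - vS J S F := by
    conv_lhs => unfold vS; rw [← sum_flp C]
    unfold vS
    rw [← Finset.sum_neg_distrib]
    refine Finset.sum_congr rfl fun s _ => ?_
    rw [gprod_flp J h, hF]; ring
  linarith

lemma nS_zero {S : Finset (V × V)} {C : Finset V} (h : clo S C)
    {F : (V → Bool) → ℝ} (hF : ∀ s, F (flp C s) = - F s) : nS S F = 0 := by
  have : nS S F = - nS S F := by
    conv_lhs => unfold nS; rw [← sum_flp C]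
    unfold nS
    rw [← Finset.sum_neg_distrib]
    refine Finset.sum_congr rfl fun s _ => ?_
    rw [ind_flp h, hF]; ring
  linarith

lemma ind_ne_zero {S : Finset (V × V)} {t : V → Bool} (h : ind S t ≠ 0) {w x : V} (hx : x ∈ clu S w) :
    t x = t w := by
  rw [mem_clu] at hx
  unfold ind at h
  rw [Finset.prod_ne_zero_iff] at h
  have h' : ∀ e ∈ S, t e.1 = t e.2 := by
    intro e he
    by_contra hne
    exact h e he (if_neg hne)
  induction hx with
  | refl => rfl
  | tail _ hbc ih =>
    rcases hbc with hbc | hbc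
    · rw [← ih]; exact (h' _ hbc).symm
    · rw [← ih]; exact (h' _ hbc)

lemma mono_pair (a b : V) (s : V → Bool) : mono [a, b] s = sp s a * sp s b := by simp [mono]

open Classical in
lemma nS_pair (S : Finset (V × V)) (x w : V) :
    nS S (mono [x, w]) = if x ∈ clu S w then nS S (fun _ => 1) else 0 := by
  split_ifs with h
  · unfold nS
    refine Finset.sum_congr rfl fun t _ => ?_
    by_cases h0 : ind S t = 0
    · rw [h0]; simp
    · rw [mono_pair]; unfold sp; rw [ind_ne_zero h0 h, spin_sq]
  · refine nS_zero (clo_clu S w) fun s => ?_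
    rw [mono_pair, mono_pair, sp_flp, sp_flp, if_neg h, if_pos (self_mem_clu S w)]; ring

open Classical in
/-- switching with a pair of sources in the second replica -/
lemma switching_pair (J : V × V → ℝ) (A : List V) (x w : V) :
    (Zp J * Zp J) * (av J (mono A) * av J (mono [x, w])) =
      ∑ S : Finset (V × V), if x ∈ clu S w then vS J S (mono (A ++ [x, w])) * nS S (fun _ => 1) else 0 := by
  rw [switching]
  refine Finset.sum_congr rfl fun S _ => ?_
  rw [nS_pair]
  have : (fun s => mono A s * mono [x, w] s) = mono (A ++ [x, w]) := by
    funext s; rw [mono_append]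
  rw [this]; split_ifs <;> simp

lemma mono_nil_fun : (mono [] : (V → Bool) → ℝ) = fun _ => 1 := by funext s; simp [mono]

lemma switching_nil (J : V × V → ℝ) (F : (V → Bool) → ℝ) :
    (Zp J * Zp J) * av J F =
      ∑ S : Finset (V × V), vS J S F * nS S (fun _ => 1) := by
  have := switching J F []
  rw [mono_nil_fun, av_const, mul_one] at this
  simpa using this

/-- independence -/
lemma sum_indep (C : Finset V) {P Q : (V → Bool) → ℝ}
    (hP : ∀ s t, (∀ x ∈ C, s x = t x) → P s = P t) (hQ : ∀ s t, (∀ x ∉ C, s x = t x) → Q s = Q t) :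
    (Fintype.card (V → Bool) : ℝ) * ∑ s, P s * Q s = (∑ s, P s) * ∑ s, Q s := by
  classical
  let mx : (V → Bool) → (V → Bool) → (V → Bool) := fun s t x => if x ∈ C then s x else t x
  have hinv : ∀ p : (V → Bool) × (V → Bool),
      (mx (mx p.1 p.2) (mx p.2 p.1), mx (mx p.2 p.1) (mx p.1 p.2)) = p := by
    intro p
    ext x <;> simp only [mx] <;> split_ifs <;> rfl
  let E : (V → Bool) × (V → Bool) ≃ (V → Bool) × (V → Bool) :=
    ⟨fun p => (mx p.1 p.2, mx p.2 p.1), fun p => (mx p.1 p.2, mx p.2 p.1), hinv, hinv⟩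
  rw [Finset.sum_mul_sum, ← Fintype.sum_prod_type' (f := fun s t => P s * Q t)]
  have h1 : ∑ p : (V → Bool) × (V → Bool), P p.1 * Q p.2
      = ∑ p : (V → Bool) × (V → Bool), (fun q : (V → Bool) × (V → Bool) => P q.1 * Q q.1) (E p) := by
    refine Finset.sum_congr rfl fun p _ => ?_
    simp only [E, Equiv.coe_fn_mk]
    rw [hP p.1 (mx p.1 p.2) (fun x hx => by simp [mx, hx]),
      hQ p.2 (mx p.1 p.2) (fun x hx => by simp [mx, hx])]
  rw [h1, Equiv.sum_comp E (fun q : (V → Bool) × (V → Bool) => P q.1 * Q q.1), Fintype.sum_prod_type]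
  simp only [Finset.sum_const, Finset.card_univ, nsmul_eq_mul, Finset.mul_sum]

end Switch

end PartP2

section PartP3
section Factor
variable {V : Type} [Fintype V] [DecidableEq V]

/-- couplings restricted to the complement of `C` -/
def Jout (J : V × V → ℝ) (C : Finset V) : V × V → ℝ := fun e => if e.1 ∉ C ∧ e.2 ∉ C then J e else 0

/-- edges inside `C` -/
def Ein (C : Finset V) : Finset (V × V) := Finset.univ.filter fun e => e.1 ∈ C ∧ e.2 ∈ C
/-- edges outside `C` -/
def Eout (C : Finset V) : Finset (V × V) := Finset.univ.filter fun e => e.1 ∉ C ∧ e.2 ∉ C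

lemma bd_congr_in {C : Finset V} {S : Finset (V × V)} (hS : S ⊆ Ein C) {s t : V → Bool}
    (h : ∀ x ∈ C, s x = t x) {e : V × V} (he : e ∈ S) : s e.1 = t e.1 ∧ s e.2 = t e.2 := by
  have := hS he
  simp only [Ein, Finset.mem_filter, Finset.mem_univ, true_and] at this
  exact ⟨h _ this.1, h _ this.2⟩

lemma bd_congr_out {C : Finset V} {S : Finset (V × V)} (hS : S ⊆ Eout C) {s t : V → Bool}
    (h : ∀ x ∉ C, s x = t x) {e : V × V} (he : e ∈ S) : s e.1 = t e.1 ∧ s e.2 = t e.2 := by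
  have := hS he
  simp only [Eout, Finset.mem_filter, Finset.mem_univ, true_and] at this
  exact ⟨h _ this.1, h _ this.2⟩

lemma disj_in_out {C : Finset V} {S1 S2 : Finset (V × V)} (h1 : S1 ⊆ Ein C) (h2 : S2 ⊆ Eout C) :
    Disjoint S1 S2 := by
  rw [Finset.disjoint_left]
  intro e he1 he2
  have a := h1 he1
  have b := h2 he2
  simp only [Ein, Eout, Finset.mem_filter, Finset.mem_univ, true_and] at a b
  exact b.1 a.1

lemma vS_factor (J : V × V → ℝ) {C : Finset V} {S1 S2 : Finset (V × V)} (h1 : S1 ⊆ Ein C)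
    (h2 : S2 ⊆ Eout C) {P Q : (V → Bool) → ℝ}
    (hP : ∀ s t, (∀ x ∈ C, s x = t x) → P s = P t) (hQ : ∀ s t, (∀ x ∉ C, s x = t x) → Q s = Q t) :
    (Fintype.card (V → Bool) : ℝ) * vS J (S1 ∪ S2) (fun s => P s * Q s) = vS J S1 P * vS J S2 Q := by
  unfold vS
  rw [← sum_indep C (P := fun s => P s * ∏ e ∈ S1, gb J e s) (Q := fun s => Q s * ∏ e ∈ S2, gb J e s)]
  · congr 1
    refine Finset.sum_congr rfl fun s _ => ?_
    rw [Finset.prod_union (disj_in_out h1 h2)]; ring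
  · intro s t h
    rw [hP s t h]
    congr 1
    refine Finset.prod_congr rfl fun e he => ?_
    obtain ⟨a, b⟩ := bd_congr_in h1 h he
    simp only [gb, bd, sp, a, b]
  · intro s t h
    rw [hQ s t h]
    congr 1
    refine Finset.prod_congr rfl fun e he => ?_
    obtain ⟨a, b⟩ := bd_congr_out h2 h he
    simp only [gb, bd, sp, a, b]

lemma nS_factor {C : Finset V} {S1 S2 : Finset (V × V)} (h1 : S1 ⊆ Ein C)
    (h2 : S2 ⊆ Eout C) :
    (Fintype.card (V → Bool) : ℝ) * nS (S1 ∪ S2) (fun s => 1) = nS S1 (fun _ => 1) * nS S2 (fun _ => 1) := by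
  unfold nS
  rw [← sum_indep C (P := fun s => 1 * ind S1 s) (Q := fun s => 1 * ind S2 s)]
  · congr 1
    refine Finset.sum_congr rfl fun s _ => ?_
    unfold ind
    rw [Finset.prod_union (disj_in_out h1 h2)]; ring
  · intro s t h
    congr 1
    refine Finset.prod_congr rfl fun e he => ?_
    obtain ⟨a, b⟩ := bd_congr_in h1 h he
    simp only [a, b]
  · intro s t h
    congr 1
    refine Finset.prod_congr rfl fun e he => ?_
    obtain ⟨a, b⟩ := bd_congr_out h2 h he
    simp only [a, b]

lemma clu_union_eq {C : Finset V} {S1 S2 : Finset (V × V)} (h1 : S1 ⊆ Ein C) (h2 : S2 ⊆ Eout C)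
    {w : V} (hw : w ∈ C) : clu (S1 ∪ S2) w = C ↔ clu S1 w = C := by
  have hc1 : clo S1 C := by
    intro e he
    have := h1 he
    simp only [Ein, Finset.mem_filter, Finset.mem_univ, true_and] at this
    exact ⟨fun _ => this.2, fun _ => this.1⟩
  have key : clu (S1 ∪ S2) w = clu S1 w := by
    apply le_antisymm
    · apply clu_sub _ (self_mem_clu S1 w)
      intro e he
      rw [Finset.mem_union] at he
      rcases he with he | he
      · exact clo_clu S1 w e he
      · have := h2 he
        simp only [Eout, Finset.mem_filter, Finset.mem_univ, true_and] at this
        have hs := clu_sub hc1 hw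
        exact ⟨fun h => absurd (hs h) this.1, fun h => absurd (hs h) this.2⟩
    · apply clu_sub _ (self_mem_clu _ w)
      intro e he
      exact clo_clu (S1 ∪ S2) w e (Finset.mem_union_left _ he)
  rw [key]

open Classical in
/-- decomposition of the sum over `S` with prescribed cluster -/
lemma sum_clu_eq (C : Finset V) {w : V} (hw : w ∈ C) (f : Finset (V × V) → ℝ) :
    ∑ S ∈ Finset.univ.filter (fun S => clu S w = C), f S =
      ∑ S1 ∈ (Ein C).powerset.filter (fun S => clu S w = C), ∑ S2 ∈ (Eout C).powerset, f (S1 ∪ S2) := by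
  rw [← Finset.sum_product']
  symm
  refine Finset.sum_bij' (fun p _ => p.1 ∪ p.2) (fun S _ => (S ∩ Ein C, S ∩ Eout C)) ?_ ?_ ?_ ?_ ?_
  · rintro ⟨S1, S2⟩ h
    simp only [Finset.mem_product, Finset.mem_filter, Finset.mem_powerset] at h
    simp only [Finset.mem_filter, Finset.mem_univ, true_and]
    exact (clu_union_eq h.1.1 h.2 hw).2 h.1.2
  · intro S h
    simp only [Finset.mem_filter, Finset.mem_univ, true_and] at h
    simp only [Finset.mem_product, Finset.mem_filter, Finset.mem_powerset]
    refine ⟨⟨Finset.inter_subset_right, ?_⟩, Finset.inter_subset_right⟩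
    have hS : S ∩ Ein C ∪ S ∩ Eout C = S := by
      ext e
      simp only [Finset.mem_union, Finset.mem_inter, Ein, Eout, Finset.mem_filter, Finset.mem_univ, true_and]
      have := clo_clu S w e
      rw [h] at this
      tauto
    have := (clu_union_eq (C := C) (S1 := S ∩ Ein C) (S2 := S ∩ Eout C)
      Finset.inter_subset_right Finset.inter_subset_right hw).1
    rw [hS] at this
    exact this h
  · rintro ⟨S1, S2⟩ h
    simp only [Finset.mem_product, Finset.mem_filter, Finset.mem_powerset] at h
    have h1 := h.1.1
    have h2 := h.2
    have a : ∀ e ∈ S1, e.1 ∈ C ∧ e.2 ∈ C := fun e he => by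
      have := h1 he; simpa [Ein] using this
    have b : ∀ e ∈ S2, e.1 ∉ C ∧ e.2 ∉ C := fun e he => by
      have := h2 he; simpa [Eout] using this
    ext e
    · simp only [Finset.mem_union, Finset.mem_inter, Ein, Finset.mem_filter, Finset.mem_univ, true_and]
      have := a e; have := b e; tauto
    · simp only [Finset.mem_union, Finset.mem_inter, Eout, Finset.mem_filter, Finset.mem_univ, true_and]
      have := a e; have := b e; tauto
  · intro S h
    simp only [Finset.mem_filter, Finset.mem_univ, true_and] at h
    ext e
    simp only [Finset.mem_union, Finset.mem_inter, Ein, Eout, Finset.mem_filter, Finset.mem_univ, true_and]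
    have := clo_clu S w e
    rw [h] at this
    tauto
  · rintro ⟨S1, S2⟩ h
    rfl

lemma sum_out (J : V × V → ℝ) (C : Finset V) (Q : (V → Bool) → ℝ) :
    ∑ S2 ∈ (Eout C).powerset, vS J S2 Q * nS S2 (fun _ => 1)
      = (Zp (Jout J C) * Zp (Jout J C)) * av (Jout J C) Q := by
  rw [switching_nil]
  rw [← Finset.sum_subset (Finset.subset_univ (Eout C).powerset)]
  · refine Finset.sum_congr rfl fun S hS => ?_
    rw [Finset.mem_powerset] at hS
    congr 1
    unfold vS
    refine Finset.sum_congr rfl fun s _ => ?_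
    congr 1
    refine Finset.prod_congr rfl fun e he => ?_
    have := hS he
    simp only [Eout, Finset.mem_filter, Finset.mem_univ, true_and] at this
    simp only [gb, Jout, if_pos this]
  · intro S _ hS
    rw [Finset.mem_powerset, Finset.not_subset] at hS
    obtain ⟨e, he, he'⟩ := hS
    simp only [Eout, Finset.mem_filter, Finset.mem_univ, true_and] at he'
    have : vS (Jout J C) S Q = 0 := by
      unfold vS
      refine Finset.sum_eq_zero fun s _ => ?_
      rw [Finset.prod_eq_zero he, mul_zero]
      simp [gb, Jout, if_neg he']
    rw [this, zero_mul]

open Classical in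
/-- Domain Markov property of the double current. -/
lemma domain_markov (J : V × V → ℝ) (C : Finset V) {w : V} (hw : w ∈ C) {P Q : (V → Bool) → ℝ}
    (hP : ∀ s t, (∀ x ∈ C, s x = t x) → P s = P t) (hQ : ∀ s t, (∀ x ∉ C, s x = t x) → Q s = Q t) :
    ∑ S ∈ Finset.univ.filter (fun S => clu S w = C), vS J S (fun s => P s * Q s) * nS S (fun _ => 1)
    = av (Jout J C) Q *
      ∑ S ∈ Finset.univ.filter (fun S => clu S w = C), vS J S P * nS S (fun _ => 1) := by
  have hc : (0:ℝ) < (Fintype.card (V → Bool) : ℝ) := by exact_mod_cast Fintype.card_pos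
  set n : ℝ := (Fintype.card (V → Bool) : ℝ) with hn
  have gen : ∀ R : (V → Bool) → ℝ, (∀ s t, (∀ x ∉ C, s x = t x) → R s = R t) →
      n * n * ∑ S ∈ Finset.univ.filter (fun S => clu S w = C), vS J S (fun s => P s * R s) * nS S (fun _ => 1)
      = (∑ S1 ∈ (Ein C).powerset.filter (fun S => clu S w = C), vS J S1 P * nS S1 (fun _ => 1)) *
        ((Zp (Jout J C) * Zp (Jout J C)) * av (Jout J C) R) := by
    intro R hR
    rw [sum_clu_eq C hw, ← sum_out, Finset.sum_mul_sum, Finset.mul_sum]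
    refine Finset.sum_congr rfl fun S1 h1 => ?_
    rw [Finset.mul_sum]
    refine Finset.sum_congr rfl fun S2 h2 => ?_
    simp only [Finset.mem_filter, Finset.mem_powerset] at h1 h2
    have e1 := vS_factor J h1.1 h2 hP hR
    have e2 := nS_factor h1.1 h2
    rw [← hn] at e1 e2
    calc n * n * (vS J (S1 ∪ S2) (fun s => P s * R s) * nS (S1 ∪ S2) fun x => 1)
        = (n * vS J (S1 ∪ S2) (fun s => P s * R s)) * (n * nS (S1 ∪ S2) fun x => 1) := by ring
      _ = _ := by rw [e1, e2]; ring
  have g1 := gen Q hQ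
  have g2 := gen (fun _ => 1) (fun _ _ _ => rfl)
  simp only [mul_one] at g2
  rw [av_const, mul_one] at g2
  apply mul_left_cancel₀ (mul_pos hc hc).ne'
  rw [g1]
  calc _ = av (Jout J C) Q * ((∑ S1 ∈ (Ein C).powerset.filter (fun S => clu S w = C), vS J S1 P * nS S1 (fun _ => 1)) * (Zp (Jout J C) * Zp (Jout J C))) := by ring
    _ = _ := by rw [← g2]; ring

end Factor

end PartP3

section PartP4
section Corr
variable {V : Type} [Fintype V] [DecidableEq V]

lemma Jout_nonneg {J : V × V → ℝ} (hJ : ∀ e, 0 ≤ J e) (C : Finset V) (e : V × V) : 0 ≤ Jout J C e := by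
  unfold Jout; split_ifs; exacts [hJ e, le_rfl]

lemma Jout_anti {J : V × V → ℝ} (hJ : ∀ e, 0 ≤ J e) {C D : Finset V} (h : C ⊆ D) (e : V × V) :
    Jout J D e ≤ Jout J C e := by
  unfold Jout
  by_cases hd : e.1 ∉ D ∧ e.2 ∉ D
  · rw [if_pos hd, if_pos ⟨fun hh => hd.1 (h hh), fun hh => hd.2 (h hh)⟩]
  · rw [if_neg hd]; split_ifs; exacts [hJ e, le_rfl]

lemma Jout_le {J : V × V → ℝ} (hJ : ∀ e, 0 ≤ J e) (C : Finset V) (e : V × V) : Jout J C e ≤ J e := by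
  unfold Jout; split_ifs; exacts [le_rfl, hJ e]

lemma Jout_mono {J J' : V × V → ℝ} (h : ∀ e, J' e ≤ J e) (C : Finset V) (e : V × V) :
    Jout J' C e ≤ Jout J C e := by
  unfold Jout; split_ifs; exacts [h e, le_rfl]

lemma Jout_Jout (J : V × V → ℝ) (C : Finset V) (u : V) :
    Jout (Jout J C) {u} = Jout J (insert u C) := by
  funext e
  unfold Jout
  simp only [Finset.mem_singleton, Finset.mem_insert, not_or]
  split_ifs <;> tauto

lemma Jout_empty (J : V × V → ℝ) : Jout J ∅ = J := by
  funext e; simp [Jout]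

/-- two point function -/
def G2 (J : V × V → ℝ) (x y : V) : ℝ := av J (mono [x, y])

lemma G2_nonneg {J : V × V → ℝ} (hJ : ∀ e, 0 ≤ J e) (x y : V) : 0 ≤ G2 J x y := gks1 hJ _

lemma mono_self (x : V) : mono [x, x] = fun _ => (1:ℝ) := by
  funext s; rw [mono_pair, sp_sq]

lemma G2_self (J : V × V → ℝ) (x : V) : G2 J x x = 1 := by
  unfold G2; rw [mono_self, av_const]

lemma G2_comm (J : V × V → ℝ) (x y : V) : G2 J x y = G2 J y x := by
  unfold G2; congr 1; funext s; rw [mono_pair, mono_pair, mul_comm]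

lemma G2_le_one (J : V × V → ℝ) (x y : V) : G2 J x y ≤ 1 := by
  unfold G2
  calc _ ≤ av J (fun _ => 1) := av_le fun s => by rcases mono_cases [x,y] s with h | h <;> rw [h] <;> norm_num
    _ = 1 := av_const _ _

lemma mono_mid (x u z : V) : mono ([x, u] ++ [u, z]) = mono [x, z] := by
  funext s
  rw [mono_append, mono_pair, mono_pair, mono_pair]
  have := sp_sq s u
  calc sp s x * sp s u * (sp s u * sp s z) = sp s x * sp s z * (sp s u * sp s u) := by ring
    _ = _ := by rw [this, mul_one]

lemma sum_by_clu (w : V) (f : Finset (V × V) → ℝ) :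
    ∑ S : Finset (V × V), f S = ∑ C : Finset V, ∑ S ∈ Finset.univ.filter (fun S => clu S w = C), f S := by
  rw [Finset.sum_fiberwise]

lemma depends_pair {C : Finset V} {a b : V} (ha : a ∈ C) (hb : b ∈ C) (s t : V → Bool)
    (h : ∀ x ∈ C, s x = t x) : mono [a, b] s = mono [a, b] t := by
  simp only [mono_pair, sp, h a ha, h b hb]

lemma depends_pair' {C : Finset V} {a b : V} (ha : a ∉ C) (hb : b ∉ C) (s t : V → Bool)
    (h : ∀ x ∉ C, s x = t x) : mono [a, b] s = mono [a, b] t := by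
  simp only [mono_pair, sp, h a ha, h b hb]

lemma vS_pair_zero (J : V × V → ℝ) {S : Finset (V × V)} {C : Finset V} (h : clo S C) {a b : V}
    (ha : a ∈ C) (hb : b ∉ C) : vS J S (mono [a, b]) = 0 := by
  refine vS_zero J h fun s => ?_
  rw [mono_pair, mono_pair, sp_flp, sp_flp, if_pos ha, if_neg hb]; ring

lemma mono_swap (a b : V) : mono [a, b] = mono [b, a] := by
  funext s; rw [mono_pair, mono_pair, mul_comm]

lemma site_removal {J : V × V → ℝ} (hJ : ∀ e, 0 ≤ J e) (x z u : V) :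
    G2 J x z - G2 J x u * G2 J u z ≤ G2 (Jout J {u}) x z := by
  classical
  have hZ : 0 < Zp J * Zp J := mul_pos (Zp_pos J) (Zp_pos J)
  have e1 := switching_nil J (mono [x, z])
  have e2 := switching_pair J [x, u] u z
  rw [mono_mid] at e2
  have e3 := switching_nil J (fun _ => 1)
  rw [av_const, mul_one] at e3
  refine le_of_mul_le_mul_left ?_ hZ
  have : Zp J * Zp J * (G2 J x z - G2 J x u * G2 J u z)
      = ∑ S : Finset (V × V), if u ∈ clu S z then 0 else vS J S (mono [x, z]) * nS S (fun _ => 1) := by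
    rw [mul_sub]; unfold G2; rw [e1, e2, ← Finset.sum_sub_distrib]
    refine Finset.sum_congr rfl fun S _ => ?_
    split_ifs <;> ring
  rw [this, e3, sum_by_clu u, sum_by_clu u, Finset.sum_mul]
  refine Finset.sum_le_sum fun C _ => ?_
  rw [mul_comm]
  have hg := G2_nonneg (Jout_nonneg hJ {u}) x z
  have hw : 0 ≤ ∑ S ∈ Finset.univ.filter (fun S => clu S u = C), vS J S (fun _ => 1) * nS S (fun _ => 1) := by
    refine Finset.sum_nonneg fun S _ => mul_nonneg ?_ (nS_one_nonneg S)
    rw [← mono_nil_fun]; exact vS_nonneg hJ S _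
  by_cases hu : u ∈ C
  swap
  · rw [Finset.sum_eq_zero]
    · exact mul_nonneg hg hw
    · intro S hS
      simp only [Finset.mem_filter] at hS
      exact absurd (hS.2 ▸ self_mem_clu S u) hu
  by_cases hz : z ∈ C
  · rw [Finset.sum_eq_zero]
    · exact mul_nonneg hg hw
    · intro S hS
      simp only [Finset.mem_filter] at hS
      rw [if_pos]; rw [clu_symm, hS.2]; exact hz
  by_cases hx : x ∈ C
  · rw [Finset.sum_eq_zero]
    · exact mul_nonneg hg hw
    · intro S hS
      simp only [Finset.mem_filter] at hS
      rw [vS_pair_zero J (C := C) (by rw [← hS.2]; exact clo_clu S u) hx hz]; simp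
  have key := domain_markov J C hu (P := fun _ => 1) (Q := mono [x, z]) (fun _ _ _ => rfl)
    (depends_pair' hx hz)
  simp only [one_mul] at key
  have : ∑ S ∈ Finset.univ.filter (fun S => clu S u = C), (if u ∈ clu S z then 0 else vS J S (mono [x, z]) * nS S (fun _ => 1))
     = ∑ S ∈ Finset.univ.filter (fun S => clu S u = C), vS J S (mono [x, z]) * nS S (fun _ => 1) := by
    refine Finset.sum_congr rfl fun S hS => ?_
    simp only [Finset.mem_filter] at hS
    rw [if_neg]; rw [clu_symm, hS.2]; exact hz
  rw [this]
  refine key.le.trans (mul_le_mul_of_nonneg_right ?_ hw)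
  exact griffiths_mono (Jout_nonneg hJ C) (Jout_anti hJ (Finset.singleton_subset_iff.2 hu)) _

lemma G2_mono {J J' : V × V → ℝ} (hJ' : ∀ e, 0 ≤ J' e) (h : ∀ e, J' e ≤ J e) (x y : V) :
    G2 J' x y ≤ G2 J x y := griffiths_mono hJ' h _

lemma set_removal {J : V × V → ℝ} (hJ : ∀ e, 0 ≤ J e) (x z : V) (C : Finset V) :
    G2 J x z - ∑ u ∈ C, G2 J x u * G2 J u z ≤ G2 (Jout J C) x z := by
  induction C using Finset.induction_on with
  | empty => simp [Jout_empty]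
  | insert u C hu ih =>
    rw [Finset.sum_insert hu]
    have h1 := site_removal (Jout_nonneg hJ C) x z u
    rw [Jout_Jout] at h1
    have h2 : G2 (Jout J C) x u * G2 (Jout J C) u z ≤ G2 J x u * G2 J u z :=
      mul_le_mul (G2_mono (Jout_nonneg hJ C) (Jout_le hJ C) _ _) (G2_mono (Jout_nonneg hJ C) (Jout_le hJ C) _ _)
        (G2_nonneg (Jout_nonneg hJ C) _ _) (G2_nonneg hJ _ _)
    linarith

lemma bracket_nonpos {J : V × V → ℝ} (hJ : ∀ e, 0 ≤ J e) (x z : V) (C : Finset V) (h : x ∈ C ∨ z ∈ C) :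
    G2 J x z - ∑ u ∈ C, G2 J x u * G2 J u z ≤ 0 := by
  have hn : ∀ u ∈ C, 0 ≤ G2 J x u * G2 J u z := fun u _ => mul_nonneg (G2_nonneg hJ _ _) (G2_nonneg hJ _ _)
  rcases h with h | h
  · have := Finset.single_le_sum hn h
    rw [G2_self, one_mul] at this; linarith
  · have := Finset.single_le_sum hn h
    rw [G2_self, mul_one] at this; linarith

lemma mono_four (x y z w : V) (s : V → Bool) : mono [x, y, z, w] s = sp s x * sp s y * sp s z * sp s w := by
  simp only [mono, List.map_cons, List.map_nil, List.prod_cons, List.prod_nil]; ring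

/-- improved Aizenman tree inequality -/
lemma tree_ineq {J J' : V × V → ℝ} (hJ' : ∀ e, 0 ≤ J' e) (hJJ : ∀ e, J' e ≤ J e) (x y z w : V) :
    G2 J x y * G2 J z w + G2 J' x z * G2 J y w + G2 J' y z * G2 J x w
      - ∑ u, (G2 J' x u * G2 J' u z * (G2 J y u * G2 J u w) + G2 J' y u * G2 J' u z * (G2 J x u * G2 J u w))
      ≤ av J (mono [x, y, z, w]) := by
  classical
  have hJ : ∀ e, 0 ≤ J e := fun e => (hJ' e).trans (hJJ e)
  have hZ : 0 < Zp J * Zp J := mul_pos (Zp_pos J) (Zp_pos J)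
  set W : V → Finset V → ℝ := fun y C =>
    ∑ S ∈ Finset.univ.filter (fun S => clu S w = C), vS J S (mono [y, w]) * nS S (fun _ => 1) with hW
  set B : V → Finset V → ℝ := fun x C => G2 J' x z - ∑ u ∈ C, G2 J' x u * G2 J' u z with hB
  have hWn : ∀ y C, 0 ≤ W y C := fun y C =>
    Finset.sum_nonneg fun S _ => mul_nonneg (vS_nonneg hJ S _) (nS_one_nonneg S)
  have hW0 : ∀ y C, y ∉ C → W y C = 0 := by
    intro y C hy
    refine Finset.sum_eq_zero fun S hS => ?_
    simp only [Finset.mem_filter] at hS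
    rw [mono_swap, vS_pair_zero J (clo_clu S w) (self_mem_clu S w) (by rw [hS.2]; exact hy), zero_mul]
  have hsumW : ∀ y, ∑ C, W y C = Zp J * Zp J * G2 J y w := by
    intro y
    rw [hW, ← sum_by_clu, G2, switching_nil]
  have hsumU : ∀ y u, ∑ C, (if u ∈ C then W y C else 0) = Zp J * Zp J * (G2 J y u * G2 J u w) := by
    intro y u
    have e2 := switching_pair J [y, u] u w
    rw [mono_mid] at e2
    rw [G2, G2, e2, sum_by_clu w]
    refine Finset.sum_congr rfl fun C _ => ?_
    by_cases hu : u ∈ C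
    · rw [if_pos hu]
      refine Finset.sum_congr rfl fun S hS => ?_
      simp only [Finset.mem_filter] at hS
      rw [hS.2, if_pos hu]
    · rw [if_neg hu]
      symm
      refine Finset.sum_eq_zero fun S hS => ?_
      simp only [Finset.mem_filter] at hS
      rw [hS.2, if_neg hu]
  have hsumB : ∀ x y, ∑ C, B x C * W y C = Zp J * Zp J *
      (G2 J' x z * G2 J y w - ∑ u, G2 J' x u * G2 J' u z * (G2 J y u * G2 J u w)) := by
    intro x y
    calc ∑ C, B x C * W y C = ∑ C, (G2 J' x z * W y C - ∑ u, G2 J' x u * G2 J' u z * (if u ∈ C then W y C else 0)) := by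
          refine Finset.sum_congr rfl fun C _ => ?_
          rw [hB]
          simp only
          rw [sub_mul, Finset.sum_mul]
          congr 1
          rw [← Finset.sum_filter_add_sum_filter_not Finset.univ (fun u => u ∈ C) (fun u => G2 J' x u * G2 J' u z * (if u ∈ C then W y C else 0))]
          rw [Finset.sum_eq_zero (s := Finset.univ.filter (fun u => ¬ u ∈ C)), add_zero]
          · rw [Finset.filter_univ_mem]
            refine Finset.sum_congr rfl fun u hu => by rw [if_pos hu]
          · intro u hu
            simp only [Finset.mem_filter] at hu
            rw [if_neg hu.2, mul_zero]
      _ = _ := by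
          rw [Finset.sum_sub_distrib, ← Finset.mul_sum, hsumW, Finset.sum_comm]
          simp only [← Finset.mul_sum, hsumU]
          rw [mul_sub, Finset.mul_sum]
          congr 1
          · ring
          · refine Finset.sum_congr rfl fun u _ => by ring
  have hdiff : Zp J * Zp J * (av J (mono [x, y, z, w]) - G2 J x y * G2 J z w) =
      ∑ S : Finset (V × V), if z ∈ clu S w then 0 else vS J S (mono [x, y, z, w]) * nS S (fun _ => 1) := by
    have e1 := switching_nil J (mono [x, y, z, w])
    have e2 := switching_pair J [x, y] z w
    simp only [List.cons_append, List.nil_append] at e2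
    rw [mul_sub]; unfold G2; rw [e1, e2, ← Finset.sum_sub_distrib]
    refine Finset.sum_congr rfl fun S _ => ?_
    split_ifs <;> ring
  have main : ∑ C, (B x C * W y C + B y C * W x C) ≤
      Zp J * Zp J * (av J (mono [x, y, z, w]) - G2 J x y * G2 J z w) := by
    rw [hdiff, sum_by_clu w]
    refine Finset.sum_le_sum fun C _ => ?_
    have hF : 0 ≤ ∑ S ∈ Finset.univ.filter (fun S => clu S w = C),
        (if z ∈ clu S w then 0 else vS J S (mono [x, y, z, w]) * nS S (fun _ => 1)) := by
      refine Finset.sum_nonneg fun S _ => ?_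
      split_ifs
      · exact le_rfl
      · exact mul_nonneg (vS_nonneg hJ S _) (nS_one_nonneg S)
    have hneg : ∀ a b, (a ∈ C ∨ z ∈ C) → B a C * W b C ≤ 0 := fun a b h =>
      mul_nonpos_of_nonpos_of_nonneg (bracket_nonpos hJ' a z C h) (hWn b C)
    by_cases hz : z ∈ C
    · have := hneg x y (Or.inr hz); have := hneg y x (Or.inr hz); linarith
    by_cases hw : w ∈ C
    swap
    · have : ∀ b, W b C = 0 := by
        intro b
        refine Finset.sum_eq_zero fun S hS => ?_
        simp only [Finset.mem_filter] at hS
        exact absurd (hS.2 ▸ self_mem_clu S w) hw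
      rw [this, this]; linarith
    have mk : ∀ a b : V, a ∉ C → b ∈ C → (mono [x, y, z, w] : (V → Bool) → ℝ) = (fun s => mono [b, w] s * mono [a, z] s) →
        B a C * W b C ≤ ∑ S ∈ Finset.univ.filter (fun S => clu S w = C),
        (if z ∈ clu S w then 0 else vS J S (mono [x, y, z, w]) * nS S (fun _ => 1)) := by
      intro a b ha hb hm
      have key := domain_markov J C hw (P := mono [b, w]) (Q := mono [a, z]) (depends_pair hb hw) (depends_pair' ha hz)
      have : ∑ S ∈ Finset.univ.filter (fun S => clu S w = C), (if z ∈ clu S w then 0 else vS J S (mono [x, y, z, w]) * nS S (fun _ => 1))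
          = ∑ S ∈ Finset.univ.filter (fun S => clu S w = C), vS J S (fun s => mono [b, w] s * mono [a, z] s) * nS S (fun _ => 1) := by
        refine Finset.sum_congr rfl fun S hS => ?_
        simp only [Finset.mem_filter] at hS
        rw [if_neg (by rw [hS.2]; exact hz), hm]
      rw [this, key]
      refine mul_le_mul_of_nonneg_right ?_ (hWn b C)
      exact (set_removal hJ' a z C).trans (G2_mono (Jout_nonneg hJ' C) (Jout_mono hJJ C) a z)
    by_cases hx : x ∈ C
    · have h1 := hneg x y (Or.inl hx)
      by_cases hy : y ∈ C
      · have := hneg y x (Or.inl hy); linarith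
      · have := mk y x hy hx (by funext s; rw [mono_four, mono_pair, mono_pair]; ring)
        linarith
    · by_cases hy : y ∈ C
      · have h1 := hneg y x (Or.inl hy)
        have := mk x y hx hy (by funext s; rw [mono_four, mono_pair, mono_pair]; ring)
        linarith
      · rw [hW0 x C hx, hW0 y C hy]; linarith
  rw [Finset.sum_add_distrib, hsumB, hsumB, ← mul_add] at main
  have := le_of_mul_le_mul_left main hZ
  rw [Finset.sum_add_distrib]
  linarith

end Corr

end PartP4

section PartP5
section Newman
variable {V : Type} [Fintype V] [DecidableEq V]

lemma mono_map_toList {ι : Type} [DecidableEq ι] (T : Finset ι) (b : ι → V) (s : V → Bool) :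
    mono (T.toList.map b) s = ∏ i ∈ T, sp s (b i) := by
  unfold mono
  rw [List.map_map, ← Finset.prod_map_toList]; rfl

lemma newman {J : V × V → ℝ} (hJ : ∀ e, 0 ≤ J e) {m : ℕ} (a : V) (b : Fin m → V) :
    av J (fun s => sp s a * ∏ i, sp s (b i)) ≤
      ∑ j, av J (fun s => sp s a * sp s (b j)) * av J (fun s => ∏ i ∈ Finset.univ.erase j, sp s (b i)) := by
  classical
  have hZ : 0 < Zp J * Zp J := mul_pos (Zp_pos J) (Zp_pos J)
  refine le_of_mul_le_mul_left ?_ hZ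
  have hF : (fun s => sp s a * ∏ i, sp s (b i)) = mono (a :: ((Finset.univ : Finset (Fin m)).toList.map b)) := by
    funext s; rw [mono_cons, mono_map_toList]
  have e1 := switching_nil J (fun s => sp s a * ∏ i, sp s (b i))
  have e2 : ∀ j, Zp J * Zp J * (av J (fun s => sp s a * sp s (b j)) * av J (fun s => ∏ i ∈ Finset.univ.erase j, sp s (b i)))
      = ∑ S : Finset (V × V), if b j ∈ clu S a then vS J S (fun s => sp s a * ∏ i, sp s (b i)) * nS S (fun _ => 1) else 0 := by
    intro j
    have := switching_pair J ((Finset.univ.erase j).toList.map b) (b j) a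
    have h1 : (mono ((Finset.univ.erase j).toList.map b) : (V → Bool) → ℝ) = fun s => ∏ i ∈ Finset.univ.erase j, sp s (b i) := by
      funext s; rw [mono_map_toList]
    have h2 : (mono [b j, a] : (V → Bool) → ℝ) = fun s => sp s a * sp s (b j) := by
      funext s; rw [mono_pair, mul_comm]
    have h3 : (mono ((Finset.univ.erase j).toList.map b ++ [b j, a]) : (V → Bool) → ℝ) = fun s => sp s a * ∏ i, sp s (b i) := by
      funext s; rw [mono_append, mono_map_toList, mono_pair, ← Finset.prod_erase_mul _ _ (Finset.mem_univ j)]; ring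
    rw [h1, h2, h3] at this
    rw [← this]; ring
  rw [Finset.mul_sum, e1]
  simp only [e2]
  rw [Finset.sum_comm]
  refine Finset.sum_le_sum fun S _ => ?_
  have hn : 0 ≤ vS J S (fun s => sp s a * ∏ i, sp s (b i)) * nS S (fun _ => 1) := by
    rw [hF]; exact mul_nonneg (vS_nonneg hJ S _) (nS_one_nonneg S)
  by_cases h : ∃ j, b j ∈ clu S a
  · obtain ⟨j, hj⟩ := h
    have := Finset.single_le_sum (f := fun j => if b j ∈ clu S a then vS J S (fun s => sp s a * ∏ i, sp s (b i)) * nS S (fun _ => 1) else 0)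
      (s := Finset.univ) (fun i _ => by split_ifs <;> first | exact hn | exact le_rfl) (Finset.mem_univ j)
    simp only [if_pos hj] at this
    exact this
  · push Not at h
    have : vS J S (fun s => sp s a * ∏ i, sp s (b i)) = 0 := by
      refine vS_zero J (clo_clu S a) fun s => ?_
      rw [sp_flp, if_pos (self_mem_clu S a)]
      have : ∀ i, sp (flp (clu S a) s) (b i) = sp s (b i) := fun i => by
        rw [sp_flp, if_neg (h i)]
      simp only [this]; ring
    rw [this, zero_mul]
    exact Finset.sum_nonneg fun i _ => by split_ifs <;> simp

/-- linear field -/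
def lin (c : V → ℝ) (s : V → Bool) : ℝ := ∑ z, c z * sp s z

lemma prod_lin {m : ℕ} (c : V → ℝ) (s : Fin m → V → Bool) :
    ∏ i, lin c (s i) = ∑ b : Fin m → V, ∏ i, (c (b i) * sp (s i) (b i)) := by
  unfold lin
  rw [Finset.prod_univ_sum]
  simp

lemma av_two (J : V × V → ℝ) (F H : (V → Bool) → ℝ) :
    av J F * av J H = (∑ s, ∑ t, wt J s * wt J t * (F s * H t)) / (Zp J * Zp J) := by
  unfold av
  rw [div_mul_div_comm, Finset.sum_mul_sum]
  congr 1
  refine Finset.sum_congr rfl fun s _ => Finset.sum_congr rfl fun t _ => by ring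

lemma newman_lin {J : V × V → ℝ} (hJ : ∀ e, 0 ≤ J e) (m : ℕ) (a : V) {c : V → ℝ} (hc : ∀ v, 0 ≤ c v) :
    av J (fun s => sp s a * lin c s ^ m) ≤ m * (av J (fun s => sp s a * lin c s) * av J (fun s => lin c s ^ (m - 1))) := by
  classical
  have e1 : av J (fun s => sp s a * lin c s ^ m) =
      ∑ b : Fin m → V, (∏ i, c (b i)) * av J (fun s => sp s a * ∏ i, sp s (b i)) := by
    simp only [← av_const_mul]
    rw [← av_sum]
    congr 1; funext s
    have := prod_lin c (fun _ : Fin m => s)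
    simp only [Finset.prod_const, Finset.card_univ, Fintype.card_fin] at this
    rw [this, Finset.mul_sum]
    refine Finset.sum_congr rfl fun b _ => ?_
    rw [Finset.prod_mul_distrib]; ring
  have e2 : ∀ j : Fin m, ∑ b : Fin m → V, (∏ i, c (b i)) *
      (av J (fun s => sp s a * sp s (b j)) * av J (fun s => ∏ i ∈ Finset.univ.erase j, sp s (b i)))
      = av J (fun s => sp s a * lin c s) * av J (fun s => lin c s ^ (m - 1)) := by
    intro j
    simp only [av_two]
    simp only [← mul_div_assoc]
    rw [← Finset.sum_div]
    congr 1
    simp only [Finset.mul_sum]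
    rw [Finset.sum_comm]
    refine Finset.sum_congr rfl fun s _ => ?_
    rw [Finset.sum_comm]
    refine Finset.sum_congr rfl fun t _ => ?_
    have := prod_lin c (fun i : Fin m => if i = j then s else t)
    have h1 : ∏ i, lin c (if i = j then s else t) = lin c s * lin c t ^ (m - 1) := by
      rw [← Finset.mul_prod_erase _ _ (Finset.mem_univ j), if_pos rfl]
      congr 1
      rw [Finset.prod_congr rfl (g := fun _ => lin c t)]
      · rw [Finset.prod_const, Finset.card_erase_of_mem (Finset.mem_univ j), Finset.card_univ, Fintype.card_fin]
      · intro i hi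
        rw [if_neg (Finset.ne_of_mem_erase hi)]
    rw [h1] at this
    calc _ = wt J s * wt J t * sp s a * ∑ b : Fin m → V, ∏ i, (c (b i) * sp (if i = j then s else t) (b i)) := by
          rw [Finset.mul_sum]
          refine Finset.sum_congr rfl fun b _ => ?_
          rw [Finset.prod_mul_distrib, ← Finset.mul_prod_erase _ (fun i => sp (if i = j then s else t) (b i)) (Finset.mem_univ j), if_pos rfl]
          have hh : ∏ i ∈ Finset.univ.erase j, sp (if i = j then s else t) (b i) = ∏ i ∈ Finset.univ.erase j, sp t (b i) := by
            refine Finset.prod_congr rfl fun i hi => ?_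
            rw [if_neg (Finset.ne_of_mem_erase hi)]
          rw [hh]; ring
      _ = _ := by rw [← this]; ring
  rw [e1]
  calc _ ≤ ∑ b : Fin m → V, (∏ i, c (b i)) * ∑ j, av J (fun s => sp s a * sp s (b j)) * av J (fun s => ∏ i ∈ Finset.univ.erase j, sp s (b i)) :=
        Finset.sum_le_sum fun b _ => mul_le_mul_of_nonneg_left (newman hJ a b) (Finset.prod_nonneg fun i _ => hc _)
    _ = _ := by
        simp only [Finset.mul_sum]
        rw [Finset.sum_comm]
        simp only [e2]
        simp

lemma newman_pow {J : V × V → ℝ} (hJ : ∀ e, 0 ≤ J e) (m : ℕ) {c : V → ℝ} (hc : ∀ v, 0 ≤ c v) :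
    av J (fun s => lin c s ^ (m+1)) ≤ m * (av J (fun s => lin c s ^ 2) * av J (fun s => lin c s ^ (m - 1))) := by
  have e1 : ∀ k, av J (fun s => lin c s ^ (k+1)) = ∑ a, c a * av J (fun s => sp s a * lin c s ^ k) := by
    intro k
    simp only [← av_const_mul]
    rw [← av_sum]
    congr 1; funext s
    rw [pow_succ']
    have : lin c s = ∑ z, c z * sp s z := rfl
    nth_rw 1 [this]
    rw [Finset.sum_mul]
    refine Finset.sum_congr rfl fun a _ => by ring
  rw [e1, e1 1]
  calc _ ≤ ∑ a, c a * (m * (av J (fun s => sp s a * lin c s) * av J (fun s => lin c s ^ (m - 1)))) :=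
        Finset.sum_le_sum fun a _ => mul_le_mul_of_nonneg_left (newman_lin hJ m a hc) (hc a)
    _ = _ := by
        simp only [pow_one]
        rw [Finset.sum_mul, Finset.mul_sum]
        refine Finset.sum_congr rfl fun a _ => by ring

lemma moment4 {J : V × V → ℝ} (hJ : ∀ e, 0 ≤ J e) {c : V → ℝ} (hc : ∀ v, 0 ≤ c v) :
    av J (fun s => lin c s ^ 4) ≤ 3 * av J (fun s => lin c s ^ 2) ^ 2 := by
  have := newman_pow hJ 3 hc
  norm_num at this; linarith [this]

lemma moment6 {J : V × V → ℝ} (hJ : ∀ e, 0 ≤ J e) {c : V → ℝ} (hc : ∀ v, 0 ≤ c v) :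
    av J (fun s => lin c s ^ 6) ≤ 15 * av J (fun s => lin c s ^ 2) ^ 3 := by
  have h := newman_pow hJ 5 hc
  have h4 := moment4 hJ hc
  norm_num at h
  have h2 : 0 ≤ av J (fun s => lin c s ^ 2) := av_nonneg fun s => sq_nonneg _
  nlinarith [mul_le_mul_of_nonneg_left h4 h2]

end Newman

end PartP5

section PartP6
section Ghost
variable {V : Type} [Fintype V] [DecidableEq V]

/-- average with a uniform field -/
def avb (J : V × V → ℝ) (b : ℝ) (F : (V → Bool) → ℝ) : ℝ :=
  (∑ s, wt J s * Real.exp (b * ∑ x, sp s x) * F s) / (∑ s, wt J s * Real.exp (b * ∑ x, sp s x))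

lemma avb_zero (J : V × V → ℝ) (F : (V → Bool) → ℝ) : avb J 0 F = av J F := by
  simp [avb, av, Zp]

def Jg (J : V × V → ℝ) (b : ℝ) : Option V × Option V → ℝ
  | (some x, some y) => J (x, y)
  | (some _, none) => b
  | (none, _) => 0

def gequiv : Bool × (V → Bool) ≃ (Option V → Bool) where
  toFun p := fun o => match o with
    | none => p.1
    | some x => (p.2 x == p.1)
  invFun s := (s none, fun x => (s (some x) == s none))
  left_inv p := by
    obtain ⟨g, s⟩ := p
    ext x
    · rfl
    · simp only; cases s x <;> cases g <;> rfl
  right_inv s := by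
    funext o
    cases o with
    | none => rfl
    | some x => simp only; cases s (some x) <;> cases s none <;> rfl

lemma sp_gequiv_none (g : Bool) (s : V → Bool) : sp (gequiv (g, s)) none = spin g := rfl
lemma sp_gequiv_some (g : Bool) (s : V → Bool) (x : V) : sp (gequiv (g, s)) (some x) = sp s x * spin g := by
  change spin (s x == g) = _
  rw [spin_mul]; rfl

lemma wt_gequiv (J : V × V → ℝ) (b : ℝ) (g : Bool) (s : V → Bool) :
    wt (Jg J b) (gequiv (g, s)) = wt J s * Real.exp (b * ∑ x, sp s x) := by
  unfold wt
  rw [← Real.exp_add]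
  congr 1
  rw [Fintype.sum_prod_type, Fintype.sum_option]
  simp only [Fintype.sum_option, Jg, bd, sp_gequiv_none, sp_gequiv_some, zero_mul, Finset.sum_const_zero, zero_add]
  rw [Finset.sum_add_distrib, Fintype.sum_prod_type, Finset.mul_sum, add_comm]
  have hg := spin_sq g
  congr 1
  · refine Finset.sum_congr rfl fun x _ => Finset.sum_congr rfl fun y _ => ?_
    calc _ = J (x, y) * (sp s x * sp s y) * (spin g * spin g) := by ring
      _ = _ := by rw [hg, mul_one]
  · refine Finset.sum_congr rfl fun x _ => ?_
    calc _ = b * sp s x * (spin g * spin g) := by ring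
      _ = _ := by rw [hg, mul_one]

lemma av_ghost (J : V × V → ℝ) (b : ℝ) (F : (V → Bool) → ℝ) (H : (Option V → Bool) → ℝ)
    (h : ∀ g s, H (gequiv (g, s)) = F s) : av (Jg J b) H = avb J b F := by
  unfold av avb Zp
  rw [← gequiv.sum_comp, ← gequiv.sum_comp (fun s => wt (Jg J b) s)]
  rw [Fintype.sum_prod_type, Fintype.sum_prod_type]
  simp only [wt_gequiv, h]
  rw [Finset.sum_const, Finset.sum_const, Finset.card_univ, Fintype.card_bool]
  simp only [nsmul_eq_mul]
  rw [mul_div_mul_left]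
  norm_num

lemma Jg_nonneg {J : V × V → ℝ} (hJ : ∀ e, 0 ≤ J e) {b : ℝ} (hb : 0 ≤ b) (e : Option V × Option V) : 0 ≤ Jg J b e := by
  rcases e with ⟨_ | x, _ | y⟩ <;> simp [Jg, hb, hJ]

lemma Jout_Jg (J : V × V → ℝ) (b : ℝ) : Jout (Jg J b) {none} = Jg J 0 := by
  funext e
  rcases e with ⟨_ | x, _ | y⟩ <;> simp [Jout, Jg]

lemma G2_ghost_pair (J : V × V → ℝ) (b : ℝ) (x y : V) :
    G2 (Jg J b) (some x) (some y) = avb J b (fun s => sp s x * sp s y) := by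
  refine av_ghost J b _ _ fun g s => ?_
  rw [mono_pair, sp_gequiv_some, sp_gequiv_some]
  have hg := spin_sq g
  calc _ = (sp s x * sp s y) * (spin g * spin g) := by ring
    _ = _ := by rw [hg, mul_one]

lemma G2_ghost_one (J : V × V → ℝ) (b : ℝ) (x : V) :
    G2 (Jg J b) (some x) none = avb J b (fun s => sp s x) := by
  refine av_ghost J b _ _ fun g s => ?_
  rw [mono_pair, sp_gequiv_some, sp_gequiv_none]
  have hg := spin_sq g
  calc _ = (sp s x) * (spin g * spin g) := by ring
    _ = _ := by rw [hg, mul_one]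

/-- truncated correlations in a nonnegative field are nonnegative and bounded by the zero field ones -/
lemma field_bound {J : V × V → ℝ} (hJ : ∀ e, 0 ≤ J e) {b : ℝ} (hb : 0 ≤ b) (x y : V) :
    0 ≤ avb J b (fun s => sp s x * sp s y) - avb J b (fun s => sp s x) * avb J b (fun s => sp s y) ∧
    avb J b (fun s => sp s x * sp s y) - avb J b (fun s => sp s x) * avb J b (fun s => sp s y) ≤ G2 J x y := by
  have hJg := Jg_nonneg hJ hb
  have h1 := site_removal hJg (some x) (some y) none
  rw [Jout_Jg, G2_ghost_pair, G2_ghost_pair, G2_comm _ none, G2_ghost_one, G2_ghost_one, avb_zero] at h1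
  have h2 := gks2 hJg [some x, none] [none, some y]
  rw [mono_mid] at h2
  change G2 _ _ _ * G2 _ _ _ ≤ G2 _ _ _ at h2
  rw [G2_ghost_pair, G2_comm _ none, G2_ghost_one, G2_ghost_one] at h2
  refine ⟨by linarith, h1.trans_eq ?_⟩
  unfold G2; congr 1; funext s; rw [mono_pair]

end Ghost

end PartP6

section PartP7
/-- abstract Kac kernel data on a finite abelian group -/
structure KD (V : Type) [Fintype V] [DecidableEq V] [AddCommGroup V] (c0 C0 : ℝ) where
  γ : ℝ
  k : V → ℝ
  co : V → V → ℝ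
  w : V → ℝ
  c0_pos : 0 < c0
  c0_le : c0 ≤ 1
  C0_ge : 1 ≤ C0
  γ_pos : 0 < γ
  γ_lt : γ < 1
  hn : (Fintype.card V : ℝ) * γ ^ 4 = 4
  k_nonneg : ∀ x, 0 ≤ k x
  k_zero : k 0 = 0
  k_even : ∀ x, k (-x) = k x
  k_sum : ∑ x, k x = 1
  k_le : ∀ x, k x ≤ C0 * γ ^ 2
  co_symm : ∀ x y, co x y = co y x
  co_zero : ∀ x, co x 0 = 1
  co_abs : ∀ x y, |co x y| ≤ 1
  co_mul : ∀ w x y, co w (x + y) + co w (x - y) = 2 * (co w x * co w y)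
  co_sum : ∀ x, ∑ y, co x y = if x = 0 then (Fintype.card V : ℝ) else 0
  w_ge : ∀ x, x ≠ 0 → 1 ≤ w x
  w_sum : ∑ x ∈ Finset.univ.erase 0, ((w x) ^ 3)⁻¹ ≤ C0
  gap : ∀ x, x ≠ 0 → c0 * min 1 (γ ^ 2 * w x ^ 2) ≤ 1 - ∑ y, k y * co x y

section Conv
variable {V : Type} [Fintype V] [DecidableEq V] [AddCommGroup V]

def conv (f h : V → ℝ) (x : V) : ℝ := ∑ y, f (x - y) * h y

def Even' (f : V → ℝ) : Prop := ∀ x, f (-x) = f x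

lemma conv_comm (f h : V → ℝ) : conv f h = conv h f := by
  funext x
  unfold conv
  rw [← Equiv.sum_comp (Equiv.subLeft x)]
  refine Finset.sum_congr rfl fun y _ => ?_
  simp [mul_comm]

lemma conv_assoc (f h l : V → ℝ) : conv (conv f h) l = conv f (conv h l) := by
  funext x
  unfold conv
  simp only [Finset.sum_mul, Finset.mul_sum]
  rw [Finset.sum_comm]
  conv_rhs => rw [Finset.sum_comm]
  conv_lhs => rw [Finset.sum_comm]
  refine Finset.sum_congr rfl fun y _ => ?_
  rw [← Equiv.sum_comp (Equiv.subRight y)]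
  refine Finset.sum_congr rfl fun z _ => ?_
  simp only [Equiv.subRight_apply]
  rw [show x - y - (z - y) = x - z by abel]; ring

lemma conv_even {f h : V → ℝ} (hf : Even' f) (hh : Even' h) : Even' (conv f h) := by
  intro x
  unfold conv
  rw [← Equiv.sum_comp (Equiv.neg V)]
  refine Finset.sum_congr rfl fun y _ => ?_
  simp only [Equiv.neg_apply]
  rw [hh, ← hf (x - y)]; congr 2; abel

lemma conv_nonneg {f h : V → ℝ} (hf : ∀ x, 0 ≤ f x) (hh : ∀ x, 0 ≤ h x) (x : V) : 0 ≤ conv f h x :=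
  Finset.sum_nonneg fun y _ => mul_nonneg (hf _) (hh _)

lemma conv_mono {f h l : V → ℝ} (hf : ∀ x, 0 ≤ f x) (hh : ∀ x, h x ≤ l x) (x : V) : conv f h x ≤ conv f l x :=
  Finset.sum_le_sum fun y _ => mul_le_mul_of_nonneg_left (hh _) (hf _)

lemma conv_add (f h l : V → ℝ) (x : V) : conv f (fun y => h y + l y) x = conv f h x + conv f l x := by
  unfold conv; rw [← Finset.sum_add_distrib]; exact Finset.sum_congr rfl fun y _ => by ring

lemma conv_smul (f h : V → ℝ) (c : ℝ) (x : V) : conv f (fun y => c * h y) x = c * conv f h x := by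
  unfold conv; rw [Finset.mul_sum]; exact Finset.sum_congr rfl fun y _ => by ring

lemma sum_sub_left (f : V → ℝ) (x : V) : ∑ y, f (x - y) = ∑ y, f y :=
  Equiv.sum_comp (Equiv.subLeft x) f

lemma conv_const (f : V → ℝ) (c : ℝ) (x : V) : conv f (fun _ => c) x = c * ∑ y, f y := by
  unfold conv; rw [← Finset.sum_mul, sum_sub_left, mul_comm]

def del (x : V) : ℝ := if x = 0 then 1 else 0

lemma conv_del (f : V → ℝ) : conv f del = f := by
  funext x; unfold conv del; simp

lemma conv_sum (f h : V → ℝ) : ∑ x, conv f h x = (∑ x, f x) * ∑ x, h x := by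
  unfold conv
  rw [Finset.sum_comm, Finset.mul_sum]
  refine Finset.sum_congr rfl fun y _ => ?_
  rw [← Finset.sum_mul]
  congr 1
  exact Equiv.sum_comp (Equiv.subRight y) f

lemma conv_zero_even {f h : V → ℝ} (hf : Even' f) : conv f h 0 = ∑ y, f y * h y := by
  unfold conv
  refine Finset.sum_congr rfl fun y _ => by rw [zero_sub, hf]

/-- Young with sup -/
lemma conv_le_sup {f h : V → ℝ} (hf : ∀ x, 0 ≤ f x) {B : ℝ} (hh : ∀ x, h x ≤ B) (x : V) :
    conv f h x ≤ (∑ y, f y) * B := by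
  calc conv f h x ≤ conv f (fun _ => B) x := conv_mono hf hh x
    _ = _ := by rw [conv_const, mul_comm]

lemma conv_cs {f h : V → ℝ} {a b : ℝ} (hf : ∑ x, f x ^ 2 ≤ a) (hh : ∑ x, h x ^ 2 ≤ b) (x : V) :
    conv f h x ≤ (a + b) / 2 := by
  have : ∀ y, f (x - y) * h y ≤ (f (x - y) ^ 2 + h y ^ 2) / 2 := fun y => by nlinarith [sq_nonneg (f (x - y) - h y)]
  calc conv f h x ≤ ∑ y, (f (x - y) ^ 2 + h y ^ 2) / 2 := Finset.sum_le_sum fun y _ => this y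
    _ = (∑ y, f (x - y) ^ 2 + ∑ y, h y ^ 2) / 2 := by rw [← Finset.sum_div, Finset.sum_add_distrib]
    _ = (∑ y, f y ^ 2 + ∑ y, h y ^ 2) / 2 := by rw [sum_sub_left (fun z => f z ^ 2) x]
    _ ≤ _ := by linarith

/-- maximum principle -/
lemma max_principle {k e : V → ℝ} (hk : ∀ x, 0 ≤ k x) (hk1 : ∑ x, k x = 1) {b : ℝ} (hb0 : 0 ≤ b) (hb : b < 1)
    (he : ∀ x, e x ≤ b * conv k e x) (x : V) : e x ≤ 0 := by
  obtain ⟨x0, _, h0⟩ := Finset.exists_max_image Finset.univ e ⟨x, Finset.mem_univ x⟩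
  have h1 : conv k e x0 ≤ e x0 := by
    have := conv_le_sup hk (h := e) (B := e x0) (fun y => h0 y (Finset.mem_univ y)) x0
    rwa [hk1, one_mul] at this
  have h2 : e x0 ≤ b * e x0 := (he x0).trans (mul_le_mul_of_nonneg_left h1 hb0)
  have h3 : e x0 ≤ 0 := by nlinarith
  exact (h0 x (Finset.mem_univ x)).trans h3

end Conv

namespace KD
variable {V : Type} [Fintype V] [DecidableEq V] [AddCommGroup V] {c0 C0 : ℝ} (D : KD V c0 C0)

def n (_ : KD V c0 C0) : ℝ := Fintype.card V
/-- Fourier transform -/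
def hat (f : V → ℝ) (ω : V) : ℝ := ∑ x, f x * D.co ω x
def κ (ω : V) : ℝ := D.hat D.k ω
def cg : ℝ := (1/4) * ∑ ω ∈ Finset.univ.erase 0, D.κ ω ^ 2 * D.γ ^ 2 / (1 - D.κ ω)
def g : ℝ := D.γ ^ 2

lemma g_pos : 0 < D.g := pow_pos D.γ_pos 2
lemma g_lt : D.g < 1 := by have := D.γ_pos; have := D.γ_lt; unfold g; nlinarith
lemma g_le_γ : D.g ≤ D.γ := by have := D.γ_pos; have := D.γ_lt; unfold g; nlinarith
lemma n_pos : 0 < D.n := by unfold n; exact_mod_cast Fintype.card_pos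
lemma n_inv : (D.n)⁻¹ = D.g ^ 2 / 4 := by
  have h := D.hn; have := D.n_pos
  unfold g
  have e : D.n * D.γ ^ 4 = 4 := h
  field_simp
  nlinarith
lemma n_eq : D.n * D.g ^ 2 = 4 := by have := D.hn; unfold n g; rw [← this]; ring

lemma co_even (ω x : V) : D.co ω (-x) = D.co ω x := by
  have h := D.co_mul ω 0 x
  rw [D.co_zero] at h
  simp only [zero_add, zero_sub] at h
  linarith

lemma co_even' (ω x : V) : D.co (-ω) x = D.co ω x := by
  rw [D.co_symm, D.co_even, D.co_symm]

lemma co_mul' (ω η x : V) : D.co (ω + η) x + D.co (ω - η) x = 2 * (D.co ω x * D.co η x) := by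
  rw [D.co_symm (ω + η), D.co_symm (ω - η), D.co_mul, D.co_symm x, D.co_symm x]

lemma hat_even (f : V → ℝ) : Even' (D.hat f) := fun ω => by
  unfold hat; exact Finset.sum_congr rfl fun x _ => by rw [D.co_even']

lemma hat_hat {f : V → ℝ} (hf : Even' f) (x : V) : D.hat (D.hat f) x = D.n * f x := by
  unfold hat
  simp only [Finset.sum_mul]
  rw [Finset.sum_comm]
  have : ∀ y, ∑ ω, f y * D.co ω y * D.co x ω = f y * ((if x + y = 0 then D.n else 0) + (if x - y = 0 then D.n else 0)) / 2 := by
    intro y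
    have h1 := D.co_sum (x + y); have h2 := D.co_sum (x - y)
    unfold n
    rw [← h1, ← h2, ← Finset.sum_add_distrib, Finset.mul_sum, Finset.sum_div]
    refine Finset.sum_congr rfl fun ω _ => ?_
    rw [D.co_mul' x y ω, D.co_symm ω y]; ring
  simp only [this, ← Finset.sum_div, mul_add, Finset.sum_add_distrib]
  have e1 : ∀ y, (x + y = 0) ↔ y = -x := fun y => by rw [add_comm]; exact add_eq_zero_iff_eq_neg
  have e2 : ∀ y, (x - y = 0) ↔ y = x := fun y => by rw [sub_eq_zero]; exact eq_comm
  simp only [e1, e2, mul_ite, mul_zero, Finset.sum_ite_eq', Finset.mem_univ, if_true]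
  rw [hf]; ring

lemma conv_co {f : V → ℝ} (hf : Even' f) (ω x : V) : conv f (D.co ω) x = D.hat f ω * D.co ω x := by
  rw [conv_comm]
  unfold conv hat
  have h2 : ∑ y, D.co ω (x - y) * f y = ∑ y, D.co ω (x + y) * f y := by
    rw [← Equiv.sum_comp (Equiv.neg V)]
    refine Finset.sum_congr rfl fun y _ => ?_
    simp [hf y]
  have h3 : ∑ y, D.co ω (x - y) * f y = (∑ y, (D.co ω (x + y) + D.co ω (x - y)) * f y) / 2 := by
    simp only [add_mul, Finset.sum_add_distrib]; rw [← h2]; ring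
  rw [h3, Finset.sum_div, Finset.sum_mul]
  refine Finset.sum_congr rfl fun y _ => ?_
  rw [D.co_mul]; ring

/-- synthesis -/
def syn (a : V → ℝ) (x : V) : ℝ := (D.n)⁻¹ * ∑ ω, a ω * D.co ω x

lemma syn_eq (a : V → ℝ) (x : V) : D.syn a x = (D.n)⁻¹ * D.hat a x := by
  unfold syn hat; congr 1; exact Finset.sum_congr rfl fun ω _ => by rw [D.co_symm]

lemma syn_even (a : V → ℝ) : Even' (D.syn a) := fun x => by rw [syn_eq, syn_eq, hat_even]

lemma hat_syn {a : V → ℝ} (ha : Even' a) (ω : V) : D.hat (D.syn a) ω = a ω := by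
  have : D.syn a = fun x => (D.n)⁻¹ * D.hat a x := by funext x; rw [syn_eq]
  rw [this]
  have h := D.hat_hat ha ω
  have : D.hat (fun x => (D.n)⁻¹ * D.hat a x) ω = (D.n)⁻¹ * D.hat (D.hat a) ω := by
    unfold hat; rw [Finset.mul_sum]; exact Finset.sum_congr rfl fun x _ => by ring
  rw [this, h, inv_mul_cancel_left₀ D.n_pos.ne']

lemma syn_hat {f : V → ℝ} (hf : Even' f) (x : V) : D.syn (D.hat f) x = f x := by
  rw [syn_eq, D.hat_hat hf, inv_mul_cancel_left₀ D.n_pos.ne']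

lemma conv_syn {f : V → ℝ} (hf : Even' f) (a : V → ℝ) : conv f (D.syn a) = D.syn (fun ω => D.hat f ω * a ω) := by
  funext x
  have : conv f (D.syn a) x = (D.n)⁻¹ * ∑ ω, a ω * conv f (D.co ω) x := by
    unfold conv syn
    simp only [Finset.mul_sum]
    rw [Finset.sum_comm]
    refine Finset.sum_congr rfl fun ω _ => Finset.sum_congr rfl fun y _ => by ring
  rw [this]; unfold syn; congr 1
  refine Finset.sum_congr rfl fun ω _ => ?_
  rw [D.conv_co hf]; ring

lemma planch {a : V → ℝ} (ha : Even' a) : ∑ x, D.syn a x ^ 2 = (D.n)⁻¹ * ∑ ω, a ω ^ 2 := by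
  have h1 : ∑ x, D.syn a x ^ 2 = (D.n)⁻¹ * ∑ ω, a ω * D.hat (D.syn a) ω := by
    have : ∀ x, D.syn a x ^ 2 = ∑ ω, (D.n)⁻¹ * (a ω * (D.syn a x * D.co ω x)) := by
      intro x
      rw [sq]; nth_rw 1 [syn]
      rw [mul_assoc, Finset.sum_mul, Finset.mul_sum]
      exact Finset.sum_congr rfl fun ω _ => by ring
    simp only [this]
    rw [Finset.sum_comm, Finset.mul_sum]
    refine Finset.sum_congr rfl fun ω _ => ?_
    unfold hat; rw [Finset.mul_sum, Finset.mul_sum]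
  rw [h1]; congr 1
  exact Finset.sum_congr rfl fun ω _ => by rw [D.hat_syn ha]; ring

lemma hat_zero (f : V → ℝ) : D.hat f 0 = ∑ x, f x := by
  unfold hat; exact Finset.sum_congr rfl fun x _ => by rw [D.co_symm, D.co_zero, mul_one]

lemma κ_zero : D.κ 0 = 1 := by unfold κ; rw [hat_zero, D.k_sum]
lemma κ_even : Even' D.κ := D.hat_even _
lemma κ_abs (ω : V) : |D.κ ω| ≤ 1 := by
  unfold κ hat
  calc _ ≤ ∑ x, |D.k x * D.co ω x| := Finset.abs_sum_le_sum_abs _ _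
    _ ≤ ∑ x, D.k x := Finset.sum_le_sum fun x _ => by
        rw [abs_mul, abs_of_nonneg (D.k_nonneg x)]
        exact mul_le_of_le_one_right (D.k_nonneg x) (D.co_abs _ _)
    _ = 1 := D.k_sum
lemma κ_le (ω : V) : D.κ ω ≤ 1 := (abs_le.1 (D.κ_abs ω)).2
lemma κ_ge (ω : V) : -1 ≤ D.κ ω := (abs_le.1 (D.κ_abs ω)).1
lemma κ_sq_le (ω : V) : D.κ ω ^ 2 ≤ 1 := by have := D.κ_le ω; have := D.κ_ge ω; nlinarith
lemma κ_gap (ω : V) (h : ω ≠ 0) : c0 * min 1 (D.g * D.w ω ^ 2) ≤ 1 - D.κ ω := D.gap ω h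
lemma κ_lt (ω : V) (h : ω ≠ 0) : 0 < 1 - D.κ ω := by
  refine lt_of_lt_of_le ?_ (D.κ_gap ω h)
  have := D.w_ge ω h
  have := D.g_pos
  exact mul_pos D.c0_pos (lt_min one_pos (by positivity))

lemma cg_nonneg : 0 ≤ D.cg := by
  unfold cg
  refine mul_nonneg (by norm_num) (Finset.sum_nonneg fun ω hω => ?_)
  exact div_nonneg (by positivity) (D.κ_lt ω (Finset.ne_of_mem_erase hω)).le

lemma κ_sum : (D.n)⁻¹ * ∑ ω, D.κ ω ^ 2 ≤ C0 * D.g := by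
  have h1 := D.planch D.κ_even
  rw [← h1]
  have : ∀ x, D.syn D.κ x = D.k x := fun x => D.syn_hat D.k_even x
  simp only [this]
  calc ∑ x, D.k x ^ 2 ≤ ∑ x, D.k x * (C0 * D.g) := Finset.sum_le_sum fun x _ => by
        rw [sq]; exact mul_le_mul_of_nonneg_left (D.k_le x) (D.k_nonneg x)
    _ = _ := by rw [← Finset.sum_mul, D.k_sum, one_mul]

end KD

end PartP7

section PartP8
namespace KD
variable {V : Type} [Fintype V] [DecidableEq V] [AddCommGroup V] {c0 C0 : ℝ} (D : KD V c0 C0)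

def aa (b : ℝ) (ω : V) : ℝ := D.κ ω / (1 - b * D.κ ω)
/-- massive Green function of the Kac random walk -/
def ff (b : ℝ) : V → ℝ := D.syn (D.aa b)

lemma aa_even (b : ℝ) : Even' (D.aa b) := fun ω => by unfold aa; rw [D.κ_even]
lemma ff_even (b : ℝ) : Even' (D.ff b) := D.syn_even _

lemma den_pos {b : ℝ} (hb0 : 0 ≤ b) (hb : b < 1) (ω : V) : 0 < 1 - b * D.κ ω := by
  have := D.κ_le ω; have := D.κ_ge ω
  nlinarith

lemma ff_eq {b : ℝ} (hb0 : 0 ≤ b) (hb : b < 1) (x : V) : D.ff b x = D.k x + b * conv D.k (D.ff b) x := by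
  have h1 : D.k x = D.syn D.κ x := (D.syn_hat D.k_even x).symm
  unfold ff
  rw [D.conv_syn D.k_even, h1]
  unfold syn
  rw [mul_left_comm, ← mul_add]
  congr 1
  rw [Finset.mul_sum, ← Finset.sum_add_distrib]
  refine Finset.sum_congr rfl fun ω _ => ?_
  have := D.den_pos hb0 hb ω
  change _ = D.κ ω * D.co ω x + b * (D.κ ω * D.aa b ω * D.co ω x)
  unfold aa
  have h3 := this.ne'
  have h4 : D.κ ω / (1 - b * D.κ ω) = D.κ ω + b * (D.κ ω * (D.κ ω / (1 - b * D.κ ω))) := by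
    rw [div_eq_iff h3, add_mul]
    have : b * (D.κ ω * (D.κ ω / (1 - b * D.κ ω))) * (1 - b * D.κ ω) = b * D.κ ω * D.κ ω := by
      rw [mul_assoc, mul_assoc, div_mul_cancel₀ _ h3]; ring
    rw [this]; ring
  linear_combination (D.co ω x) * h4

lemma ff_nonneg {b : ℝ} (hb0 : 0 ≤ b) (hb : b < 1) (x : V) : 0 ≤ D.ff b x := by
  have := max_principle D.k_nonneg D.k_sum hb0 hb (e := fun y => -1 * D.ff b y) (fun y => by
    rw [conv_smul, D.ff_eq hb0 hb y]
    have := D.k_nonneg y; linarith) x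
  linarith

lemma ff_sum {b : ℝ} (hb0 : 0 ≤ b) (hb : b < 1) : ∑ x, D.ff b x = (1 - b)⁻¹ := by
  rw [← D.hat_zero, ff, D.hat_syn (D.aa_even b), aa, κ_zero]; simp

/-- comparison -/
lemma compare {b : ℝ} (hb0 : 0 ≤ b) (hb : b < 1) {G s : V → ℝ}
    (h : ∀ x, G x ≤ del x + b * conv D.k G x + s x) (x : V) :
    conv D.k G x ≤ D.ff b x + conv (D.ff b) s x := by
  set e : V → ℝ := fun y => conv D.k G y + (-1) * (D.ff b y + conv (D.ff b) s y) with he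
  have hfs : ∀ y, conv (D.ff b) s y = conv D.k s y + b * conv D.k (conv (D.ff b) s) y := by
    intro y
    have : D.ff b = fun z => D.k z + b * conv D.k (D.ff b) z := by funext z; exact D.ff_eq hb0 hb z
    rw [← conv_assoc]
    conv_lhs => rw [this, conv_comm]
    rw [conv_add, conv_smul, conv_comm s, conv_comm s]
  have hm := max_principle D.k_nonneg D.k_sum hb0 hb (e := e) (fun y => by
    have h1 : conv D.k G y ≤ D.k y + b * conv D.k (conv D.k G) y + conv D.k s y := by
      have := conv_mono D.k_nonneg h y
      rw [conv_add D.k (fun x => del x + b * conv D.k G x) s, conv_add D.k del, conv_smul, conv_del] at this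
      exact this
    rw [he, conv_add D.k (conv D.k G) (fun y => -1 * (D.ff b y + conv (D.ff b) s y)), conv_smul, conv_add]
    simp only
    have h2 := D.ff_eq hb0 hb y
    have h3 := hfs y
    linarith) x
  rw [he] at hm; simp only at hm; linarith

section bounds
variable {r : ℝ}

lemma bb_nonneg (hgr : D.g * r ^ 2 ≤ 1 / 2) : 1 / 2 ≤ 1 - D.g * r ^ 2 := by linarith
lemma bb_lt (hr : 1 ≤ r) : 1 - D.g * r ^ 2 < 1 := by
  have := D.g_pos
  have : 0 < D.g * r ^ 2 := by positivity
  linarith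


lemma ff0 (hr : 1 ≤ r) (hgr : D.g * r ^ 2 ≤ 1 / 2) (x : V) : 0 ≤ D.ff (1 - D.g * r ^ 2) x :=
  D.ff_nonneg (by linarith) (D.bb_lt hr) x

lemma ff1 (hr : 1 ≤ r) (hgr : D.g * r ^ 2 ≤ 1 / 2) (x : V) : D.ff (1 - D.g * r ^ 2) x = D.k x + (1 - D.g * r ^ 2) * conv D.k (D.ff (1 - D.g * r ^ 2)) x :=
  D.ff_eq (by linarith) (D.bb_lt hr) x

lemma ff_sum' (hr : 1 ≤ r) (hgr : D.g * r ^ 2 ≤ 1 / 2) : ∑ x, D.ff (1 - D.g * r ^ 2) x = (D.g * r ^ 2)⁻¹ := by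
  rw [D.ff_sum (by linarith) (D.bb_lt hr)]; congr 1; ring

lemma k_le_ff (hr : 1 ≤ r) (hgr : D.g * r ^ 2 ≤ 1 / 2) (x : V) : D.k x ≤ D.ff (1 - D.g * r ^ 2) x := by
  rw [D.ff1 hr hgr x]
  have := conv_nonneg D.k_nonneg (D.ff0 hr hgr) x
  nlinarith

lemma Kff_le (hr : 1 ≤ r) (hgr : D.g * r ^ 2 ≤ 1 / 2) (x : V) : conv D.k (D.ff (1 - D.g * r ^ 2)) x ≤ 2 * D.ff (1 - D.g * r ^ 2) x := by
  have h := D.ff1 hr hgr x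
  have := conv_nonneg D.k_nonneg (D.ff0 hr hgr) x
  have := D.k_nonneg x
  nlinarith

lemma den_ge (hr : 1 ≤ r) (hgr : D.g * r ^ 2 ≤ 1 / 2) {ω : V} (h : ω ≠ 0) : c0 / 2 * min 1 (D.g * D.w ω ^ 2) + D.g * r ^ 2 ≤ 1 - (1 - D.g * r ^ 2) * D.κ ω := by
  have h1 := D.κ_gap ω h
  have h2 : 0 < 1 - D.κ ω := D.κ_lt ω h
  have : 1 - (1 - D.g * r ^ 2) * D.κ ω = (1 - D.g * r ^ 2) * (1 - D.κ ω) + D.g * r ^ 2 := by ring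
  rw [this]
  nlinarith

lemma aa_sq (hr : 1 ≤ r) (hgr : D.g * r ^ 2 ≤ 1 / 2) {ω : V} (h : ω ≠ 0) : D.aa (1 - D.g * r ^ 2) ω ^ 2 ≤
    4 / c0 ^ 2 * ((D.g ^ 2 * r)⁻¹ * (D.w ω ^ 3)⁻¹ + D.κ ω ^ 2) := by
  have hd := D.den_ge hr hgr h
  have hw := D.w_ge ω h
  have hg := D.g_pos
  have hc := D.c0_pos
  have hc1 := D.c0_le
  unfold aa
  rw [div_pow]
  have hk := sq_nonneg (D.κ ω)
  have hk1 := D.κ_sq_le ω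
  rcases le_total 1 (D.g * D.w ω ^ 2) with hcase | hcase
  · rw [min_eq_left hcase] at hd
    have hd' : c0 / 2 ≤ 1 - (1 - D.g * r ^ 2) * D.κ ω := by
      have : 0 < D.g * r ^ 2 := by positivity
      linarith
    have : D.κ ω ^ 2 / (1 - (1 - D.g * r ^ 2) * D.κ ω) ^ 2 ≤ D.κ ω ^ 2 / (c0 / 2) ^ 2 := by
      gcongr
    refine this.trans ?_
    have h5 : 0 ≤ (D.g ^ 2 * r)⁻¹ * (D.w ω ^ 3)⁻¹ := by positivity
    have h6 : D.κ ω ^ 2 / (c0 / 2) ^ 2 = 4 / c0 ^ 2 * D.κ ω ^ 2 := by field_simp; norm_num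
    rw [h6]
    gcongr
    linarith
  · rw [min_eq_right hcase] at hd
    have hd' : c0 / 2 * D.g * (D.w ω ^ 2 + r ^ 2) ≤ 1 - (1 - D.g * r ^ 2) * D.κ ω := by
      have : 0 < D.g * r ^ 2 := by positivity
      nlinarith
    have h1 : (c0 / 2 * D.g * (D.w ω ^ 2 + r ^ 2)) ^ 2 ≤ (1 - (1 - D.g * r ^ 2) * D.κ ω) ^ 2 := by
      gcongr
    have h2 : c0 ^ 2 / 4 * (D.g ^ 2 * r * D.w ω ^ 3) ≤ (c0 / 2 * D.g * (D.w ω ^ 2 + r ^ 2)) ^ 2 := by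
      have e : (c0 / 2 * D.g * (D.w ω ^ 2 + r ^ 2)) ^ 2 = c0 ^ 2 / 4 * (D.g ^ 2 * (D.w ω ^ 2 + r ^ 2) ^ 2) := by ring
      rw [e]
      have e2 : r * D.w ω ^ 3 ≤ (D.w ω ^ 2 + r ^ 2) ^ 2 := by
        have a1 : r * D.w ω ≤ D.w ω ^ 2 + r ^ 2 := by nlinarith [sq_nonneg (r - D.w ω)]
        have a2 : D.w ω ^ 2 ≤ D.w ω ^ 2 + r ^ 2 := by nlinarith
        calc r * D.w ω ^ 3 = (r * D.w ω) * D.w ω ^ 2 := by ring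
          _ ≤ (D.w ω ^ 2 + r ^ 2) * (D.w ω ^ 2 + r ^ 2) := by gcongr
          _ = _ := by ring
      have : D.g ^ 2 * r * D.w ω ^ 3 ≤ D.g ^ 2 * (D.w ω ^ 2 + r ^ 2) ^ 2 := by
        rw [mul_assoc]; gcongr
      gcongr
    calc _ ≤ 1 / (c0 ^ 2 / 4 * (D.g ^ 2 * r * D.w ω ^ 3)) := by
          refine div_le_div₀ zero_le_one hk1 (by positivity) (h2.trans h1)
      _ = 4 / c0 ^ 2 * ((D.g ^ 2 * r)⁻¹ * (D.w ω ^ 3)⁻¹) := by field_simp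
      _ ≤ _ := by gcongr; linarith

lemma aa_zero (hr : 1 ≤ r) (hgr : D.g * r ^ 2 ≤ 1 / 2) : D.aa (1 - D.g * r ^ 2) 0 = (D.g * r ^ 2)⁻¹ := by
  unfold aa; rw [κ_zero, one_div]; congr 1; ring

lemma κ_sum' : (D.n)⁻¹ * ∑ ω ∈ Finset.univ.erase 0, D.κ ω ^ 2 ≤ C0 * D.g := by
  refine le_trans ?_ D.κ_sum
  exact mul_le_mul_of_nonneg_left (Finset.sum_le_sum_of_subset_of_nonneg (Finset.subset_univ _) (fun _ _ _ => sq_nonneg _)) (inv_pos.2 D.n_pos).le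

lemma ff_sq (hr : 1 ≤ r) (hgr : D.g * r ^ 2 ≤ 1 / 2) : ∑ x, D.ff (1 - D.g * r ^ 2) x ^ 2 ≤ (1 + 5 * C0 / c0 ^ 2) / r := by
  have hg := D.g_pos
  have hc := D.c0_pos
  have hC := D.C0_ge
  have hr0 : 0 < r := by linarith
  unfold ff
  rw [D.planch (D.aa_even _), ← Finset.add_sum_erase _ _ (Finset.mem_univ (0:V)), D.aa_zero hr hgr, mul_add]
  have h1 : (D.n)⁻¹ * (D.g * r ^ 2)⁻¹ ^ 2 ≤ 1 / r := by
    rw [D.n_inv]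
    have : D.g ^ 2 / 4 * (D.g * r ^ 2)⁻¹ ^ 2 = 1 / (4 * r ^ 4) := by field_simp
    rw [this]
    gcongr
    nlinarith [pow_le_pow_right₀ hr (show 1 ≤ 4 by norm_num)]
  have h2 : (D.n)⁻¹ * ∑ ω ∈ Finset.univ.erase 0, D.aa (1 - D.g * r ^ 2) ω ^ 2 ≤ (5 * C0 / c0 ^ 2) / r := by
    have hn : 0 < (D.n)⁻¹ := inv_pos.2 D.n_pos
    calc _ ≤ (D.n)⁻¹ * ∑ ω ∈ Finset.univ.erase 0, 4 / c0 ^ 2 * ((D.g ^ 2 * r)⁻¹ * (D.w ω ^ 3)⁻¹ + D.κ ω ^ 2) := by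
          refine mul_le_mul_of_nonneg_left (Finset.sum_le_sum fun ω hω => ?_) hn.le
          exact D.aa_sq hr hgr (Finset.ne_of_mem_erase hω)
      _ = 4 / c0 ^ 2 * ((D.n)⁻¹ * (D.g ^ 2 * r)⁻¹ * ∑ ω ∈ Finset.univ.erase 0, (D.w ω ^ 3)⁻¹ + (D.n)⁻¹ * ∑ ω ∈ Finset.univ.erase 0, D.κ ω ^ 2) := by
          rw [← Finset.mul_sum, Finset.sum_add_distrib, ← Finset.mul_sum]; ring
      _ ≤ 4 / c0 ^ 2 * ((D.n)⁻¹ * (D.g ^ 2 * r)⁻¹ * C0 + C0 * D.g) := by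
          have := D.w_sum; have := D.κ_sum'
          gcongr
      _ = 4 / c0 ^ 2 * (C0 / (4 * r) + C0 * D.g) := by
          rw [D.n_inv]; field_simp
      _ ≤ 4 / c0 ^ 2 * (C0 / (4 * r) + C0 * (1 / r)) := by
          have : D.g ≤ 1 / r := by rw [le_div_iff₀ hr0]; nlinarith
          gcongr
      _ = _ := by field_simp; ring
  calc _ ≤ 1 / r + (5 * C0 / c0 ^ 2) / r := add_le_add h1 h2
    _ = _ := by ring

lemma Kff_zero (hr : 1 ≤ r) (hgr : D.g * r ^ 2 ≤ 1 / 2) : conv D.k (D.ff (1 - D.g * r ^ 2)) 0 ≤ D.g * (D.cg + 1 + C0) := by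
  have hg := D.g_pos
  have hC := D.C0_ge
  have hn : 0 < (D.n)⁻¹ := inv_pos.2 D.n_pos
  have hr0 : 0 < r := by linarith
  unfold ff
  rw [D.conv_syn D.k_even, syn, ← Finset.add_sum_erase _ _ (Finset.mem_univ (0:V)), D.aa_zero hr hgr]
  have e0 : D.hat D.k 0 = 1 := D.κ_zero
  simp only [D.co_zero, mul_one, e0, one_mul]
  rw [mul_add]
  have h1 : (D.n)⁻¹ * (D.g * r ^ 2)⁻¹ ≤ D.g / 4 := by
    rw [D.n_inv]
    have : D.g ^ 2 / 4 * (D.g * r ^ 2)⁻¹ = D.g / 4 * (1 / r ^ 2) := by field_simp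
    rw [this]
    have : 1 / r ^ 2 ≤ 1 := by rw [div_le_one (by positivity)]; nlinarith
    nlinarith
  have h2 : (D.n)⁻¹ * ∑ ω ∈ Finset.univ.erase 0, D.hat D.k ω * D.aa (1 - D.g * r ^ 2) ω ≤ D.g * D.cg + D.g * C0 / 2 := by
    calc _ ≤ (D.n)⁻¹ * ∑ ω ∈ Finset.univ.erase 0, (D.κ ω ^ 2 / (1 - D.κ ω) + (1/2) * D.κ ω ^ 2) := by
          refine mul_le_mul_of_nonneg_left (Finset.sum_le_sum fun ω hω => ?_) hn.le
          have h0 := Finset.ne_of_mem_erase hω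
          have hp := D.κ_lt ω h0
          have hd := D.den_pos (b := 1 - D.g * r ^ 2) (by linarith) (D.bb_lt hr) ω
          change D.κ ω * (D.κ ω / _) ≤ _
          rw [← mul_div_assoc, ← sq]
          have hgr0 : 0 < D.g * r ^ 2 := by positivity
          rcases le_total 0 (D.κ ω) with hk | hk
          · have : D.κ ω ^ 2 / (1 - (1 - D.g * r ^ 2) * D.κ ω) ≤ D.κ ω ^ 2 / (1 - D.κ ω) := by
              gcongr; nlinarith
            have := sq_nonneg (D.κ ω)
            linarith
          · rw [div_le_iff₀ hd]
            have e : D.κ ω ^ 2 / (1 - D.κ ω) * (1 - (1 - D.g * r ^ 2) * D.κ ω) = D.κ ω ^ 2 + D.κ ω ^ 2 * (D.g * r ^ 2 * D.κ ω / (1 - D.κ ω)) := by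
              field_simp; ring
            rw [add_mul, e]
            have h3 : -(D.g * r ^ 2) ≤ D.g * r ^ 2 * D.κ ω / (1 - D.κ ω) := by
              rw [le_div_iff₀ hp]; nlinarith
            have h4 : 1 ≤ 1 - (1 - D.g * r ^ 2) * D.κ ω := by nlinarith
            have := sq_nonneg (D.κ ω)
            nlinarith [mul_le_mul_of_nonneg_left h3 this, mul_le_mul_of_nonneg_left h4 this]
      _ = D.g * D.cg + 1/2 * ((D.n)⁻¹ * ∑ ω ∈ Finset.univ.erase 0, D.κ ω ^ 2) := by
          rw [Finset.sum_add_distrib, mul_add, ← Finset.mul_sum]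
          congr 1
          · unfold cg; rw [D.n_inv]
            simp only [← div_mul_eq_mul_div]
            rw [← Finset.sum_mul]
            change _ = _ * (_ * (_ * D.g))
            ring
          · ring
      _ ≤ _ := by
          have := D.κ_sum'
          linarith
  have : 0 ≤ D.g * C0 := by positivity
  calc _ ≤ D.g / 4 + (D.g * D.cg + D.g * C0 / 2) := add_le_add h1 h2
    _ ≤ _ := by linarith

lemma Kff_le_zero (hr : 1 ≤ r) (hgr : D.g * r ^ 2 ≤ 1 / 2) (x : V) : conv D.k (D.ff (1 - D.g * r ^ 2)) x ≤ conv D.k (D.ff (1 - D.g * r ^ 2)) 0 := by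
  have hn : 0 < (D.n)⁻¹ := inv_pos.2 D.n_pos
  unfold ff
  rw [D.conv_syn D.k_even, syn, syn]
  refine mul_le_mul_of_nonneg_left (Finset.sum_le_sum fun ω _ => ?_) hn.le
  rw [D.co_zero]
  have hd := D.den_pos (b := 1 - D.g * r ^ 2) (by linarith) (D.bb_lt hr) ω
  have : 0 ≤ D.hat D.k ω * D.aa (1 - D.g * r ^ 2) ω := by
    change 0 ≤ D.κ ω * (D.κ ω / _)
    rw [← mul_div_assoc, ← sq]; positivity
  exact mul_le_mul_of_nonneg_left (abs_le.1 (D.co_abs ω x)).2 this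

lemma ff_le (hr : 1 ≤ r) (hgr : D.g * r ^ 2 ≤ 1 / 2) (x : V) : D.ff (1 - D.g * r ^ 2) x ≤ D.g * (D.cg + 1 + 2 * C0) := by
  have hg := D.g_pos
  have h1 := D.ff1 hr hgr x
  have h2 := D.Kff_le_zero hr hgr x
  have h3 := D.Kff_zero hr hgr
  have h4 := D.k_le x
  have h5 := conv_nonneg D.k_nonneg (D.ff0 hr hgr) x
  change _ ≤ C0 * D.g at h4
  have : 0 ≤ D.g * r ^ 2 := by positivity
  nlinarith

end bounds
end KD

end PartP8

section PartP8b
namespace KD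
variable {V : Type} [Fintype V] [DecidableEq V] [AddCommGroup V] {c0 C0 : ℝ} (D : KD V c0 C0)

lemma syn_sq (a : V → ℝ) (x : V) : D.syn a x ^ 2 =
    (D.n)⁻¹ ^ 2 * ∑ ω, ∑ η, a ω * a η * ((D.co (ω + η) x + D.co (ω - η) x) / 2) := by
  unfold syn
  rw [mul_pow, sq (∑ ω, a ω * D.co ω x), Finset.sum_mul_sum]
  congr 1
  refine Finset.sum_congr rfl fun ω _ => Finset.sum_congr rfl fun η _ => ?_
  rw [D.co_mul']; ring

lemma syn_cube {a : V → ℝ} (ha : Even' a) : ∑ x, D.syn a x ^ 3 =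
    (D.n)⁻¹ ^ 2 * ∑ ω, ∑ η, a ω * a η * ((a (ω + η) + a (ω - η)) / 2) := by
  have h1 : ∀ x, D.syn a x ^ 3 = ∑ ω, ∑ η, (D.n)⁻¹ ^ 2 * (a ω * a η * ((D.syn a x * D.co (ω + η) x + D.syn a x * D.co (ω - η) x) / 2)) := by
    intro x
    rw [pow_succ, D.syn_sq, mul_assoc, Finset.sum_mul, Finset.mul_sum]
    refine Finset.sum_congr rfl fun ω _ => ?_
    rw [Finset.sum_mul, Finset.mul_sum]
    refine Finset.sum_congr rfl fun η _ => ?_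
    ring
  simp only [h1]
  rw [Finset.sum_comm, Finset.mul_sum]
  refine Finset.sum_congr rfl fun ω _ => ?_
  rw [Finset.sum_comm, Finset.mul_sum]
  refine Finset.sum_congr rfl fun η _ => ?_
  rw [← Finset.mul_sum, ← Finset.mul_sum, ← Finset.sum_div, Finset.sum_add_distrib]
  have e : ∀ ζ, ∑ x, D.syn a x * D.co ζ x = a ζ := fun ζ => D.hat_syn ha ζ
  rw [e, e]

lemma amgm3 {a b c : ℝ} (ha : 0 ≤ a) (hb : 0 ≤ b) (hc : 0 ≤ c) :
    3 * (a * b * c) ^ 2 ≤ a ^ 3 * b ^ 3 + b ^ 3 * c ^ 3 + c ^ 3 * a ^ 3 := by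
  have key : ∀ u v w : ℝ, 0 ≤ u → 0 ≤ v → 0 ≤ w → 3 * (u * v * w) ≤ u ^ 3 + v ^ 3 + w ^ 3 := by
    intro u v w hu hv hw
    nlinarith [mul_nonneg (add_nonneg (add_nonneg hu hv) hw) (add_nonneg (add_nonneg (sq_nonneg (u - v)) (sq_nonneg (v - w))) (sq_nonneg (w - u)))]
  have := key (a * b) (b * c) (c * a) (by positivity) (by positivity) (by positivity)
  calc _ = 3 * (a * b * (b * c) * (c * a)) := by ring
    _ ≤ _ := this
    _ = _ := by ring

lemma syn_cube_le {a : V → ℝ} (ha : Even' a) :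
    ∑ x, D.syn a x ^ 3 ≤ ((D.n)⁻¹ * ∑ ω, Real.sqrt |a ω| ^ 3) ^ 2 := by
  set α : V → ℝ := fun ω => Real.sqrt |a ω| with hα
  have hα0 : ∀ ω, 0 ≤ α ω := fun ω => Real.sqrt_nonneg _
  have hα2 : ∀ ω, α ω ^ 2 = |a ω| := fun ω => Real.sq_sqrt (abs_nonneg _)
  rw [D.syn_cube ha, mul_pow]
  refine mul_le_mul_of_nonneg_left ?_ (by positivity)
  have tri : ∀ x y z : V, a x * a y * a z ≤ (α x ^ 3 * α y ^ 3 + α y ^ 3 * α z ^ 3 + α z ^ 3 * α x ^ 3) / 3 := by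
    intro x y z
    have h := amgm3 (hα0 x) (hα0 y) (hα0 z)
    have h2 : a x * a y * a z ≤ (α x * α y * α z) ^ 2 := by
      rw [mul_pow, mul_pow, hα2, hα2, hα2, ← abs_mul, ← abs_mul]; exact le_abs_self _
    linarith
  set S := ∑ ω, α ω ^ 3 with hS
  have s1 : ∑ ω, ∑ η, α ω ^ 3 * α η ^ 3 = S ^ 2 := by rw [sq, hS, Finset.sum_mul_sum]
  have s2 : ∑ ω, ∑ η, α η ^ 3 * α (ω + η) ^ 3 = S ^ 2 := by
    rw [Finset.sum_comm, sq, hS, Finset.sum_mul]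
    refine Finset.sum_congr rfl fun η _ => ?_
    rw [← Finset.mul_sum]; congr 1
    exact Equiv.sum_comp (Equiv.addRight η) (fun z => α z ^ 3)
  have s3 : ∑ ω, ∑ η, α (ω + η) ^ 3 * α ω ^ 3 = S ^ 2 := by
    rw [sq]; nth_rw 2 [hS]; rw [Finset.mul_sum]
    refine Finset.sum_congr rfl fun η _ => ?_
    rw [← Finset.sum_mul]; congr 1
    exact Equiv.sum_comp (Equiv.addLeft η) (fun z => α z ^ 3)
  have s4 : ∑ ω, ∑ η, α η ^ 3 * α (ω - η) ^ 3 = S ^ 2 := by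
    rw [Finset.sum_comm, sq, hS, Finset.sum_mul]
    refine Finset.sum_congr rfl fun η _ => ?_
    rw [← Finset.mul_sum]; congr 1
    exact Equiv.sum_comp (Equiv.subRight η) (fun z => α z ^ 3)
  have s5 : ∑ ω, ∑ η, α (ω - η) ^ 3 * α ω ^ 3 = S ^ 2 := by
    rw [sq]; nth_rw 2 [hS]; rw [Finset.mul_sum]
    refine Finset.sum_congr rfl fun η _ => ?_
    rw [← Finset.sum_mul]; congr 1
    exact Equiv.sum_comp (Equiv.subLeft η) (fun z => α z ^ 3)
  calc _ ≤ ∑ ω, ∑ η, ((α ω ^ 3 * α η ^ 3 + α η ^ 3 * α (ω + η) ^ 3 + α (ω + η) ^ 3 * α ω ^ 3)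
        + (α ω ^ 3 * α η ^ 3 + α η ^ 3 * α (ω - η) ^ 3 + α (ω - η) ^ 3 * α ω ^ 3)) / 6 := by
        refine Finset.sum_le_sum fun ω _ => Finset.sum_le_sum fun η _ => ?_
        have := tri ω η (ω + η); have := tri ω η (ω - η)
        linarith
    _ = S ^ 2 := by
        simp only [← Finset.sum_div, Finset.sum_add_distrib]
        rw [s1, s2, s3, s4, s5]; ring

def C3 (c0 C0 : ℝ) : ℝ := (1 / 4 + (2 / c0) ^ 3 * (1 + 2 * C0)) ^ 2

lemma aa_three {r : ℝ} (hr : 1 ≤ r) (hgr : D.g * r ^ 2 ≤ 1 / 2) {ω : V} (h : ω ≠ 0) :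
    Real.sqrt |D.aa (1 - D.g * r ^ 2) ω| ^ 3 ≤
    (2 / c0) ^ 3 * ((D.γ ^ 3)⁻¹ * (D.w ω ^ 3)⁻¹ + (D.γ + D.γ⁻¹ * D.κ ω ^ 2)) := by
  have hd := D.den_ge hr hgr h
  have hw := D.w_ge ω h
  have hg := D.g_pos
  have hγ := D.γ_pos
  have hγ1 := D.γ_lt
  have hc := D.c0_pos
  have hc1 := D.c0_le
  have hE : 1 ≤ 2 / c0 := by rw [le_div_iff₀ hc]; linarith
  set E := 2 / c0 with hEdef
  have hEinv : c0 / 2 = E⁻¹ := by rw [hEdef, inv_div]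
  have hgr0 : 0 < D.g * r ^ 2 := by positivity
  have hE3 : E ≤ E ^ 2 := by nlinarith
  have hab : |D.aa (1 - D.g * r ^ 2) ω| = |D.κ ω| / (1 - (1 - D.g * r ^ 2) * D.κ ω) := by
    unfold aa
    rw [abs_div, abs_of_pos (D.den_pos (by linarith) (D.bb_lt hr) ω)]
  rw [hab]
  rcases le_total 1 (D.g * D.w ω ^ 2) with hcase | hcase
  · rw [min_eq_left hcase] at hd
    have hd' : E⁻¹ ≤ 1 - (1 - D.g * r ^ 2) * D.κ ω := by rw [← hEinv]; linarith
    have h1 : |D.κ ω| / (1 - (1 - D.g * r ^ 2) * D.κ ω) ≤ (E * Real.sqrt |D.κ ω|) ^ 2 := by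
      rw [mul_pow, Real.sq_sqrt (abs_nonneg _)]
      calc _ ≤ |D.κ ω| / E⁻¹ := by gcongr
        _ = E * |D.κ ω| := by rw [div_inv_eq_mul, mul_comm]
        _ ≤ _ := by gcongr
    have h2 := Real.sqrt_le_sqrt h1
    rw [Real.sqrt_sq (by positivity)] at h2
    have h3 : Real.sqrt |D.κ ω| ^ 3 ≤ D.γ + D.γ⁻¹ * D.κ ω ^ 2 := by
      set u := Real.sqrt |D.κ ω| with hu
      have hu0 : 0 ≤ u := Real.sqrt_nonneg _
      have hu1 : u ≤ 1 := by rw [hu]; exact Real.sqrt_le_one.2 (D.κ_abs ω)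
      have hu4 : D.κ ω ^ 2 = u ^ 4 := by
        rw [← sq_abs, ← Real.sq_sqrt (abs_nonneg (D.κ ω)), ← hu]; ring
      rw [hu4]
      have a2 : u ^ 6 ≤ u ^ 4 := pow_le_pow_of_le_one hu0 hu1 (by norm_num)
      have a3 : D.γ * u ^ 3 ≤ D.γ ^ 2 + u ^ 4 := by
        have := sq_nonneg (D.γ - u ^ 3)
        have e : (u ^ 3) ^ 2 = u ^ 6 := by ring
        nlinarith [pow_nonneg hu0 4, sq_nonneg D.γ]
      have : D.γ + D.γ⁻¹ * u ^ 4 = D.γ⁻¹ * (D.γ ^ 2 + u ^ 4) := by field_simp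
      rw [this, ← div_eq_inv_mul, le_div_iff₀ hγ]; linarith
    calc _ ≤ (E * Real.sqrt |D.κ ω|) ^ 3 := by gcongr
      _ = E ^ 3 * Real.sqrt |D.κ ω| ^ 3 := by ring
      _ ≤ _ := by
        gcongr
        have : 0 ≤ (D.γ ^ 3)⁻¹ * (D.w ω ^ 3)⁻¹ := by positivity
        linarith
  · rw [min_eq_right hcase] at hd
    have hd' : E⁻¹ * (D.γ * D.w ω) ^ 2 ≤ 1 - (1 - D.g * r ^ 2) * D.κ ω := by
      rw [← hEinv]
      have : c0 / 2 * (D.γ * D.w ω) ^ 2 = c0 / 2 * (D.g * D.w ω ^ 2) := by unfold g; ring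
      linarith
    have h1 : |D.κ ω| / (1 - (1 - D.g * r ^ 2) * D.κ ω) ≤ (E * (D.γ * D.w ω)⁻¹) ^ 2 := by
      calc _ ≤ 1 / (E⁻¹ * (D.γ * D.w ω) ^ 2) := by
            refine div_le_div₀ zero_le_one (D.κ_abs ω) (by positivity) hd'
        _ = E * ((D.γ * D.w ω)⁻¹) ^ 2 := by field_simp
        _ ≤ E ^ 2 * ((D.γ * D.w ω)⁻¹) ^ 2 := by gcongr
        _ = _ := by ring
    have h2 := Real.sqrt_le_sqrt h1
    rw [Real.sqrt_sq (by positivity)] at h2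
    calc _ ≤ (E * (D.γ * D.w ω)⁻¹) ^ 3 := by gcongr
      _ = E ^ 3 * ((D.γ ^ 3)⁻¹ * (D.w ω ^ 3)⁻¹) := by rw [mul_pow, inv_pow, mul_pow, mul_inv]
      _ ≤ _ := by
        gcongr
        have : 0 ≤ D.γ + D.γ⁻¹ * D.κ ω ^ 2 := by positivity
        linarith

lemma ff_cube {r : ℝ} (hr : 1 ≤ r) (hgr : D.g * r ^ 2 ≤ 1 / 2) :
    ∑ x, D.ff (1 - D.g * r ^ 2) x ^ 3 ≤ C3 c0 C0 * D.g := by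
  have hg := D.g_pos
  have hγ := D.γ_pos
  have hc := D.c0_pos
  have hC := D.C0_ge
  have hn : 0 < (D.n)⁻¹ := inv_pos.2 D.n_pos
  have hr0 : 0 < r := by linarith
  refine (D.syn_cube_le (D.aa_even _)).trans ?_
  have key : (D.n)⁻¹ * ∑ ω, Real.sqrt |D.aa (1 - D.g * r ^ 2) ω| ^ 3 ≤ (1 / 4 + (2 / c0) ^ 3 * (1 + 2 * C0)) * D.γ := by
    rw [← Finset.add_sum_erase _ _ (Finset.mem_univ (0:V)), D.aa_zero hr hgr, mul_add]
    have h1 : (D.n)⁻¹ * Real.sqrt |(D.g * r ^ 2)⁻¹| ^ 3 ≤ 1 / 4 * D.γ := by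
      have : (D.g * r ^ 2)⁻¹ = ((D.γ * r)⁻¹) ^ 2 := by unfold g; rw [inv_pow, mul_pow]
      rw [this, abs_of_nonneg (by positivity), Real.sqrt_sq (by positivity), D.n_inv]
      have : D.g ^ 2 / 4 * (D.γ * r)⁻¹ ^ 3 = 1 / 4 * D.γ * (1 / r ^ 3) := by unfold g; field_simp
      rw [this]
      have : 1 / r ^ 3 ≤ 1 := by rw [div_le_one (by positivity)]; exact one_le_pow₀ hr
      have : 0 ≤ 1 / 4 * D.γ := by positivity
      nlinarith
    have h2 : (D.n)⁻¹ * ∑ ω ∈ Finset.univ.erase 0, Real.sqrt |D.aa (1 - D.g * r ^ 2) ω| ^ 3 ≤ (2 / c0) ^ 3 * (1 + 2 * C0) * D.γ := by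
      calc _ ≤ (D.n)⁻¹ * ∑ ω ∈ Finset.univ.erase 0, (2 / c0) ^ 3 * ((D.γ ^ 3)⁻¹ * (D.w ω ^ 3)⁻¹ + (D.γ + D.γ⁻¹ * D.κ ω ^ 2)) := by
            refine mul_le_mul_of_nonneg_left (Finset.sum_le_sum fun ω hω => ?_) hn.le
            exact D.aa_three hr hgr (Finset.ne_of_mem_erase hω)
        _ = (2 / c0) ^ 3 * ((D.n)⁻¹ * (D.γ ^ 3)⁻¹ * ∑ ω ∈ Finset.univ.erase 0, (D.w ω ^ 3)⁻¹ + ((D.n)⁻¹ * ∑ ω ∈ Finset.univ.erase (0:V), D.γ) + D.γ⁻¹ * ((D.n)⁻¹ * ∑ ω ∈ Finset.univ.erase 0, D.κ ω ^ 2)) := by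
            rw [← Finset.mul_sum, Finset.sum_add_distrib, Finset.sum_add_distrib, ← Finset.mul_sum, ← Finset.mul_sum]; ring
        _ ≤ (2 / c0) ^ 3 * ((D.n)⁻¹ * (D.γ ^ 3)⁻¹ * C0 + D.γ + D.γ⁻¹ * (C0 * D.g)) := by
            have := D.w_sum; have := D.κ_sum'
            have h5 : (D.n)⁻¹ * ∑ ω ∈ Finset.univ.erase (0:V), D.γ ≤ D.γ := by
              calc _ ≤ (D.n)⁻¹ * ∑ ω : V, D.γ :=
                    mul_le_mul_of_nonneg_left (Finset.sum_le_sum_of_subset_of_nonneg (Finset.subset_univ _) (fun _ _ _ => hγ.le)) hn.le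
                _ = D.γ := by
                    rw [Finset.sum_const, nsmul_eq_mul]
                    change (D.n)⁻¹ * (D.n * D.γ) = _
                    rw [inv_mul_cancel_left₀ D.n_pos.ne']
            gcongr
        _ = (2 / c0) ^ 3 * (C0 / 4 + 1 + C0) * D.γ := by
            rw [D.n_inv]; unfold g; field_simp
        _ ≤ _ := by
            refine mul_le_mul_of_nonneg_right (mul_le_mul_of_nonneg_left ?_ (by positivity)) hγ.le
            linarith
    linarith
  calc _ ≤ ((1 / 4 + (2 / c0) ^ 3 * (1 + 2 * C0)) * D.γ) ^ 2 := by
        gcongr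
    _ = _ := by unfold C3 g; ring

lemma low {r : ℝ} (hr : 1 ≤ r) (hgr : D.g * r ^ 2 ≤ 1) :
    D.g * (D.cg - 2 * C0 / c0 ^ 2 * r) ≤
    (D.n)⁻¹ * ∑ ω ∈ Finset.univ.erase 0, D.κ ω ^ 2 / (1 - D.κ ω + D.g * r ^ 2) := by
  have hg := D.g_pos
  have hc := D.c0_pos
  have hc1 := D.c0_le
  have hC := D.C0_ge
  have hn : 0 < (D.n)⁻¹ := inv_pos.2 D.n_pos
  have hr0 : 0 < r := by linarith
  have hcg : D.g * D.cg = (D.n)⁻¹ * ∑ ω ∈ Finset.univ.erase 0, D.κ ω ^ 2 / (1 - D.κ ω) := by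
    unfold cg; rw [D.n_inv]
    simp only [← div_mul_eq_mul_div]
    rw [← Finset.sum_mul]
    change _ * (_ * (_ * D.g)) = _
    ring
  have hgr0 : 0 < D.g * r ^ 2 := by positivity
  have pt : ∀ ω ∈ Finset.univ.erase (0:V), D.κ ω ^ 2 / (1 - D.κ ω) - D.κ ω ^ 2 / (1 - D.κ ω + D.g * r ^ 2) ≤
      (c0 ^ 2)⁻¹ * ((r / (2 * D.g)) * (D.w ω ^ 3)⁻¹ + r * D.κ ω ^ 2) := by
    intro ω hω
    have h := Finset.ne_of_mem_erase hω
    have hp := D.κ_lt ω h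
    have hgap := D.κ_gap ω h
    have hw := D.w_ge ω h
    have e : D.κ ω ^ 2 / (1 - D.κ ω) - D.κ ω ^ 2 / (1 - D.κ ω + D.g * r ^ 2) = D.κ ω ^ 2 * (D.g * r ^ 2) / ((1 - D.κ ω) * (1 - D.κ ω + D.g * r ^ 2)) := by
      rw [div_sub_div _ _ hp.ne' (by positivity)]; congr 1; ring
    rw [e]
    have hk1 := D.κ_sq_le ω
    rcases le_total 1 (D.g * D.w ω ^ 2) with hcase | hcase
    · rw [min_eq_left hcase, mul_one] at hgap
      calc _ ≤ D.κ ω ^ 2 * r / (c0 * c0) := by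
            refine div_le_div₀ (by positivity) ?_ (by positivity) ?_
            · have : D.g * r ^ 2 ≤ r := by linarith
              gcongr
            · gcongr; linarith
        _ = (c0 ^ 2)⁻¹ * (r * D.κ ω ^ 2) := by field_simp
        _ ≤ _ := by
            gcongr
            have : 0 ≤ (r / (2 * D.g)) * (D.w ω ^ 3)⁻¹ := by positivity
            linarith
    · rw [min_eq_right hcase] at hgap
      have h2 : 2 * c0 * D.g * (D.w ω * r) ≤ 1 - D.κ ω + D.g * r ^ 2 := by
        have a1 : c0 * (D.g * r ^ 2) ≤ D.g * r ^ 2 := by nlinarith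
        have a2 : 0 ≤ c0 * D.g * (D.w ω - r) ^ 2 := by positivity
        nlinarith
      calc _ ≤ 1 * (D.g * r ^ 2) / (c0 * (D.g * D.w ω ^ 2) * (2 * c0 * D.g * (D.w ω * r))) := by
            refine div_le_div₀ (by positivity) ?_ (by positivity) ?_
            · gcongr
            · gcongr
        _ = (c0 ^ 2)⁻¹ * ((r / (2 * D.g)) * (D.w ω ^ 3)⁻¹) := by field_simp
        _ ≤ _ := by
            gcongr
            have : 0 ≤ r * D.κ ω ^ 2 := by positivity
            linarith
  have hs := mul_le_mul_of_nonneg_left (Finset.sum_le_sum pt) hn.le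
  rw [Finset.sum_sub_distrib, mul_sub, ← hcg, ← Finset.mul_sum, Finset.sum_add_distrib, ← Finset.mul_sum, ← Finset.mul_sum] at hs
  have h3 : (D.n)⁻¹ * ((c0 ^ 2)⁻¹ * (r / (2 * D.g) * ∑ ω ∈ Finset.univ.erase 0, (D.w ω ^ 3)⁻¹ + r * ∑ ω ∈ Finset.univ.erase 0, D.κ ω ^ 2)) ≤ D.g * (2 * C0 / c0 ^ 2 * r) := by
    calc _ = (c0 ^ 2)⁻¹ * ((D.n)⁻¹ * (r / (2 * D.g)) * ∑ ω ∈ Finset.univ.erase 0, (D.w ω ^ 3)⁻¹ + r * ((D.n)⁻¹ * ∑ ω ∈ Finset.univ.erase 0, D.κ ω ^ 2)) := by ring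
      _ ≤ (c0 ^ 2)⁻¹ * ((D.n)⁻¹ * (r / (2 * D.g)) * C0 + r * (C0 * D.g)) := by
          have := D.w_sum; have := D.κ_sum'
          gcongr
      _ = (c0 ^ 2)⁻¹ * (D.g * r * C0 * (1 / 8 + 1)) := by rw [D.n_inv]; field_simp; ring
      _ ≤ (c0 ^ 2)⁻¹ * (D.g * r * C0 * 2) := by gcongr; norm_num
      _ = _ := by field_simp
  linarith

end KD

end PartP8b

section PartP9
section Tanh
open Real

lemma hasDerivAt_tanh' (x : ℝ) : HasDerivAt tanh (1 - tanh x ^ 2) x := by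
  have h := (hasDerivAt_sinh x).div (hasDerivAt_cosh x) (cosh_pos x).ne'
  have e : (sinh / cosh) = tanh := by funext y; simp [tanh_eq_sinh_div_cosh]
  rw [e] at h
  have e2 : 1 - tanh x ^ 2 = (cosh x * cosh x - sinh x * sinh x) / cosh x ^ 2 := by
    rw [tanh_eq_sinh_div_cosh]
    have := (cosh_pos x).ne'
    field_simp
  rw [e2]; exact h

lemma tanh_sq_le_one (x : ℝ) : tanh x ^ 2 ≤ 1 := by
  rw [tanh_eq_sinh_div_cosh, div_pow, div_le_one (by have := cosh_pos x; positivity)]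
  have := cosh_sq x; linarith

lemma abs_tanh_le_one (x : ℝ) : |tanh x| ≤ 1 := by
  have := tanh_sq_le_one x
  exact abs_le_one_iff_mul_self_le_one.2 (by nlinarith)

lemma nonneg_of_deriv {f f' : ℝ → ℝ} (h0 : f 0 = 0) (hd : ∀ x, HasDerivAt f (f' x) x)
    (hp : ∀ x, 0 ≤ x → 0 ≤ f' x) {x : ℝ} (hx : 0 ≤ x) : 0 ≤ f x := by
  have hm : MonotoneOn f (Set.Ici 0) := by
    refine monotoneOn_of_deriv_nonneg (convex_Ici 0) (fun y _ => (hd y).continuousAt.continuousWithinAt) (fun y _ => (hd y).differentiableAt.differentiableWithinAt) ?_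
    intro y hy
    rw [(hd y).deriv]
    rw [interior_Ici] at hy
    exact hp y (le_of_lt hy)
  have := hm (Set.mem_Ici.2 le_rfl) (Set.mem_Ici.2 hx) hx
  rwa [h0] at this

lemma tanh_nonneg' {x : ℝ} (hx : 0 ≤ x) : 0 ≤ tanh x :=
  nonneg_of_deriv (f := tanh) (f' := fun x => 1 - tanh x ^ 2) tanh_zero hasDerivAt_tanh'
    (fun y _ => by have := tanh_sq_le_one y; linarith) hx

lemma tanh_le' {x : ℝ} (hx : 0 ≤ x) : tanh x ≤ x := by
  have := nonneg_of_deriv (f := fun x => x - tanh x) (f' := fun x => 1 - (1 - tanh x ^ 2)) (by simp)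
    (fun y => (hasDerivAt_id y).sub (hasDerivAt_tanh' y)) (fun y _ => by nlinarith [sq_nonneg (tanh y)]) hx
  linarith

lemma tanh_ge3 {x : ℝ} (hx : 0 ≤ x) : x - x ^ 3 / 3 ≤ tanh x := by
  have := nonneg_of_deriv (f := fun x => tanh x - x + x ^ 3 / 3) (f' := fun x => 1 - tanh x ^ 2 - 1 + (3:ℕ) * x ^ 2 / 3) (by simp)
    (fun y => ((hasDerivAt_tanh' y).sub (hasDerivAt_id y)).add ((hasDerivAt_pow 3 y).div_const 3)) (fun y hy => by
      have h1 := tanh_le' hy; have h2 := tanh_nonneg' hy; push_cast; nlinarith) hx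
  linarith

lemma tanh_sq_ge_pos {x : ℝ} (hx : 0 ≤ x) : x ^ 2 - 2 / 3 * x ^ 4 ≤ tanh x ^ 2 := by
  rcases le_total (x ^ 2) 3 with h | h
  · have h1 : 0 ≤ x - x ^ 3 / 3 := by nlinarith
    have h2 := tanh_ge3 hx
    have h3 : (x - x ^ 3 / 3) ^ 2 ≤ tanh x ^ 2 := by gcongr
    nlinarith [sq_nonneg (x ^ 3)]
  · nlinarith [sq_nonneg (tanh x), sq_nonneg x]

lemma tanh_le5 {x : ℝ} (hx : 0 ≤ x) : tanh x ≤ x - x ^ 3 / 3 + 2 / 15 * x ^ 5 := by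
  have := nonneg_of_deriv (f := fun x => x - tanh x - x ^ 3 / 3 + 2 / 15 * x ^ 5) (f' := fun x => 1 - (1 - tanh x ^ 2) - (3:ℕ) * x ^ 2 / 3 + 2 / 15 * ((5:ℕ) * x ^ 4)) (by simp)
    (fun y => (((hasDerivAt_id y).sub (hasDerivAt_tanh' y)).sub ((hasDerivAt_pow 3 y).div_const 3)).add ((hasDerivAt_pow 5 y).const_mul (2/15))) (fun y hy => by
      have h1 := tanh_sq_ge_pos hy; push_cast; nlinarith) hx
  linarith

lemma tanh_sq_ge (x : ℝ) : x ^ 2 - 2 / 3 * x ^ 4 ≤ tanh x ^ 2 := by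
  rcases le_total 0 x with h | h
  · exact tanh_sq_ge_pos h
  · have := tanh_sq_ge_pos (neg_nonneg.2 h)
    rw [tanh_neg] at this; nlinarith

lemma tanh_sq_le (x : ℝ) : tanh x ^ 2 ≤ x ^ 2 := by
  rcases le_total 0 x with h | h
  · have := tanh_le' h; have := tanh_nonneg' h; gcongr
  · have h1 := tanh_le' (neg_nonneg.2 h); have h2 := tanh_nonneg' (neg_nonneg.2 h)
    rw [tanh_neg] at h1 h2; nlinarith

lemma tanh_taylor {γ : ℝ} (hγ : 0 < γ) (x : ℝ) : |tanh x - x + x ^ 3 / 3| ≤ (γ * x ^ 4 + γ⁻¹ * x ^ 6) / 15 := by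
  have key : ∀ y : ℝ, 0 ≤ y → |tanh y - y + y ^ 3 / 3| ≤ (γ * y ^ 4 + γ⁻¹ * y ^ 6) / 15 := by
    intro y hy
    have h1 := tanh_ge3 hy
    have h2 := tanh_le5 hy
    have h3 : 2 * y ^ 5 ≤ γ * y ^ 4 + γ⁻¹ * y ^ 6 := by
      have : γ * y ^ 4 + γ⁻¹ * y ^ 6 - 2 * y ^ 5 = γ⁻¹ * y ^ 4 * (γ - y) ^ 2 := by field_simp; ring
      have : 0 ≤ γ⁻¹ * y ^ 4 * (γ - y) ^ 2 := by positivity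
      linarith
    rw [abs_le]; constructor <;> nlinarith [pow_nonneg hy 5]
  rcases le_total 0 x with h | h
  · exact key x h
  · have := key (-x) (neg_nonneg.2 h)
    rw [tanh_neg] at this
    have e : -tanh x - -x + (-x) ^ 3 / 3 = -(tanh x - x + x ^ 3 / 3) := by ring
    rw [e, abs_neg] at this
    calc _ ≤ _ := this
      _ = _ := by ring

lemma tanh_mvt (a : ℝ) {J : ℝ} (hJ : 0 ≤ J) : ∃ ξ ∈ Set.Icc (a - J) (a + J), (tanh (a + J) - tanh (a - J)) / 2 = J * (1 - tanh ξ ^ 2) := by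
  rcases hJ.eq_or_lt with h | h
  · exact ⟨a, by simp [← h], by simp [← h]⟩
  · obtain ⟨ξ, hξ, h1⟩ := exists_hasDerivAt_eq_slope tanh (fun x => 1 - tanh x ^ 2) (show a - J < a + J by linarith)
      (fun y _ => (hasDerivAt_tanh' y).continuousAt.continuousWithinAt) (fun y _ => hasDerivAt_tanh' y)
    refine ⟨ξ, Set.Ioo_subset_Icc_self hξ, ?_⟩
    rw [h1, show a + J - (a - J) = 2 * J by ring]; field_simp

lemma tanh_lip (a b : ℝ) : |tanh a - tanh b| ≤ |a - b| := by
  have key : ∀ u v : ℝ, u ≤ v → |tanh v - tanh u| ≤ |v - u| := by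
    intro u v h
    obtain ⟨ξ, _, h1⟩ := tanh_mvt ((u + v) / 2) (J := (v - u) / 2) (by linarith)
    rw [show (u + v) / 2 + (v - u) / 2 = v by ring, show (u + v) / 2 - (v - u) / 2 = u by ring] at h1
    have e : tanh v - tanh u = (v - u) * (1 - tanh ξ ^ 2) := by linarith
    rw [e, abs_mul]
    have := tanh_sq_le_one ξ
    refine mul_le_of_le_one_right (abs_nonneg _) ?_
    rw [abs_le]; constructor <;> nlinarith [sq_nonneg (tanh ξ)]
  rcases le_total a b with h | h
  · rw [abs_sub_comm, abs_sub_comm a]; exact key a b h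
  · exact key b a h

lemma tanh_sq_lip (a b : ℝ) : |tanh a ^ 2 - tanh b ^ 2| ≤ 2 * |a - b| := by
  have : tanh a ^ 2 - tanh b ^ 2 = (tanh a + tanh b) * (tanh a - tanh b) := by ring
  rw [this, abs_mul]
  have h1 : |tanh a + tanh b| ≤ 2 := (abs_add_le _ _).trans (by have := abs_tanh_le_one a; have := abs_tanh_le_one b; linarith)
  have := tanh_lip a b
  have := abs_nonneg (a - b)
  calc _ ≤ 2 * |tanh a - tanh b| := by gcongr
    _ ≤ _ := by gcongr

/-- discrete derivative of tanh in a spin -/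
lemma tanh_O (h' : ℝ) {J h : ℝ} (hJ : 0 ≤ J) (hh : h = h' + J ∨ h = h' - J) :
    |(tanh (h' + J) - tanh (h' - J)) / 2 - J * (1 - tanh h ^ 2)| ≤ 4 * J ^ 2 := by
  obtain ⟨ξ, hξ, e⟩ := tanh_mvt h' hJ
  rw [e, ← mul_sub, abs_mul, abs_of_nonneg hJ]
  have h1 : |ξ - h| ≤ 2 * J := by
    rw [Set.mem_Icc] at hξ
    rw [abs_le]; rcases hh with rfl | rfl <;> constructor <;> linarith
  have h2 : |1 - tanh ξ ^ 2 - (1 - tanh h ^ 2)| ≤ 4 * J := by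
    have := tanh_sq_lip h ξ
    rw [abs_sub_comm h] at this
    rw [show 1 - tanh ξ ^ 2 - (1 - tanh h ^ 2) = tanh h ^ 2 - tanh ξ ^ 2 by ring]; linarith
  calc _ ≤ J * (4 * J) := by gcongr
    _ = _ := by ring

lemma tanh_flip (h : ℝ) : (1 - tanh h) = exp (-(2 * h)) * (1 + tanh h) := by
  have hc := (cosh_pos h).ne'
  rw [tanh_eq_sinh_div_cosh]
  have e1 : 1 - sinh h / cosh h = exp (-h) / cosh h := by rw [← cosh_sub_sinh]; field_simp
  have e2 : 1 + sinh h / cosh h = exp h / cosh h := by rw [← cosh_add_sinh]; field_simp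
  rw [e1, e2, ← mul_div_assoc, ← exp_add]; congr 2; ring

end Tanh

end PartP9

section PartP9b
namespace KD
variable {V : Type} [Fintype V] [DecidableEq V] [AddCommGroup V] {c0 C0 : ℝ} (D : KD V c0 C0)

def JJ (β : ℝ) (e : V × V) : ℝ := β / 2 * D.k (e.1 - e.2)
def E (β : ℝ) (F : (V → Bool) → ℝ) : ℝ := av (D.JJ β) F
def G (β : ℝ) (x : V) : ℝ := G2 (D.JJ β) 0 x
def hh (β : ℝ) (x : V) (s : V → Bool) : ℝ := lin (fun z => β * D.k (x - z)) s
def tt (β : ℝ) (x : V) (s : V → Bool) : ℝ := Real.tanh (D.hh β x s)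
def H (β : ℝ) (x : V) : ℝ := β * conv D.k (D.G β) x
def TT (β : ℝ) (x : V) : ℝ := β * conv D.k (D.H β) x
def th (β : ℝ) : ℝ := D.TT β 0
def tau (β : ℝ) : ℝ := D.E β (fun s => D.tt β 0 s ^ 2)
def rho (β : ℝ) : ℝ := (D.γ * (3 * D.th β ^ 2) + D.γ⁻¹ * (15 * D.th β ^ 3)) / 15

lemma JJ_nonneg {β : ℝ} (hβ : 0 ≤ β) (e : V × V) : 0 ≤ D.JJ β e := mul_nonneg (by linarith) (D.k_nonneg _)
lemma JJ_mono {β β' : ℝ} (h : β' ≤ β) (e : V × V) : D.JJ β' e ≤ D.JJ β e :=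
  mul_le_mul_of_nonneg_right (by linarith) (D.k_nonneg _)

def shift (a : V) (s : V → Bool) : V → Bool := fun x => s (x + a)
lemma sp_shift (a : V) (s : V → Bool) (x : V) : sp (shift a s) x = sp s (x + a) := rfl

lemma sum_shift (a : V) (F : (V → Bool) → ℝ) : ∑ s, F (shift a s) = ∑ s, F s := by
  refine Equiv.sum_comp (⟨shift a, shift (-a), ?_, ?_⟩ : (V → Bool) ≃ (V → Bool)) F
  · intro s; funext x; simp [shift]
  · intro s; funext x; simp [shift]

lemma wt_shift (β : ℝ) (a : V) (s : V → Bool) : wt (D.JJ β) (shift a s) = wt (D.JJ β) s := by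
  unfold wt
  congr 1
  rw [← Equiv.sum_comp (Equiv.prodCongr (Equiv.addRight a) (Equiv.addRight a)) (fun e => D.JJ β e * bd s e)]
  refine Finset.sum_congr rfl fun e _ => ?_
  simp [JJ, bd, sp_shift]

lemma E_shift (β : ℝ) (a : V) (F : (V → Bool) → ℝ) : D.E β (fun s => F (shift a s)) = D.E β F := by
  unfold E av
  congr 1
  rw [← sum_shift a (fun s => wt (D.JJ β) s * F s)]
  exact Finset.sum_congr rfl fun s _ => by rw [D.wt_shift]

lemma hh_shift (β : ℝ) (a x : V) (s : V → Bool) : D.hh β x (shift a s) = D.hh β (x + a) s := by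
  unfold hh lin
  rw [← Equiv.sum_comp (Equiv.addRight a) (fun z => β * D.k (x + a - z) * sp s z)]
  refine Finset.sum_congr rfl fun z _ => ?_
  simp [sp_shift]

lemma E_spsp (β : ℝ) (x y : V) : D.E β (fun s => sp s x * sp s y) = D.G β (y - x) := by
  unfold G G2
  rw [show av (D.JJ β) (mono [0, y - x]) = D.E β (mono [0, y - x]) from rfl, ← D.E_shift β x (mono [0, y - x])]
  congr 1; funext s
  simp [mono, sp_shift]

lemma G2_eq (β : ℝ) (x y : V) : G2 (D.JJ β) x y = D.G β (y - x) := by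
  rw [← D.E_spsp]; unfold G2 E; congr 1; funext s; simp [mono]

lemma G_even (β : ℝ) : Even' (D.G β) := fun x => by
  have h1 := D.G2_eq β x 0; have h2 := D.G2_eq β 0 x
  rw [zero_sub] at h1; rw [sub_zero] at h2
  rw [← h1, G2_comm, h2]

lemma G_nonneg {β : ℝ} (hβ : 0 ≤ β) (x : V) : 0 ≤ D.G β x := G2_nonneg (D.JJ_nonneg hβ) _ _
lemma G_zero (β : ℝ) : D.G β 0 = 1 := G2_self _ _
lemma G_mono {β β' : ℝ} (h0 : 0 ≤ β') (h : β' ≤ β) (x : V) : D.G β' x ≤ D.G β x :=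
  G2_mono (D.JJ_nonneg h0) (D.JJ_mono h) _ _

lemma H_nonneg {β : ℝ} (hβ : 0 ≤ β) (x : V) : 0 ≤ D.H β x := mul_nonneg hβ (conv_nonneg D.k_nonneg (D.G_nonneg hβ) x)
lemma H_even (β : ℝ) : Even' (D.H β) := fun x => by unfold H; rw [conv_even D.k_even (D.G_even β)]
lemma TT_nonneg {β : ℝ} (hβ : 0 ≤ β) (x : V) : 0 ≤ D.TT β x := mul_nonneg hβ (conv_nonneg D.k_nonneg (D.H_nonneg hβ) x)
lemma th_nonneg {β : ℝ} (hβ : 0 ≤ β) : 0 ≤ D.th β := D.TT_nonneg hβ 0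

lemma E_hsp (β : ℝ) (x y : V) : D.E β (fun s => D.hh β x s * sp s y) = D.H β (y - x) := by
  unfold hh lin H conv
  have : ∀ s : V → Bool, (∑ z, β * D.k (x - z) * sp s z) * sp s y = ∑ z, (β * D.k (x - z)) * (sp s z * sp s y) := by
    intro s; rw [Finset.sum_mul]; exact Finset.sum_congr rfl fun z _ => by ring
  simp only [this]
  unfold E
  rw [av_sum, Finset.mul_sum, ← Equiv.sum_comp (Equiv.subLeft y) (fun u => β * (D.k (y - x - u) * D.G β u))]
  refine Finset.sum_congr rfl fun z _ => ?_
  rw [av_const_mul]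
  change _ * D.E β _ = _
  rw [D.E_spsp]
  simp only [Equiv.subLeft_apply]
  rw [← D.k_even (x - z), show y - x - (y - z) = -(x - z) by abel]; ring

lemma E_hh (β : ℝ) (x y : V) : D.E β (fun s => D.hh β x s * D.hh β y s) = D.TT β (y - x) := by
  have : ∀ s : V → Bool, D.hh β x s * D.hh β y s = ∑ z, (β * D.k (y - z)) * (D.hh β x s * sp s z) := by
    intro s; conv_lhs => rw [hh, hh, ]
    unfold lin
    rw [Finset.mul_sum]; exact Finset.sum_congr rfl fun z _ => by rw [hh, lin]; ring
  simp only [this]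
  unfold E
  rw [av_sum]
  unfold TT conv
  rw [Finset.mul_sum, ← Equiv.sum_comp (Equiv.subRight x) (fun u => β * (D.k (y - x - u) * D.H β u))]
  refine Finset.sum_congr rfl fun z _ => ?_
  rw [av_const_mul]
  change _ * D.E β _ = _
  rw [D.E_hsp]
  simp only [Equiv.subRight_apply]
  rw [show y - x - (z - x) = y - z by abel]; ring

lemma E_h2 (β : ℝ) (x : V) : D.E β (fun s => D.hh β x s ^ 2) = D.th β := by
  have := D.E_hh β x x
  simp only [sub_self] at this
  rw [← th] at this; rw [← this]; congr 1; funext s; ring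

lemma E_h4 {β : ℝ} (hβ : 0 ≤ β) (x : V) : D.E β (fun s => D.hh β x s ^ 4) ≤ 3 * D.th β ^ 2 := by
  rw [← D.E_h2 β x]
  exact moment4 (D.JJ_nonneg hβ) (fun v => mul_nonneg hβ (D.k_nonneg _))

lemma E_h6 {β : ℝ} (hβ : 0 ≤ β) (x : V) : D.E β (fun s => D.hh β x s ^ 6) ≤ 15 * D.th β ^ 3 := by
  rw [← D.E_h2 β x]
  exact moment6 (D.JJ_nonneg hβ) (fun v => mul_nonneg hβ (D.k_nonneg _))

/-- single flip -/
lemma energy_flip (β : ℝ) (x : V) (s : V → Bool) :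
    ∑ e, D.JJ β e * bd (flp {x} s) e = (∑ e, D.JJ β e * bd s e) - 2 * (sp s x * D.hh β x s) := by
  have key : ∀ u v, D.JJ β (u, v) * bd (flp {x} s) (u, v) = D.JJ β (u, v) * bd s (u, v)
      - (if u = x then β * D.k (x - v) * (sp s x * sp s v) else 0) - (if v = x then β * D.k (x - u) * (sp s x * sp s u) else 0) := by
    intro u v
    simp only [JJ, bd, sp_flp, Finset.mem_singleton]
    have e : D.k (u - v) = D.k (v - u) := by rw [← D.k_even, neg_sub]
    by_cases hu : u = x <;> by_cases hv : v = x
    · subst hu; subst hv; simp [D.k_zero]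
    · subst hu; simp [hv]; ring
    · subst hv; rw [e]; simp [hu]; ring
    · simp [hu, hv]
  rw [Fintype.sum_prod_type, Fintype.sum_prod_type]
  simp only [key, Finset.sum_sub_distrib]
  have e1 : ∑ u, ∑ v, (if u = x then β * D.k (x - v) * (sp s x * sp s v) else 0) = sp s x * D.hh β x s := by
    rw [Finset.sum_comm]
    simp only [Finset.sum_ite_eq', Finset.mem_univ, if_true]
    unfold hh lin; rw [Finset.mul_sum]; exact Finset.sum_congr rfl fun v _ => by ring
  have e2 : ∑ u, ∑ v, (if v = x then β * D.k (x - u) * (sp s x * sp s u) else 0) = sp s x * D.hh β x s := by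
    simp only [Finset.sum_ite_eq', Finset.mem_univ, if_true]
    unfold hh lin; rw [Finset.mul_sum]; exact Finset.sum_congr rfl fun v _ => by ring
  rw [e1, e2]; ring

lemma hh_flip (β : ℝ) (x : V) (s : V → Bool) : D.hh β x (flp {x} s) = D.hh β x s := by
  unfold hh lin
  refine Finset.sum_congr rfl fun z _ => ?_
  simp only [sp_flp, Finset.mem_singleton]
  split_ifs with h
  · subst h; simp [D.k_zero]
  · rfl

/-- DLR identity -/
lemma E_flip (β : ℝ) (x : V) (F : (V → Bool) → ℝ) (hF : ∀ s, F (flp {x} s) = F s) :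
    D.E β (fun s => (sp s x - D.tt β x s) * F s) = 0 := by
  unfold E av
  have h : ∑ s, wt (D.JJ β) s * ((sp s x - D.tt β x s) * F s) = 0 := by
    have h1 := sum_flp {x} (fun s => wt (D.JJ β) s * ((sp s x - D.tt β x s) * F s))
    have h2 : ∀ s, wt (D.JJ β) (flp {x} s) * ((sp (flp {x} s) x - D.tt β x (flp {x} s)) * F (flp {x} s)) =
        - (wt (D.JJ β) s * ((sp s x - D.tt β x s) * F s)) := by
      intro s
      have hw : wt (D.JJ β) (flp {x} s) = wt (D.JJ β) s * Real.exp (-(2 * (sp s x * D.hh β x s))) := by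
        unfold wt; rw [D.energy_flip, sub_eq_add_neg, Real.exp_add]
      rw [hw, hF, sp_flp, if_pos (Finset.mem_singleton_self x)]
      unfold tt
      rw [D.hh_flip]
      rcases sp_cases s x with hs | hs
      · rw [hs, one_mul]
        have := tanh_flip (D.hh β x s)
        linear_combination (wt (D.JJ β) s * F s) * this
      · rw [hs]
        have := tanh_flip (-D.hh β x s)
        rw [Real.tanh_neg] at this
        rw [show -(2 * (-1 * D.hh β x s)) = -(2 * -D.hh β x s) by ring]
        linear_combination (-(wt (D.JJ β) s * F s)) * this
    simp only [h2, Finset.sum_neg_distrib] at h1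
    linarith
  rw [h, zero_div]

lemma tt_flip (β : ℝ) (x : V) (s : V → Bool) : D.tt β x (flp {x} s) = D.tt β x s := by unfold tt; rw [D.hh_flip]
lemma tt_shift (β : ℝ) (a x : V) (s : V → Bool) : D.tt β x (shift a s) = D.tt β (x + a) s := by unfold tt; rw [D.hh_shift]

lemma E_t2 (β : ℝ) (x : V) : D.E β (fun s => D.tt β x s ^ 2) = D.tau β := by
  unfold tau
  rw [← D.E_shift β x (fun s => D.tt β 0 s ^ 2)]
  simp only [D.tt_shift, zero_add]

lemma E_st (β : ℝ) (x : V) : D.E β (fun s => sp s x * D.tt β x s) = D.tau β := by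
  have := D.E_flip β x (D.tt β x) (D.tt_flip β x)
  rw [← D.E_t2 β x]
  have e : (fun s => (sp s x - D.tt β x s) * D.tt β x s) = fun s => sp s x * D.tt β x s - D.tt β x s ^ 2 := by
    funext s; ring
  rw [e] at this
  unfold E at *
  rw [av_sub] at this; linarith

lemma tau_nonneg (β : ℝ) : 0 ≤ D.tau β := av_nonneg fun s => sq_nonneg _
lemma tau_le (β : ℝ) : D.tau β ≤ D.th β := by
  rw [← D.E_h2 β 0]; exact av_le fun s => tanh_sq_le _
lemma tau_ge {β : ℝ} (hβ : 0 ≤ β) : D.th β - 2 * D.th β ^ 2 ≤ D.tau β := by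
  have h4 := D.E_h4 hβ 0
  have h2 := D.E_h2 β 0
  have : D.E β (fun s => D.hh β 0 s ^ 2 - 2 / 3 * D.hh β 0 s ^ 4) ≤ D.tau β := av_le fun s => tanh_sq_ge _
  unfold E at *
  rw [av_sub, av_const_mul] at this
  linarith

/-- SD equation -/
lemma SD (β : ℝ) (y : V) : D.G β y = (1 - D.tau β) * del y + D.E β (fun s => D.tt β 0 s * sp s y) := by
  unfold del
  split_ifs with h
  · subst h
    have := D.E_st β 0
    have e : (fun s => D.tt β 0 s * sp s 0) = fun s => sp s 0 * D.tt β 0 s := by funext s; ring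
    rw [e, this, D.G_zero]; ring
  · have h1 := D.E_flip β 0 (fun s => sp s y) (fun s => by rw [sp_flp, if_neg]; simpa using h)
    have e : (fun s => (sp s 0 - D.tt β 0 s) * sp s y) = fun s => sp s 0 * sp s y - D.tt β 0 s * sp s y := by
      funext s; ring
    rw [e] at h1
    have h2 := D.E_spsp β 0 y
    unfold E at *
    rw [av_sub, h2, sub_zero] at h1
    linarith

lemma SD_le {β : ℝ} (hβ : 0 ≤ β) (y : V) :
    D.G β y ≤ del y + D.H β y - (1 / 3) * D.E β (fun s => D.hh β 0 s ^ 3 * sp s y) + D.rho β := by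
  rw [D.SD β y]
  have hd : (1 - D.tau β) * del y ≤ del y := by
    have := D.tau_nonneg β
    unfold del; split_ifs <;> linarith
  have h1 : D.E β (fun s => D.tt β 0 s * sp s y - D.hh β 0 s * sp s y + 1 / 3 * (D.hh β 0 s ^ 3 * sp s y)) ≤ D.rho β := by
    have h2 : D.E β (fun s => 1 / 15 * (D.γ * D.hh β 0 s ^ 4 + D.γ⁻¹ * D.hh β 0 s ^ 6)) ≤ D.rho β := by
      have h4 := D.E_h4 hβ 0; have h6 := D.E_h6 hβ 0
      unfold E at *
      rw [av_const_mul, av_add, av_const_mul, av_const_mul]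
      unfold rho
      have hγ := D.γ_pos
      have a1 := mul_le_mul_of_nonneg_left h4 hγ.le
      have a2 := mul_le_mul_of_nonneg_left h6 (inv_pos.2 hγ).le
      linarith
    refine le_trans (av_le fun s => ?_) h2
    have h3 := tanh_taylor D.γ_pos (D.hh β 0 s)
    have e : D.tt β 0 s * sp s y - D.hh β 0 s * sp s y + 1 / 3 * (D.hh β 0 s ^ 3 * sp s y) =
      (Real.tanh (D.hh β 0 s) - D.hh β 0 s + D.hh β 0 s ^ 3 / 3) * sp s y := by unfold tt; ring
    rw [e]
    refine (le_abs_self _).trans ?_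
    rw [abs_mul, abs_sp, mul_one]; linarith
  have h3 := D.E_hsp β 0 y
  rw [sub_zero] at h3
  unfold E at *
  rw [av_add, av_sub, av_const_mul] at h1
  linarith

lemma E_h3 (β : ℝ) (w : V) : D.E β (fun s => D.hh β 0 s ^ 3 * sp s w) =
    ∑ x, ∑ y, ∑ z, (β * D.k x) * (β * D.k y) * (β * D.k z) * av (D.JJ β) (mono [x, y, z, w]) := by
  have : (fun s : V → Bool => D.hh β 0 s ^ 3 * sp s w) = fun s => ∑ x, ∑ y, ∑ z, (β * D.k x) * (β * D.k y) * (β * D.k z) * mono [x, y, z, w] s := by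
    funext s
    have e : D.hh β 0 s = ∑ x, β * D.k x * sp s x := by
      unfold hh lin; exact Finset.sum_congr rfl fun z _ => by
        show β * D.k (0 - z) * sp s z = _
        rw [zero_sub, D.k_even]
    rw [e, pow_succ, sq, Finset.sum_mul_sum, Finset.sum_mul, Finset.sum_mul]
    refine Finset.sum_congr rfl fun x _ => ?_
    rw [Finset.sum_mul, Finset.sum_mul]
    refine Finset.sum_congr rfl fun y _ => ?_
    rw [Finset.mul_sum, Finset.sum_mul]
    refine Finset.sum_congr rfl fun z _ => ?_
    rw [mono_four]; ring
  rw [this]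
  unfold E
  simp only [av_sum, av_const_mul]

lemma E_h3_nonneg {β : ℝ} (hβ : 0 ≤ β) (w : V) : 0 ≤ D.E β (fun s => D.hh β 0 s ^ 3 * sp s w) := by
  rw [D.E_h3]
  refine Finset.sum_nonneg fun x _ => Finset.sum_nonneg fun y _ => Finset.sum_nonneg fun z _ => ?_
  have := gks1 (D.JJ_nonneg hβ) [x, y, z, w]
  have := D.k_nonneg x; have := D.k_nonneg y; have := D.k_nonneg z
  positivity

lemma G_le {β : ℝ} (hβ : 0 ≤ β) (y : V) : D.G β y ≤ del y + D.H β y + D.rho β := by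
  have := D.SD_le hβ y; have := D.E_h3_nonneg hβ y; linarith

lemma rho_nonneg {β : ℝ} (hβ : 0 ≤ β) : 0 ≤ D.rho β := by
  unfold rho; have := D.th_nonneg hβ; have := D.γ_pos; positivity

lemma H_le {β : ℝ} (hβ : 0 ≤ β) (y : V) : D.H β y ≤ β * D.k y + D.TT β y + β * D.rho β := by
  have h := conv_mono D.k_nonneg (D.G_le hβ) y
  rw [conv_add D.k (fun y => del y + D.H β y), conv_add D.k del, conv_del, conv_const, D.k_sum] at h
  unfold TT
  change β * conv D.k (D.G β) y ≤ _
  have := mul_le_mul_of_nonneg_left h hβ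
  linarith

/-- sum against kernel -/
lemma kG (β β' : ℝ) (u : V) : ∑ x, (β * D.k x) * D.G β' (u - x) = β * conv D.k (D.G β') u := by
  rw [conv_comm]; unfold conv; rw [Finset.mul_sum]
  exact Finset.sum_congr rfl fun x _ => by ring

lemma h3_lower {β β' : ℝ} (h0 : 0 ≤ β') (hb : β' ≤ β) (w : V) :
    (D.th β + 2 * (β ^ 2 * conv D.k (conv D.k (D.G β')) 0)) * D.H β w
      - 2 * conv (fun u => (β * conv D.k (D.G β') u) ^ 2 * D.H β u) (D.G β) w
      ≤ D.E β (fun s => D.hh β 0 s ^ 3 * sp s w) := by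
  rw [D.E_h3]
  set c : V → ℝ := fun x => β * D.k x with hc
  have hc0 : ∀ x, 0 ≤ c x := fun x => mul_nonneg (h0.trans hb) (D.k_nonneg x)
  set H' : V → ℝ := fun u => β * conv D.k (D.G β') u with hH'
  have cG : ∀ u, ∑ x, c x * D.G β (u - x) = D.H β u := fun u => D.kG β β u
  have cG' : ∀ u, ∑ x, c x * D.G β' (u - x) = H' u := fun u => D.kG β β' u
  have ev : ∀ b (x y : V), D.G b (x - y) = D.G b (y - x) := fun b x y => by rw [← D.G_even, neg_sub]
  have th1 : ∑ x, c x * D.H β x = D.th β := by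
    unfold th TT; rw [conv_zero_even D.k_even, Finset.mul_sum]; exact Finset.sum_congr rfl fun x _ => by rw [hc]; ring
  have th2 : ∑ x, c x * H' x = β ^ 2 * conv D.k (conv D.k (D.G β')) 0 := by
    rw [conv_zero_even D.k_even, Finset.mul_sum]; exact Finset.sum_congr rfl fun x _ => by rw [hc, hH']; ring
  have step : ∀ x y z, c x * c y * c z * (D.G β (y - x) * D.G β (w - z) + D.G β' (z - x) * D.G β (w - y) + D.G β' (z - y) * D.G β (w - x)
      - ∑ u, (D.G β' (u - x) * D.G β' (u - z) * (D.G β (u - y) * D.G β (w - u)) + D.G β' (u - y) * D.G β' (u - z) * (D.G β (u - x) * D.G β (w - u))))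
      ≤ c x * c y * c z * av (D.JJ β) (mono [x, y, z, w]) := by
    intro x y z
    refine mul_le_mul_of_nonneg_left ?_ (mul_nonneg (mul_nonneg (hc0 x) (hc0 y)) (hc0 z))
    have := tree_ineq (D.JJ_nonneg h0) (D.JJ_mono hb) x y z w
    simp only [D.G2_eq] at this
    simpa only [ev β' z] using this
  refine le_trans (le_of_eq ?_) (Finset.sum_le_sum fun x _ => Finset.sum_le_sum fun y _ => Finset.sum_le_sum fun z _ => step x y z)
  have s1 : ∑ x, ∑ y, ∑ z, c x * c y * c z * (D.G β (y - x) * D.G β (w - z)) = D.th β * D.H β w := by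
    have : ∀ x y, ∑ z, c x * c y * c z * (D.G β (y - x) * D.G β (w - z)) = c x * c y * D.G β (x - y) * D.H β w := by
      intro x y; rw [← cG w, Finset.mul_sum]; exact Finset.sum_congr rfl fun z _ => by rw [ev β x]; ring
    simp only [this]
    have : ∀ x, ∑ y, c x * c y * D.G β (x - y) * D.H β w = c x * D.H β x * D.H β w := by
      intro x; rw [← Finset.sum_mul, ← cG x, Finset.mul_sum]; congr 1; exact Finset.sum_congr rfl fun z _ => by ring
    simp only [this]
    rw [← Finset.sum_mul, th1]
  have s2 : ∑ x, ∑ y, ∑ z, c x * c y * c z * (D.G β' (z - x) * D.G β (w - y)) = (∑ x, c x * H' x) * D.H β w := by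
    have : ∀ x y, ∑ z, c x * c y * c z * (D.G β' (z - x) * D.G β (w - y)) = c x * H' x * (c y * D.G β (w - y)) := by
      intro x y; rw [← cG' x, Finset.mul_sum, Finset.sum_mul]; exact Finset.sum_congr rfl fun z _ => by rw [ev β' x]; ring
    simp only [this]
    rw [Finset.sum_mul]
    refine Finset.sum_congr rfl fun x _ => ?_
    rw [← Finset.mul_sum, cG]
  have s3 : ∑ x, ∑ y, ∑ z, c x * c y * c z * (D.G β' (z - y) * D.G β (w - x)) = (∑ x, c x * H' x) * D.H β w := by
    rw [Finset.sum_comm, ← s2]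
    refine Finset.sum_congr rfl fun x _ => Finset.sum_congr rfl fun y _ => Finset.sum_congr rfl fun z _ => by ring
  have s4 : ∑ x, ∑ y, ∑ z, c x * c y * c z * ∑ u, (D.G β' (u - x) * D.G β' (u - z) * (D.G β (u - y) * D.G β (w - u)))
      = conv (fun u => H' u ^ 2 * D.H β u) (D.G β) w := by
    rw [conv_comm]; unfold conv
    have e : ∀ x y z, c x * c y * c z * ∑ u, (D.G β' (u - x) * D.G β' (u - z) * (D.G β (u - y) * D.G β (w - u))) =
      ∑ u, D.G β (w - u) * ((c x * D.G β' (u - x)) * ((c y * D.G β (u - y)) * (c z * D.G β' (u - z)))) := by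
      intro x y z; rw [Finset.mul_sum]; exact Finset.sum_congr rfl fun u _ => by ring
    simp only [e]
    have sw : ∀ x, ∑ y, ∑ z, ∑ u, D.G β (w - u) * ((c x * D.G β' (u - x)) * ((c y * D.G β (u - y)) * (c z * D.G β' (u - z)))) =
        ∑ u, D.G β (w - u) * ((c x * D.G β' (u - x)) * (D.H β u * H' u)) := by
      intro x
      have : ∀ y, ∑ z, ∑ u, D.G β (w - u) * ((c x * D.G β' (u - x)) * ((c y * D.G β (u - y)) * (c z * D.G β' (u - z)))) =
        ∑ u, D.G β (w - u) * ((c x * D.G β' (u - x)) * ((c y * D.G β (u - y)) * H' u)) := by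
        intro y
        rw [Finset.sum_comm]
        refine Finset.sum_congr rfl fun u _ => ?_
        rw [← cG' u]; simp only [Finset.mul_sum]
      simp only [this]
      rw [Finset.sum_comm]
      refine Finset.sum_congr rfl fun u _ => ?_
      rw [← cG u]; simp only [Finset.mul_sum, Finset.sum_mul]
    simp only [sw]
    rw [Finset.sum_comm]
    refine Finset.sum_congr rfl fun u _ => ?_
    rw [← Finset.mul_sum, ← Finset.sum_mul, cG']; ring
  have s5 : ∑ x, ∑ y, ∑ z, c x * c y * c z * ∑ u, (D.G β' (u - y) * D.G β' (u - z) * (D.G β (u - x) * D.G β (w - u)))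
      = conv (fun u => H' u ^ 2 * D.H β u) (D.G β) w := by
    rw [← s4, Finset.sum_comm]
    refine Finset.sum_congr rfl fun x _ => Finset.sum_congr rfl fun y _ => Finset.sum_congr rfl fun z _ => by
      rw [mul_comm (c y) (c x)]
  simp only [mul_sub, mul_add, Finset.sum_sub_distrib, Finset.sum_add_distrib]
  rw [s1, s2, s3, s4, s5, th2]; ring

/-- the skeleton inequality -/
lemma G_skel {β β' : ℝ} (h0 : 0 ≤ β') (hb : β' ≤ β) (y : V) :
    D.G β y ≤ del y + β * (1 - D.th β / 3 - 2 / 3 * (β ^ 2 * conv D.k (conv D.k (D.G β')) 0)) * conv D.k (D.G β) y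
      + (2 / 3 * conv (fun u => (β * conv D.k (D.G β') u) ^ 2 * D.H β u) (D.G β) y + D.rho β) := by
  have h1 := D.SD_le (h0.trans hb) y
  have h2 := D.h3_lower h0 hb y
  have e : D.H β y = β * conv D.k (D.G β) y := rfl
  rw [e] at h1 h2
  linarith

lemma E_cont (F : ℝ → (V → Bool) → ℝ) (hF : ∀ s, Continuous (fun β => F β s)) : Continuous (fun β => D.E β (F β)) := by
  unfold E av
  refine Continuous.div ?_ ?_ (fun β => (Zp_pos _).ne')
  · refine continuous_finset_sum _ fun s _ => Continuous.mul ?_ (hF s)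
    unfold wt JJ
    fun_prop
  · unfold Zp wt JJ
    fun_prop

lemma G_cont (x : V) : Continuous (fun β => D.G β x) := D.E_cont (fun _ => mono [0, x]) (fun s => continuous_const)
lemma H_cont (x : V) : Continuous (fun β => D.H β x) := by
  unfold H conv
  exact continuous_id.mul (continuous_finset_sum _ fun y _ => continuous_const.mul (D.G_cont y))
lemma th_cont : Continuous D.th := by
  have : D.th = fun β => β * ∑ y, D.k (0 - y) * D.H β y := rfl
  rw [this]
  exact continuous_id.mul (continuous_finset_sum _ fun y _ => continuous_const.mul (D.H_cont y))

end KD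

end PartP9b

section PartP10
namespace KD
variable {V : Type} [Fintype V] [DecidableEq V] [AddCommGroup V] {c0 C0 : ℝ} (D : KD V c0 C0)

lemma E_add (β : ℝ) (F H : (V → Bool) → ℝ) : D.E β (fun s => F s + H s) = D.E β F + D.E β H := av_add _ _ _
lemma E_sub (β : ℝ) (F H : (V → Bool) → ℝ) : D.E β (fun s => F s - H s) = D.E β F - D.E β H := av_sub _ _ _
lemma E_smul (β c : ℝ) (F : (V → Bool) → ℝ) : D.E β (fun s => c * F s) = c * D.E β F := av_const_mul _ _ _
lemma E_const (β c : ℝ) : D.E β (fun _ => c) = c := av_const _ _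
lemma E_le {β : ℝ} {F H : (V → Bool) → ℝ} (h : ∀ s, F s ≤ H s) : D.E β F ≤ D.E β H := av_le h
lemma E_nonneg {β : ℝ} {F : (V → Bool) → ℝ} (h : ∀ s, 0 ≤ F s) : 0 ≤ D.E β F := av_nonneg h
lemma E_abs {β : ℝ} {F H : (V → Bool) → ℝ} (h : ∀ s, |F s| ≤ H s) : |D.E β F| ≤ D.E β H := abs_av_le h

def YY (β : ℝ) (x : V) (s : V → Bool) : ℝ := sp s x - D.tt β x s
def Yf (β : ℝ) (y : V) : ℝ := D.E β (fun s => D.YY β 0 s * D.YY β y s)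

lemma YY_shift (β : ℝ) (a x : V) (s : V → Bool) : D.YY β x (shift a s) = D.YY β (x + a) s := by
  unfold YY; rw [D.tt_shift, sp_shift]

lemma E_YY (β : ℝ) (x y : V) : D.E β (fun s => D.YY β x s * D.YY β y s) = D.Yf β (y - x) := by
  unfold Yf
  rw [← D.E_shift β x (fun s => D.YY β 0 s * D.YY β (y - x) s)]
  simp only [D.YY_shift, zero_add, sub_add_cancel]

lemma Yf_even (β : ℝ) : Even' (D.Yf β) := fun x => by
  have h1 := D.E_YY β x 0; have h2 := D.E_YY β 0 x
  rw [zero_sub] at h1; rw [sub_zero] at h2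
  rw [← h1, ← h2]; congr 1; funext s; ring

lemma E_sY (β : ℝ) (x y : V) : D.E β (fun s => sp s x * D.YY β y s) = (1 - D.tau β) * del (y - x) := by
  unfold del
  split_ifs with h
  · have h : y = x := sub_eq_zero.1 h
    subst h
    have e : (fun s => sp s y * D.YY β y s) = fun s => 1 - sp s y * D.tt β y s := by
      funext s; have := sp_sq s y; unfold YY; linear_combination this
    rw [e, D.E_sub, D.E_const, D.E_st]; ring
  · have h : x ≠ y := fun e => h (by rw [e, sub_self])
    have h1 := D.E_flip β y (fun s => sp s x) (fun s => by rw [sp_flp, if_neg]; simpa using h)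
    rw [mul_zero, ← h1]; congr 1; funext s; unfold YY; ring

/-- quadratic forms -/
lemma quad (q : V → ℝ) (hq : Even' q) (ω : V) :
    ∑ x, ∑ y, D.co ω x * D.co ω y * q (y - x) = D.hat q ω * ∑ x, D.co ω x ^ 2 := by
  have : ∀ x, ∑ y, D.co ω x * D.co ω y * q (y - x) = D.co ω x * conv q (D.co ω) x := by
    intro x; unfold conv; rw [Finset.mul_sum]
    exact Finset.sum_congr rfl fun y _ => by rw [← hq, neg_sub]; ring
  simp only [this, D.conv_co hq]
  rw [Finset.mul_sum]; exact Finset.sum_congr rfl fun x _ => by ring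

lemma co_sq_pos (ω : V) : 0 < ∑ x, D.co ω x ^ 2 := by
  refine Finset.sum_pos' (fun x _ => sq_nonneg _) ⟨0, Finset.mem_univ _, ?_⟩
  rw [D.co_zero]; norm_num

lemma E_bil (β : ℝ) (v : V → ℝ) (F H : V → (V → Bool) → ℝ) (q : V → ℝ)
    (h : ∀ x y, D.E β (fun s => F x s * H y s) = q (y - x)) :
    D.E β (fun s => (∑ x, v x * F x s) * (∑ y, v y * H y s)) = ∑ x, ∑ y, v x * v y * q (y - x) := by
  have e : (fun s => (∑ x, v x * F x s) * (∑ y, v y * H y s)) = fun s => ∑ x, ∑ y, v x * v y * (F x s * H y s) := by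
    funext s
    rw [Finset.sum_mul_sum]
    exact Finset.sum_congr rfl fun x _ => Finset.sum_congr rfl fun y _ => by ring
  rw [e]
  unfold E at *
  simp only [av_sum, av_const_mul, h]

lemma hat_del (ω : V) : D.hat del ω = 1 := by
  unfold hat del; simp [D.co_zero]

lemma Yhat_nonneg (β : ℝ) (ω : V) : 0 ≤ D.hat (D.Yf β) ω := by
  have h := D.E_bil β (D.co ω) (D.YY β) (D.YY β) (D.Yf β) (D.E_YY β)
  rw [D.quad _ (D.Yf_even β)] at h
  have h0 : 0 ≤ D.E β (fun s => (∑ x, D.co ω x * D.YY β x s) * (∑ y, D.co ω y * D.YY β y s)) :=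
    D.E_nonneg fun s => mul_self_nonneg _
  rw [h] at h0
  exact nonneg_of_mul_nonneg_left h0 (D.co_sq_pos ω)

lemma Ghat_nonneg (β : ℝ) (ω : V) : 0 ≤ D.hat (D.G β) ω := by
  have h := D.E_bil β (D.co ω) (fun x s => sp s x) (fun x s => sp s x) (D.G β) (D.E_spsp β)
  rw [D.quad _ (D.G_even β)] at h
  have h0 : 0 ≤ D.E β (fun s => (∑ x, D.co ω x * sp s x) * (∑ y, D.co ω y * sp s y)) :=
    D.E_nonneg fun s => mul_self_nonneg _
  rw [h] at h0
  exact nonneg_of_mul_nonneg_left h0 (D.co_sq_pos ω)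

lemma CRquad (β l : ℝ) (ω : V) : 0 ≤ D.hat (D.G β) ω - 2 * l * (1 - D.tau β) + l ^ 2 * D.hat (D.Yf β) ω := by
  have h1 := D.E_bil β (D.co ω) (fun x s => sp s x) (fun x s => sp s x) (D.G β) (D.E_spsp β)
  have h2 := D.E_bil β (D.co ω) (D.YY β) (D.YY β) (D.Yf β) (D.E_YY β)
  have h3 := D.E_bil β (D.co ω) (fun x s => sp s x) (D.YY β) (fun x => (1 - D.tau β) * del x) (D.E_sY β)
  rw [D.quad _ (D.G_even β)] at h1
  rw [D.quad _ (D.Yf_even β)] at h2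
  have he : Even' (fun x : V => (1 - D.tau β) * del x) := fun x => by unfold del; simp
  rw [D.quad _ he] at h3
  have e3 : D.hat (fun x => (1 - D.tau β) * del x) ω = 1 - D.tau β := by
    have := D.hat_del ω
    unfold hat at *
    simp only [mul_assoc]; rw [← Finset.mul_sum, this, mul_one]
  rw [e3] at h3
  have h0 : 0 ≤ D.E β (fun s => (∑ x, D.co ω x * sp s x - l * ∑ x, D.co ω x * D.YY β x s) ^ 2) :=
    D.E_nonneg fun s => sq_nonneg _
  have e : (fun s => (∑ x, D.co ω x * sp s x - l * ∑ x, D.co ω x * D.YY β x s) ^ 2) =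
      fun s => ((∑ x, D.co ω x * sp s x) * (∑ x, D.co ω x * sp s x) - (2 * l) * ((∑ x, D.co ω x * sp s x) * ∑ x, D.co ω x * D.YY β x s))
        + l ^ 2 * ((∑ x, D.co ω x * D.YY β x s) * ∑ x, D.co ω x * D.YY β x s) := by
    funext s; ring
  rw [e, D.E_add, D.E_sub, D.E_smul, D.E_smul, h1, h2, h3] at h0
  have := D.co_sq_pos ω
  refine nonneg_of_mul_nonneg_left (b := ∑ x, D.co ω x ^ 2) ?_ this
  linarith

lemma E_t22 {β : ℝ} (hβ : 0 ≤ β) (y : V) : D.E β (fun s => D.tt β 0 s ^ 2 * D.tt β y s ^ 2) ≤ 3 * D.th β ^ 2 := by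
  have h0 := D.E_h4 hβ 0
  have hy := D.E_h4 hβ y
  have h : D.E β (fun s => D.tt β 0 s ^ 2 * D.tt β y s ^ 2) ≤ D.E β (fun s => (1/2) * (D.hh β 0 s ^ 4 + D.hh β y s ^ 4)) := by
    refine D.E_le fun s => ?_
    have a1 := tanh_sq_le (D.hh β 0 s); have a2 := tanh_sq_le (D.hh β y s)
    change D.tt β 0 s ^ 2 ≤ _ at a1
    change D.tt β y s ^ 2 ≤ _ at a2
    have := mul_le_mul a1 a2 (sq_nonneg _) (sq_nonneg _)
    nlinarith [sq_nonneg (D.hh β 0 s ^ 2 - D.hh β y s ^ 2)]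
  rw [D.E_smul, D.E_add] at h
  linarith

lemma hh_flip' (β : ℝ) (y : V) (s : V → Bool) :
    D.hh β y (flp {0} s) = D.hh β y s - 2 * (β * D.k y * sp s 0) := by
  unfold hh lin
  have : ∀ z, β * D.k (y - z) * sp (flp {0} s) z = β * D.k (y - z) * sp s z - (if z = 0 then 2 * (β * D.k y * sp s 0) else 0) := by
    intro z
    simp only [sp_flp, Finset.mem_singleton]
    split_ifs with h
    · subst h; rw [sub_zero]; ring
    · ring
  simp only [this, Finset.sum_sub_distrib, Finset.sum_ite_eq', Finset.mem_univ, if_true]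

lemma Yf_approx {β : ℝ} (hβ : 0 ≤ β) (y : V) :
    |D.Yf β y - ((1 - D.tau β) * del y - (1 - 2 * D.tau β) * (β * D.k y))| ≤
      3 * D.th β ^ 2 * (β * D.k y) + 4 * (β * D.k y) ^ 2 := by
  by_cases hy : y = 0
  · subst hy
    rw [D.k_zero]
    have e : (fun s => D.YY β 0 s * D.YY β 0 s) = fun s => (1 - 2 * (sp s 0 * D.tt β 0 s)) + D.tt β 0 s ^ 2 := by
      funext s; have := sp_sq s 0; unfold YY; linear_combination this
    unfold Yf
    rw [e, D.E_add, D.E_sub, D.E_const, D.E_smul, D.E_st, D.E_t2]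
    have : (del (0:V)) = 1 := by simp [del]
    rw [this]
    simp; ring
  · have hd : del y = 0 := by simp [del, hy]
    set J := β * D.k y with hJ
    have hJ0 : 0 ≤ J := mul_nonneg hβ (D.k_nonneg y)
    set h' : (V → Bool) → ℝ := fun s => D.hh β y s - J * sp s 0 with hh'
    set O : (V → Bool) → ℝ := fun s => (Real.tanh (h' s + J) - Real.tanh (h' s - J)) / 2 with hO
    set P : (V → Bool) → ℝ := fun s => (Real.tanh (h' s + J) + Real.tanh (h' s - J)) / 2 with hP
    have f0 : ∀ s, h' (flp {0} s) = h' s := by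
      intro s
      simp only [hh', D.hh_flip', sp_flp, Finset.mem_singleton, if_true]; rw [hJ]; ring
    have fO : ∀ s, O (flp {0} s) = O s := fun s => by simp only [hO, f0]
    have fP : ∀ s, P (flp {0} s) = P s := fun s => by simp only [hP, f0]
    have dec : ∀ s, D.tt β y s = P s + sp s 0 * O s := by
      intro s
      have : D.hh β y s = h' s + J * sp s 0 := by rw [hh']; ring
      unfold tt; rw [this]
      rcases sp_cases s 0 with hs | hs <;> rw [hs] <;> simp only [hP, hO]
      · rw [mul_one]; ring
      · rw [show h' s + J * -1 = h' s - J by ring]; ring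
    have g1 := D.E_flip β 0 (fun s => sp s y) (fun s => by rw [sp_flp, if_neg]; simpa using hy)
    have g2 := D.E_flip β 0 P fP
    have g3 := D.E_flip β 0 (fun s => D.tt β 0 s * O s) (fun s => by rw [D.tt_flip, fO])
    have hY : D.Yf β y = - D.E β (fun s => (1 - D.tt β 0 s ^ 2) * O s) := by
      unfold Yf
      have e : (fun s => D.YY β 0 s * D.YY β y s) = fun s => (((sp s 0 - D.tt β 0 s) * sp s y - (sp s 0 - D.tt β 0 s) * P s)
          + (sp s 0 - D.tt β 0 s) * (D.tt β 0 s * O s)) - (1 - D.tt β 0 s ^ 2) * O s := by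
        funext s
        have := sp_sq s 0
        unfold YY; rw [dec s]; linear_combination (-O s) * this
      rw [e, D.E_sub, D.E_add, D.E_sub, g1, g2, g3]; ring
    have b1 : |D.E β (fun s => (1 - D.tt β 0 s ^ 2) * (O s - J * (1 - D.tt β y s ^ 2)))| ≤ D.E β (fun _ => 4 * J ^ 2) := by
      refine D.E_abs fun s => ?_
      have t0 : D.tt β 0 s ^ 2 ≤ 1 := tanh_sq_le_one _
      have t1 := sq_nonneg (D.tt β 0 s)
      have := tanh_O (h := D.hh β y s) (h' s) hJ0 (by
        rcases sp_cases s 0 with hs | hs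
        · left; simp only [hh', hs]; ring
        · right; simp only [hh', hs]; ring)
      change |O s - J * (1 - D.tt β y s ^ 2)| ≤ _ at this
      rw [abs_mul, abs_of_nonneg (by linarith : 0 ≤ 1 - D.tt β 0 s ^ 2)]
      have := abs_nonneg (O s - J * (1 - D.tt β y s ^ 2))
      nlinarith
    rw [D.E_const] at b1
    have e : (fun s => (1 - D.tt β 0 s ^ 2) * (O s - J * (1 - D.tt β y s ^ 2))) = fun s => (1 - D.tt β 0 s ^ 2) * O s
      - J * (((1 - D.tt β 0 s ^ 2) - D.tt β y s ^ 2) + D.tt β 0 s ^ 2 * D.tt β y s ^ 2) := by funext s; ring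
    rw [e, D.E_sub, D.E_smul, D.E_add, D.E_sub, D.E_sub, D.E_const, D.E_t2, D.E_t2] at b1
    have q1 := D.E_t22 hβ y
    have q0 : 0 ≤ D.E β (fun s => D.tt β 0 s ^ 2 * D.tt β y s ^ 2) := D.E_nonneg fun s => by positivity
    set q := D.E β (fun s => D.tt β 0 s ^ 2 * D.tt β y s ^ 2)
    rw [hY, hd]
    set m := D.E β (fun s => (1 - D.tt β 0 s ^ 2) * O s)
    have c1 := mul_le_mul_of_nonneg_left q1 hJ0
    have c0 := mul_nonneg hJ0 q0
    rw [abs_le] at b1 ⊢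
    constructor <;> nlinarith [b1.1, b1.2]

def dd (β : ℝ) : ℝ := (1 - D.tau β) - β * (1 - 2 * D.tau β)
def ee (β : ℝ) : ℝ := 3 * D.th β ^ 2 * β + 4 * β ^ 2 * C0 * D.g

lemma Yhat_approx {β : ℝ} (hβ : 0 ≤ β) (ω : V) :
    |D.hat (D.Yf β) ω - ((1 - D.tau β) * (1 - D.κ ω) + D.dd β * D.κ ω)| ≤ D.ee β := by
  have e : D.hat (D.Yf β) ω - ((1 - D.tau β) * (1 - D.κ ω) + D.dd β * D.κ ω) =
      ∑ y, (D.Yf β y - ((1 - D.tau β) * del y - (1 - 2 * D.tau β) * (β * D.k y))) * D.co ω y := by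
    have h1 := D.hat_del ω
    have h2 : ∑ y, D.k y * D.co ω y = D.κ ω := rfl
    have h3 : ∑ y, D.Yf β y * D.co ω y = D.hat (D.Yf β) ω := rfl
    unfold hat at h1
    have : ∀ y, (D.Yf β y - ((1 - D.tau β) * del y - (1 - 2 * D.tau β) * (β * D.k y))) * D.co ω y =
      D.Yf β y * D.co ω y - (1 - D.tau β) * (del y * D.co ω y) + ((1 - 2 * D.tau β) * β) * (D.k y * D.co ω y) := fun y => by ring
    simp only [this, Finset.sum_add_distrib, Finset.sum_sub_distrib, ← Finset.mul_sum, h1, h2, h3]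
    unfold dd; ring
  rw [e]
  refine (Finset.abs_sum_le_sum_abs _ _).trans ?_
  have b : ∀ y ∈ Finset.univ, |(D.Yf β y - ((1 - D.tau β) * del y - (1 - 2 * D.tau β) * (β * D.k y))) * D.co ω y| ≤
      (3 * D.th β ^ 2 * β + 4 * β ^ 2 * (C0 * D.g)) * D.k y := by
    intro y _
    rw [abs_mul]
    have h1 := D.Yf_approx hβ y
    have h2 := D.co_abs ω y
    have hk := D.k_le y
    change D.k y ≤ C0 * D.g at hk
    have hk0 := D.k_nonneg y
    have h3 := mul_le_mul_of_nonneg_left hk hk0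
    have h4 := mul_le_mul_of_nonneg_left h3 (by positivity : 0 ≤ 4 * β ^ 2)
    calc _ ≤ |D.Yf β y - ((1 - D.tau β) * del y - (1 - 2 * D.tau β) * (β * D.k y))| := mul_le_of_le_one_right (abs_nonneg _) h2
      _ ≤ _ := by nlinarith
  refine (Finset.sum_le_sum b).trans (le_of_eq ?_)
  rw [← Finset.mul_sum, D.k_sum]; unfold ee; ring

lemma ee_nonneg {β : ℝ} (hβ : 0 ≤ β) : 0 ≤ D.ee β := by
  unfold ee; have := D.g_pos; have := D.C0_ge; positivity

lemma dd_ge {β : ℝ} (hβ : 0 ≤ β) : - D.ee β ≤ D.dd β := by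
  have h := D.Yhat_approx hβ 0
  have h0 := D.Yhat_nonneg β 0
  rw [D.κ_zero, abs_le] at h
  linarith [h.1, h.2]

/-- the lower bound on the Fourier transform of the correlation function -/
lemma CR {β p : ℝ} (hβ : 0 ≤ β) (hτ : D.tau β < 1) (hp : 0 < p) (h : |D.dd β| + D.ee β ≤ (1 - D.tau β) * p) (ω : V) :
    (1 - D.tau β) / (1 - D.κ ω + p) ≤ D.hat (D.G β) ω := by
  have h1 := D.κ_le ω
  have h2 := abs_le.1 (D.Yhat_approx hβ ω)
  have h3 := D.κ_abs ω
  have h4 : D.dd β * D.κ ω ≤ |D.dd β| := by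
    calc _ ≤ |D.dd β * D.κ ω| := le_abs_self _
      _ ≤ _ := by rw [abs_mul]; exact mul_le_of_le_one_right (abs_nonneg _) h3
  set q := 1 - D.κ ω + p with hq
  have hq0 : 0 < q := by linarith
  have h5 : D.hat (D.Yf β) ω ≤ (1 - D.tau β) * q := by nlinarith [h2.2]
  have h6 := D.CRquad β q⁻¹ ω
  have h7 : q⁻¹ ^ 2 * D.hat (D.Yf β) ω ≤ q⁻¹ * (1 - D.tau β) := by
    calc _ ≤ q⁻¹ ^ 2 * ((1 - D.tau β) * q) := mul_le_mul_of_nonneg_left h5 (by positivity)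
      _ = _ := by field_simp
  rw [div_eq_mul_inv]
  nlinarith

end KD

end PartP10

section PartP11
namespace KD
variable {V : Type} [Fintype V] [DecidableEq V] [AddCommGroup V] {c0 C0 : ℝ} (D : KD V c0 C0)

/-- smallness condition -/
def Sm (B : ℝ) : Prop := 100 ≤ B ∧ D.γ * (D.cg + B) ^ 3 * B ≤ 1

lemma Sm.one {D : KD V c0 C0} {B : ℝ} (h : D.Sm B) : D.g * (D.cg + B) ^ 2 * B ≤ 1 := by
  obtain ⟨hB, h⟩ := h
  have hc := D.cg_nonneg
  have hg := D.g_pos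
  have hγ := D.γ_pos
  refine le_trans ?_ h
  have h1 := D.g_le_γ
  have h2 : (D.cg + B) ^ 2 ≤ (D.cg + B) ^ 3 := pow_le_pow_right₀ (by linarith) (by norm_num)
  gcongr

lemma Sm.two {D : KD V c0 C0} {B : ℝ} (h : D.Sm B) : D.g * (D.cg + B) * B ^ 2 ≤ 1 := by
  have h1 := h.one
  obtain ⟨hB, h⟩ := h
  have hc := D.cg_nonneg
  have hg := D.g_pos
  refine le_trans ?_ h1
  have : D.g * (D.cg + B) ^ 2 * B - D.g * (D.cg + B) * B ^ 2 = D.g * (D.cg + B) * B * D.cg := by ring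
  have : 0 ≤ D.g * (D.cg + B) * B * D.cg := by positivity
  linarith

lemma Sm.three {D : KD V c0 C0} {B : ℝ} (h : D.Sm B) : D.g * B ^ 3 ≤ 1 := by
  have h1 := h.two
  obtain ⟨hB, h⟩ := h
  have hc := D.cg_nonneg
  have hg := D.g_pos
  refine le_trans ?_ h1
  have : 0 ≤ D.g * D.cg * B ^ 2 := by positivity
  nlinarith

lemma Sm.le {D : KD V c0 C0} {B : ℝ} (h : D.Sm B) : D.g * (D.cg + B) ≤ 1 / 10000 := by
  have h1 := h.two
  obtain ⟨hB, h⟩ := h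
  have hc := D.cg_nonneg
  have hg := D.g_pos
  have : 10000 ≤ B ^ 2 := by nlinarith
  have : 0 ≤ D.g * (D.cg + B) := by positivity
  nlinarith

lemma Sm.sq {D : KD V c0 C0} {B : ℝ} (h : D.Sm B) : D.g * (D.cg + B) ^ 2 ≤ 1 / 100 := by
  have h1 := h.one
  obtain ⟨hB, h⟩ := h
  have : 0 ≤ D.g * (D.cg + B) ^ 2 := by have := D.g_pos; positivity
  nlinarith

lemma Sm.r {D : KD V c0 C0} {B r : ℝ} (h : D.Sm B) (hr : 1 ≤ r) (hrB : r ≤ B) : D.g * r ^ 2 ≤ 1 / 4 := by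
  have h1 := h.sq
  have hc := D.cg_nonneg
  have hg := D.g_pos
  have : r ^ 2 ≤ (D.cg + B) ^ 2 := by gcongr; linarith
  nlinarith

lemma rho_le {β X : ℝ} (hβ : 0 ≤ β) (hX : 1 ≤ X) (h : D.th β ≤ D.g * X) : D.rho β ≤ 2 * (D.γ * D.g ^ 2 * X ^ 3) := by
  have hγ := D.γ_pos
  have hg := D.g_pos
  have h0 := D.th_nonneg hβ
  unfold rho
  have h2 : D.th β ^ 2 ≤ (D.g * X) ^ 2 := by gcongr
  have h3 : D.th β ^ 3 ≤ (D.g * X) ^ 3 := by gcongr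
  have e3 : D.γ⁻¹ * (D.g * X) ^ 3 = D.γ * D.g ^ 2 * X ^ 3 := by unfold g; field_simp
  have e2 : D.γ * (D.g * X) ^ 2 ≤ D.γ * D.g ^ 2 * X ^ 3 := by
    have : X ^ 2 ≤ X ^ 3 := pow_le_pow_right₀ hX (by norm_num)
    calc _ = D.γ * D.g ^ 2 * X ^ 2 := by ring
      _ ≤ _ := by gcongr
  have a2 := mul_le_mul_of_nonneg_left h2 hγ.le
  have a3 := mul_le_mul_of_nonneg_left h3 (inv_pos.2 hγ).le
  have : 0 ≤ D.γ * D.g ^ 2 * X ^ 3 := by positivity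
  linarith

lemma TT_eq (β : ℝ) (x : V) : D.TT β x = β ^ 2 * conv D.k (conv D.k (D.G β)) x := by
  unfold TT
  have : D.H β = fun y => β * conv D.k (D.G β) y := rfl
  rw [this, conv_smul]; ring

lemma TT_four (β : ℝ) (x : V) : D.TT β x = β ^ 2 * D.syn (fun ω => D.κ ω ^ 2 * D.hat (D.G β) ω) x := by
  rw [TT_eq]
  have h1 : D.G β = D.syn (D.hat (D.G β)) := by funext x; rw [D.syn_hat (D.G_even β)]
  conv_lhs => rw [h1]
  rw [D.conv_syn D.k_even, D.conv_syn D.k_even]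
  congr 2; funext ω; unfold κ; ring

lemma th_mono {β β' : ℝ} (h0 : 0 ≤ β') (h : β' ≤ β) : D.th β' ≤ D.th β := by
  unfold th
  rw [TT_eq, TT_eq]
  have h1 : conv D.k (conv D.k (D.G β')) 0 ≤ conv D.k (conv D.k (D.G β)) 0 :=
    conv_mono D.k_nonneg (fun x => conv_mono D.k_nonneg (D.G_mono h0 h) x) 0
  have h2 : 0 ≤ conv D.k (conv D.k (D.G β')) 0 := conv_nonneg D.k_nonneg (conv_nonneg D.k_nonneg (D.G_nonneg h0)) 0
  gcongr

lemma syn_le_zero {a : V → ℝ} (ha : ∀ ω, 0 ≤ a ω) (x : V) : D.syn a x ≤ D.syn a 0 := by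
  unfold syn
  refine mul_le_mul_of_nonneg_left (Finset.sum_le_sum fun ω _ => ?_) (inv_pos.2 D.n_pos).le
  rw [D.co_zero]
  exact mul_le_mul_of_nonneg_left ((le_abs_self _).trans (D.co_abs _ _)) (ha ω)

lemma syn_sub (a b : V → ℝ) (x : V) : D.syn (fun ω => a ω - b ω) x = D.syn a x - D.syn b x := by
  unfold syn; simp only [sub_mul, Finset.sum_sub_distrib, mul_sub]

lemma dd_eq {β B : ℝ} (hS : D.Sm B) (hβ : 0 ≤ β) (h1 : |β - 1| ≤ D.g * (D.cg + B)) (h2 : D.th β ≤ D.g * (D.cg + B)) :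
    |D.dd β - (1 - β + D.th β)| ≤ D.g := by
  have a1 := D.tau_le β
  have a2 := D.tau_ge hβ
  have a3 := D.tau_nonneg β
  have a4 := hS.sq
  have hg := D.g_pos
  have hth := D.th_nonneg hβ
  set X := D.cg + B
  have e : D.dd β - (1 - β + D.th β) = (D.tau β - D.th β) + 2 * (D.tau β * (β - 1)) := by unfold dd; ring
  have b1 : |D.tau β * (β - 1)| ≤ (D.g * X) * (D.g * X) := by
    rw [abs_mul, abs_of_nonneg a3]; exact mul_le_mul (a1.trans h2) h1 (abs_nonneg _) (hth.trans h2)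
  have b2 : D.th β ^ 2 ≤ (D.g * X) ^ 2 := by gcongr
  have b3 : (D.g * X) ^ 2 ≤ D.g / 100 := by
    calc (D.g * X) ^ 2 = D.g * (D.g * X ^ 2) := by ring
      _ ≤ D.g * (1 / 100) := by gcongr
      _ = _ := by ring
  rw [e, abs_le]
  rw [abs_le] at b1
  constructor <;> nlinarith [b1.1, b1.2]

set_option maxHeartbeats 1600000 in
/-- consequences of the Fourier lower bound -/
lemma CRpack {β B r : ℝ} (hS : D.Sm B) (hβ : 0 ≤ β) (h1 : |β - 1| ≤ D.g * (D.cg + B)) (h2 : D.th β ≤ D.g * (D.cg + B))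
    (hr : 1 ≤ r) (hrB : r ≤ B) (hd : |1 - β + D.th β| + D.g * (2 + 8 * C0) ≤ D.g * r ^ 2 / 2) :
    (∀ x, D.TT β x ≤ D.th β - D.g * (D.cg - 1 - 8 * C0 / c0 ^ 2 * r) + 4 * D.ff (1 - D.g * r ^ 2) x) ∧
    D.g * (D.cg - 1 - 8 * C0 / c0 ^ 2 * r) ≤ D.th β ∧
    (D.n)⁻¹ * ∑ x, D.G β x ≤ 2 * (D.th β - D.g * (D.cg - 1 - 8 * C0 / c0 ^ 2 * r)) := by
  have hle := hS.le
  have hsq := hS.sq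
  have hgr := hS.r hr hrB
  have hgr2 : D.g * r ^ 2 ≤ 1 / 2 := by linarith
  have hg := D.g_pos
  have hc0 := D.c0_pos
  have hC0 := D.C0_ge
  have hcg := D.cg_nonneg
  have hB : 100 ≤ B := hS.1
  have hth := D.th_nonneg hβ
  have t1 := D.tau_le β
  have t3 := D.tau_nonneg β
  have hdd := D.dd_eq hS hβ h1 h2
  set X := D.cg + B with hX
  have hX0 : 0 ≤ X := by linarith
  set τ := D.tau β
  have b := abs_le.1 h1
  have hβ1 : 9/10 ≤ β := by linarith [b.1]
  have hβ2 : β ≤ 11/10 := by linarith [b.2]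
  have hee : D.ee β ≤ D.g * (1 + 8 * C0) := by
    have : D.th β ^ 2 ≤ D.g / 100 := by
      calc D.th β ^ 2 ≤ (D.g * X) ^ 2 := by gcongr
        _ = D.g * (D.g * X ^ 2) := by ring
        _ ≤ D.g * (1 / 100) := by gcongr
        _ = _ := by ring
    have h4 : D.th β ^ 2 * β ≤ D.g / 100 * (11/10) := mul_le_mul this hβ2 hβ (by positivity)
    have h5 : β ^ 2 ≤ 2 := by nlinarith only [hβ1, hβ2]
    have h6 : β ^ 2 * (C0 * D.g) ≤ 2 * (C0 * D.g) := mul_le_mul_of_nonneg_right h5 (by positivity)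
    unfold ee; linarith
  set b' := 1 - D.g * r ^ 2 with hb'
  have hb0 : 0 < b' := by linarith
  have hgr0 : 0 < D.g * r ^ 2 := by positivity
  set p := D.g * r ^ 2 / b' with hp
  have hp0 : 0 < p := by positivity
  have hpge : D.g * r ^ 2 ≤ p := by rw [hp, le_div_iff₀ hb0]; nlinarith only [hgr0, hb']
  have hple : p ≤ D.g * (2 * r) ^ 2 := by rw [hp, div_le_iff₀ hb0]; nlinarith only [hgr0, hgr, hb']
  have hdabs : |D.dd β| ≤ |1 - β + D.th β| + D.g := by
    have := abs_add_le (D.dd β - (1 - β + D.th β)) (1 - β + D.th β)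
    rw [sub_add_cancel] at this; linarith
  have hτ : τ ≤ 1/2 := by linarith
  have hcr := D.CR hβ (by linarith) hp0 (by
    have : 1 / 2 * (D.g * r ^ 2) ≤ (1 - τ) * p := mul_le_mul (by linarith) hpge hgr0.le (by linarith)
    linarith)
  -- the lower bound for S(0)
  have hlow : D.g * (D.cg - 1 - 8 * C0 / c0 ^ 2 * r) ≤ β ^ 2 * ((D.n)⁻¹ * ∑ ω ∈ Finset.univ.erase 0, D.κ ω ^ 2 * ((1 - τ) / (1 - D.κ ω + p))) := by
    have l1 := D.low (r := 2 * r) (by linarith) (by linarith)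
    have l2 : (D.n)⁻¹ * ∑ ω ∈ Finset.univ.erase 0, D.κ ω ^ 2 / (1 - D.κ ω + D.g * (2 * r) ^ 2) ≤
        (D.n)⁻¹ * ∑ ω ∈ Finset.univ.erase 0, D.κ ω ^ 2 / (1 - D.κ ω + p) := by
      refine mul_le_mul_of_nonneg_left (Finset.sum_le_sum fun ω _ => ?_) (inv_pos.2 D.n_pos).le
      have := D.κ_le ω
      have : 0 < 1 - D.κ ω + p := by linarith
      gcongr
    have l3 : β ^ 2 * ((D.n)⁻¹ * ∑ ω ∈ Finset.univ.erase 0, D.κ ω ^ 2 * ((1 - τ) / (1 - D.κ ω + p))) =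
        (β ^ 2 * (1 - τ)) * ((D.n)⁻¹ * ∑ ω ∈ Finset.univ.erase 0, D.κ ω ^ 2 / (1 - D.κ ω + p)) := by
      simp only [Finset.mul_sum]
      exact Finset.sum_congr rfl fun ω _ => by ring
    rw [l3]
    have m0 : 0 ≤ β ^ 2 * (1 - τ) := mul_nonneg (sq_nonneg _) (by linarith)
    have m1 := mul_le_mul_of_nonneg_left (l1.trans l2) m0
    refine le_trans ?_ m1
    have m2 : β ^ 2 * (1 - τ) ≤ 2 := by
      have h5 : β ^ 2 ≤ 2 := by nlinarith only [hβ1, hβ2]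
      calc β ^ 2 * (1 - τ) ≤ 2 * 1 := mul_le_mul h5 (by linarith) (by linarith) (by norm_num)
        _ = 2 := by norm_num
    have m3 : 1 - 3 * (D.g * X) ≤ β ^ 2 * (1 - τ) := by
      have : 1 - 2 * (D.g * X) ≤ β ^ 2 := by nlinarith only [b.1, sq_nonneg (β - 1)]
      have : (1 - 2 * (D.g * X)) * (1 - D.g * X) ≤ β ^ 2 * (1 - τ) := mul_le_mul this (by linarith) (by linarith) (by positivity)
      nlinarith only [this, sq_nonneg (D.g * X)]
    have m4 : D.cg - 1 ≤ β ^ 2 * (1 - τ) * D.cg := by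
      have a := mul_le_mul_of_nonneg_right m3 hcg
      have : D.g * X * D.cg ≤ D.g * X ^ 2 := by rw [sq, ← mul_assoc]; gcongr; linarith
      linarith
    have hK : 0 ≤ 2 * C0 / c0 ^ 2 * (2 * r) := by positivity
    have m5 := mul_le_mul_of_nonneg_right m2 hK
    have : D.cg - 1 - 8 * C0 / c0 ^ 2 * r ≤ β ^ 2 * (1 - τ) * (D.cg - 2 * C0 / c0 ^ 2 * (2 * r)) := by
      have e : 8 * C0 / c0 ^ 2 * r = 2 * (2 * C0 / c0 ^ 2 * (2 * r)) := by ring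
      rw [e]; linarith
    have := mul_le_mul_of_nonneg_left this hg.le
    linarith
  have hKnn : ∀ ω, 0 ≤ D.κ ω ^ 2 * ((1 - τ) / (1 - D.κ ω + p)) := fun ω => by
    have := D.κ_le ω
    have : 0 < 1 - D.κ ω + p := by linarith
    have : 0 ≤ 1 - τ := by linarith
    positivity
  have hS0 : (D.n)⁻¹ * ∑ ω ∈ Finset.univ.erase 0, D.κ ω ^ 2 * ((1 - τ) / (1 - D.κ ω + p)) ≤ D.syn (fun ω => D.κ ω ^ 2 * ((1 - τ) / (1 - D.κ ω + p))) 0 := by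
    unfold syn
    refine mul_le_mul_of_nonneg_left ?_ (inv_pos.2 D.n_pos).le
    simp only [D.co_zero, mul_one]
    exact Finset.sum_le_sum_of_subset_of_nonneg (Finset.subset_univ _) (fun ω _ _ => hKnn ω)
  have hth0 : D.th β = β ^ 2 * D.syn (fun ω => D.κ ω ^ 2 * D.hat (D.G β) ω) 0 := D.TT_four β 0
  have hmono : ∀ ω, D.κ ω ^ 2 * ((1 - τ) / (1 - D.κ ω + p)) ≤ D.κ ω ^ 2 * D.hat (D.G β) ω := fun ω =>
    mul_le_mul_of_nonneg_left (hcr ω) (sq_nonneg _)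
  have hSc : ∀ x, D.syn (fun ω => D.κ ω ^ 2 * ((1 - τ) / (1 - D.κ ω + p))) x ≤ 2 * D.ff b' x := by
    intro x
    have e : (fun ω => D.κ ω ^ 2 * ((1 - τ) / (1 - D.κ ω + p))) = fun ω => (b' * (1 - τ)) * (D.κ ω * D.aa b' ω) := by
      funext ω
      unfold aa
      have q1 : 0 < 1 - b' * D.κ ω := D.den_pos hb0.le (by linarith) ω
      have q2 : 1 - D.κ ω + p = (1 - b' * D.κ ω) / b' := by
        rw [hp]; field_simp; rw [hb']; ring
      rw [q2]; field_simp
    have e2 : D.syn (fun ω => (b' * (1 - τ)) * (D.κ ω * D.aa b' ω)) x = (b' * (1 - τ)) * conv D.k (D.ff b') x := by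
      unfold ff; rw [D.conv_syn D.k_even]; unfold syn κ; simp only [Finset.mul_sum]
      exact Finset.sum_congr rfl fun ω _ => by ring
    rw [e, e2]
    have h := D.Kff_le hr hgr2 x
    have h0 := conv_nonneg D.k_nonneg (D.ff0 hr hgr2) x
    have : b' * (1 - τ) ≤ 1 := by
      calc b' * (1 - τ) ≤ 1 * 1 := mul_le_mul (by linarith) (by linarith) (by linarith) (by norm_num)
        _ = 1 := by norm_num
    have := mul_le_mul_of_nonneg_right this h0
    linarith
  refine ⟨fun x => ?_, ?_, ?_⟩
  · rw [D.TT_four β x, hth0]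
    have h := D.syn_le_zero (a := fun ω => D.κ ω ^ 2 * D.hat (D.G β) ω - D.κ ω ^ 2 * ((1 - τ) / (1 - D.κ ω + p))) (fun ω => sub_nonneg.2 (hmono ω)) x
    rw [D.syn_sub, D.syn_sub] at h
    have hb2 : β ^ 2 ≤ 2 := by nlinarith only [hβ1, hβ2]
    have h' := mul_le_mul_of_nonneg_left h (sq_nonneg β)
    have hl := hlow.trans (mul_le_mul_of_nonneg_left hS0 (sq_nonneg β))
    have hs1 := mul_le_mul_of_nonneg_left (hSc x) (sq_nonneg β)
    have hs2 : β ^ 2 * (2 * D.ff b' x) ≤ 2 * (2 * D.ff b' x) := mul_le_mul_of_nonneg_right hb2 (by have := D.ff0 hr hgr2 x; linarith)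
    linarith
  · rw [hth0]
    refine hlow.trans (mul_le_mul_of_nonneg_left (hS0.trans ?_) (sq_nonneg β))
    have := D.syn_sub (fun ω => D.κ ω ^ 2 * D.hat (D.G β) ω) (fun ω => D.κ ω ^ 2 * ((1 - τ) / (1 - D.κ ω + p))) 0
    have h : 0 ≤ D.syn (fun ω => D.κ ω ^ 2 * D.hat (D.G β) ω - D.κ ω ^ 2 * ((1 - τ) / (1 - D.κ ω + p))) 0 := by
      unfold syn
      refine mul_nonneg (inv_pos.2 D.n_pos).le (Finset.sum_nonneg fun ω _ => ?_)
      rw [D.co_zero, mul_one]; exact sub_nonneg.2 (hmono ω)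
    linarith
  · have e : D.syn (fun ω => D.κ ω ^ 2 * D.hat (D.G β) ω) 0 = (D.n)⁻¹ * ∑ x, D.G β x + (D.n)⁻¹ * ∑ ω ∈ Finset.univ.erase 0, D.κ ω ^ 2 * D.hat (D.G β) ω := by
      unfold syn
      simp only [D.co_zero, mul_one]
      rw [← Finset.add_sum_erase _ _ (Finset.mem_univ (0:V)), D.κ_zero, D.hat_zero]; ring
    have h3 : (D.n)⁻¹ * ∑ ω ∈ Finset.univ.erase 0, D.κ ω ^ 2 * ((1 - τ) / (1 - D.κ ω + p)) ≤ (D.n)⁻¹ * ∑ ω ∈ Finset.univ.erase 0, D.κ ω ^ 2 * D.hat (D.G β) ω :=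
      mul_le_mul_of_nonneg_left (Finset.sum_le_sum fun ω _ => hmono ω) (inv_pos.2 D.n_pos).le
    have h4 := hlow.trans (mul_le_mul_of_nonneg_left h3 (sq_nonneg β))
    rw [e] at hth0
    have h5 : 0 ≤ (D.n)⁻¹ * ∑ x, D.G β x := mul_nonneg (inv_pos.2 D.n_pos).le (Finset.sum_nonneg fun x _ => D.G_nonneg hβ x)
    have h6 : 1/2 ≤ β ^ 2 := by nlinarith only [hβ1]
    have h7 := mul_le_mul_of_nonneg_right h6 h5
    linarith

end KD

end PartP11

section PartP11b
namespace KD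
variable {V : Type} [Fintype V] [DecidableEq V] [AddCommGroup V] {c0 C0 : ℝ} (D : KD V c0 C0)

lemma ffG {b : ℝ} (hb0 : 0 ≤ b) (hb : b < 1) (s : ℝ) (x : V) :
    s * conv (D.ff b) (D.G s) x = D.H s x + b * conv (D.ff b) (D.H s) x := by
  have h1 : D.ff b = fun y => D.k y + b * conv D.k (D.ff b) y := by funext y; exact D.ff_eq hb0 hb y
  have h2 : conv (D.ff b) (D.G s) x = conv D.k (D.G s) x + b * conv (D.G s) (conv D.k (D.ff b)) x := by
    rw [conv_comm]
    conv_lhs => rw [h1]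
    rw [conv_add, conv_smul, conv_comm (D.G s) D.k]
  have h3 : D.H s = fun y => s * conv D.k (D.G s) y := rfl
  rw [h2, h3, conv_smul, ← conv_assoc, conv_comm (D.G s) D.k, conv_comm (D.ff b)]
  ring

lemma conv_sup {U f : V → ℝ} (hU : ∀ x, 0 ≤ U x) {S : ℝ} (hf : ∀ x, f x ≤ S) (x : V) : conv U f x ≤ (∑ x, U x) * S :=
  conv_le_sup hU hf x

lemma step {s r : ℝ} (hs : 0 ≤ s) (hr : 1 ≤ r) (hgr : D.g * r ^ 2 ≤ 1 / 2) {U : V → ℝ} (hU : ∀ x, 0 ≤ U x) {ρ : ℝ}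
    (hG : ∀ y, D.G s y ≤ del y + (1 - D.g * r ^ 2) * conv D.k (D.G s) y + (2 / 3 * conv U (D.G s) y + ρ))
    {S1 S2 : ℝ} (h1 : ∀ x, D.H s x ≤ S1) (h2 : ∀ x, conv (D.ff (1 - D.g * r ^ 2)) (D.H s) x ≤ S2) (x : V) :
    D.H s x ≤ s * D.ff (1 - D.g * r ^ 2) x + (2 / 3 * (∑ x, U x) * (S1 + S2) + s * ρ * (D.g * r ^ 2)⁻¹) := by
  set b := 1 - D.g * r ^ 2 with hb
  have hb0 : 0 ≤ b := by linarith
  have hb1 : b < 1 := D.bb_lt hr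
  have hc := D.compare hb0 hb1 hG x
  have e : s * conv (D.ff b) (fun y => 2 / 3 * conv U (D.G s) y + ρ) x =
      2 / 3 * conv U (fun y => D.H s y + b * conv (D.ff b) (D.H s) y) x + s * ρ * (D.g * r ^ 2)⁻¹ := by
    have e1 : (fun y => D.H s y + b * conv (D.ff b) (D.H s) y) = fun y => s * conv (D.ff b) (D.G s) y := by
      funext y; rw [D.ffG hb0 hb1]
    rw [e1, conv_smul, conv_add, conv_smul, conv_const, D.ff_sum' hr hgr, ← conv_assoc, ← conv_assoc, conv_comm (D.ff b) U]
    ring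
  have hs2 : conv U (fun y => D.H s y + b * conv (D.ff b) (D.H s) y) x ≤ (∑ x, U x) * (S1 + S2) := by
    refine conv_le_sup hU (fun y => ?_) x
    have a1 := h1 y; have a2 := h2 y
    have a3 := conv_nonneg (D.ff0 hr hgr) (D.H_nonneg hs) y
    rw [← hb] at a3
    have := mul_le_mul_of_nonneg_right hb1.le a3
    linarith
  have := mul_le_mul_of_nonneg_left hc hs
  rw [mul_add, e] at this
  change D.H s x ≤ _ at this
  linarith

lemma cube_add {a b : ℝ} (ha : 0 ≤ a) (hb : 0 ≤ b) : (a + b) ^ 3 ≤ 4 * (a ^ 3 + b ^ 3) := by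
  have : 0 ≤ 3 * ((a + b) * (a - b) ^ 2) := by positivity
  nlinarith only [this]

lemma sum_g3 (c : ℝ) : ∑ _x : V, (c * D.g) ^ 3 = 4 * c ^ 3 * D.g := by
  rw [Finset.sum_const, Finset.card_univ, nsmul_eq_mul]
  have := D.n_eq
  unfold n at this
  linear_combination (c ^ 3 * D.g) * this

lemma sum_g2 (c : ℝ) : ∑ _x : V, (c * D.g) ^ 2 = 4 * c ^ 2 := by
  rw [Finset.sum_const, Finset.card_univ, nsmul_eq_mul]
  have := D.n_eq
  unfold n at this
  linear_combination (c ^ 2) * this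

/-- sum of cubes of a function dominated by a Green function plus constant -/
lemma sum_cube {r : ℝ} (hr : 1 ≤ r) (hgr : D.g * r ^ 2 ≤ 1 / 2) {F : V → ℝ} (h0 : ∀ x, 0 ≤ F x) {a c : ℝ} (ha : 0 ≤ a) (hc : 0 ≤ c)
    (h : ∀ x, F x ≤ a * D.ff (1 - D.g * r ^ 2) x + c * D.g) : ∑ x, F x ^ 3 ≤ D.g * (4 * a ^ 3 * C3 c0 C0 + 16 * c ^ 3) := by
  have hg := D.g_pos
  have : ∀ x ∈ Finset.univ, F x ^ 3 ≤ 4 * a ^ 3 * D.ff (1 - D.g * r ^ 2) x ^ 3 + 4 * (c * D.g) ^ 3 := fun x _ => by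
    have hf := D.ff0 hr hgr x
    calc F x ^ 3 ≤ (a * D.ff (1 - D.g * r ^ 2) x + c * D.g) ^ 3 := by have := h0 x; have := h x; gcongr
      _ ≤ 4 * ((a * D.ff (1 - D.g * r ^ 2) x) ^ 3 + (c * D.g) ^ 3) := cube_add (by positivity) (by positivity)
      _ = _ := by ring
  refine (Finset.sum_le_sum this).trans ?_
  rw [Finset.sum_add_distrib, ← Finset.mul_sum, ← Finset.mul_sum, D.sum_g3]
  have := mul_le_mul_of_nonneg_left (D.ff_cube hr hgr) (by positivity : 0 ≤ 4 * a ^ 3)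
  linarith

lemma sum_square {r : ℝ} (hr : 1 ≤ r) (hgr : D.g * r ^ 2 ≤ 1 / 2) {F : V → ℝ} (h0 : ∀ x, 0 ≤ F x) {a c : ℝ} (ha : 0 ≤ a) (hc : 0 ≤ c)
    (h : ∀ x, F x ≤ a * D.ff (1 - D.g * r ^ 2) x + c * D.g) : ∑ x, F x ^ 2 ≤ 2 * a ^ 2 * ((1 + 5 * C0 / c0 ^ 2) / r) + 8 * c ^ 2 := by
  have hg := D.g_pos
  have : ∀ x ∈ Finset.univ, F x ^ 2 ≤ 2 * a ^ 2 * D.ff (1 - D.g * r ^ 2) x ^ 2 + 2 * (c * D.g) ^ 2 := fun x _ => by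
    have hf := D.ff0 hr hgr x
    calc F x ^ 2 ≤ (a * D.ff (1 - D.g * r ^ 2) x + c * D.g) ^ 2 := by have := h0 x; have := h x; gcongr
      _ ≤ _ := by nlinarith only [sq_nonneg (a * D.ff (1 - D.g * r ^ 2) x - c * D.g)]
  refine (Finset.sum_le_sum this).trans ?_
  rw [Finset.sum_add_distrib, ← Finset.mul_sum, ← Finset.mul_sum, D.sum_g2]
  have := mul_le_mul_of_nonneg_left (D.ff_sq hr hgr) (by positivity : 0 ≤ 2 * a ^ 2)
  linarith

def Csq (c0 C0 : ℝ) : ℝ := 1 + 5 * C0 / c0 ^ 2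
def C4 (c0 C0 : ℝ) : ℝ := 32 * C3 c0 C0 + 16
def C5 (c0 C0 : ℝ) : ℝ := C4 c0 C0 * (2 * Csq c0 C0 + 1)

lemma C3_nonneg (c0 C0 : ℝ) : 0 ≤ C3 c0 C0 := by unfold C3; positivity
lemma Csq_ge (D : KD V c0 C0) : 1 ≤ Csq c0 C0 := by
  unfold Csq; have := D.c0_pos; have := D.C0_ge
  have : 0 ≤ 5 * C0 / c0 ^ 2 := by positivity
  linarith

set_option maxHeartbeats 800000 in
lemma boot {B r s : ℝ} (hS : D.Sm B) (hBC : 3 + 4 * C0 ≤ 2 * B) (hr : 1 ≤ r) (hrB : r ≤ B) (hs : 0 ≤ s) (hs2 : s ≤ 2)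
    (hθ : s * (1 - D.th s) ≤ 1 - D.g * r ^ 2) (hb : ∀ x, D.H s x ≤ s * D.ff (1 - D.g * r ^ 2) x + D.g) (x : V) :
    D.H s x ≤ s * D.ff (1 - D.g * r ^ 2) x + C5 c0 C0 / r * D.g := by
  have hgr : D.g * r ^ 2 ≤ 1 / 2 := by linarith [hS.r hr hrB]
  have hg := D.g_pos
  have hcg := D.cg_nonneg
  have hC0 := D.C0_ge
  have hB := hS.1
  have hCs := D.Csq_ge
  have hC3 := C3_nonneg c0 C0
  set X := D.cg + B with hX
  have hX1 : 1 ≤ X := by linarith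
  have hff0 := D.ff0 hr hgr
  have hbb : ∀ x, D.H s x ≤ 2 * D.ff (1 - D.g * r ^ 2) x + 1 * D.g := fun x => by
    have := mul_le_mul_of_nonneg_right hs2 (hff0 x); linarith [hb x]
  have hr0 : 0 < r := by linarith
  have hS1 : ∀ x, D.H s x ≤ 2 * (D.g * X) := fun x => by
    have h := D.ff_le hr hgr x
    have : D.g * (2 * D.cg + 3 + 4 * C0) ≤ D.g * (2 * X) := by gcongr; linarith
    linarith [hbb x]
  have hS1' : 2 * (D.g * X) ≤ 2 / (B * r) := by
    rw [le_div_iff₀ (by positivity)]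
    have h := hS.two
    have : D.g * X * (B * r) ≤ D.g * X * B ^ 2 := by rw [sq]; gcongr
    linarith
  have hθ4 : D.th s ≤ D.g * (4 * X) := by
    have h := conv_le_sup D.k_nonneg hS1 0
    rw [D.k_sum, one_mul] at h
    have h0 : 0 ≤ conv D.k (D.H s) 0 := conv_nonneg D.k_nonneg (D.H_nonneg hs) 0
    change s * conv D.k (D.H s) 0 ≤ _
    have := mul_le_mul hs2 h h0 (by norm_num)
    linarith
  have hρ := D.rho_le hs (by linarith) hθ4
  have hρ' : s * D.rho s * (D.g * r ^ 2)⁻¹ ≤ D.g * (256 / (B * r)) := by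
    have h := hS.2
    have h1 : s * D.rho s ≤ 2 * (2 * (D.γ * D.g ^ 2 * (4 * X) ^ 3)) := mul_le_mul hs2 hρ (D.rho_nonneg hs) (by norm_num)
    have h2 : D.γ * X ^ 3 ≤ 1 / B := by rw [le_div_iff₀ (by linarith)]; exact h
    calc s * D.rho s * (D.g * r ^ 2)⁻¹ ≤ 2 * (2 * (D.γ * D.g ^ 2 * (4 * X) ^ 3)) * (D.g * r ^ 2)⁻¹ := by gcongr
      _ = D.g * (256 * (D.γ * X ^ 3) * (1 / r ^ 2)) := by field_simp; ring
      _ ≤ D.g * (256 * (1 / B) * (1 / r)) := by gcongr; exact le_self_pow₀ hr (by norm_num)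
      _ = _ := by field_simp
  have hS2 : ∀ x, conv (D.ff (1 - D.g * r ^ 2)) (D.H s) x ≤ (2 * Csq c0 C0 + 1) / r := fun x => by
    have h := conv_mono hff0 hbb x
    rw [conv_add, conv_smul, conv_const, D.ff_sum' hr hgr] at h
    have h1 := conv_cs (D.ff_sq hr hgr) (D.ff_sq hr hgr) x
    have h2 : 1 * D.g * (D.g * r ^ 2)⁻¹ ≤ 1 / r := by
      have : 1 * D.g * (D.g * r ^ 2)⁻¹ = 1 / r ^ 2 := by field_simp
      rw [this]; gcongr; exact le_self_pow₀ hr (by norm_num)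
    rw [← Csq] at h1
    have e : (2 * Csq c0 C0 + 1) / r = 2 * (Csq c0 C0 / r) + 1 / r := by ring
    rw [e]; linarith
  have hU : ∑ x, D.H s x ^ 3 ≤ D.g * C4 c0 C0 := by
    have := D.sum_cube hr hgr (D.H_nonneg hs) (by norm_num) (by norm_num) hbb
    unfold C4; linarith
  have hG : ∀ y, D.G s y ≤ del y + (1 - D.g * r ^ 2) * conv D.k (D.G s) y + (2 / 3 * conv (fun u => D.H s u ^ 3) (D.G s) y + D.rho s) := by
    intro y
    have h := D.G_skel hs le_rfl y
    rw [← D.TT_eq] at h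
    have e : (fun u => (s * conv D.k (D.G s) u) ^ 2 * D.H s u) = fun u => D.H s u ^ 3 := by
      funext u; change D.H s u ^ 2 * D.H s u = _; ring
    rw [e] at h
    have h1 : s * (1 - D.th s / 3 - 2 / 3 * D.TT s 0) = s * (1 - D.th s) := by unfold th; ring
    rw [h1] at h
    have h2 := conv_nonneg D.k_nonneg (D.G_nonneg hs) y
    have := mul_le_mul_of_nonneg_right hθ h2
    linarith
  have hfin := D.step hs hr hgr (fun x => pow_nonneg (D.H_nonneg hs x) 3) hG hS1 hS2 x
  refine hfin.trans ?_
  have hC4 : 16 ≤ C4 c0 C0 := by unfold C4; linarith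
  have h1 : 2 / 3 * (∑ x, D.H s x ^ 3) * (2 * (D.g * X) + (2 * Csq c0 C0 + 1) / r) ≤
      2 / 3 * (D.g * C4 c0 C0) * (2 / (B * r) + (2 * Csq c0 C0 + 1) / r) := by
    have : 0 ≤ ∑ x, D.H s x ^ 3 := Finset.sum_nonneg fun x _ => pow_nonneg (D.H_nonneg hs x) 3
    gcongr
  have h2 : 2 / (B * r) ≤ (2 / 100) / r := by
    rw [div_div]; gcongr
  have h3 : 256 / (B * r) ≤ (256 / 100) / r := by
    rw [div_div]; gcongr
  have h4 : 2 / 3 * (D.g * C4 c0 C0) * (2 / (B * r) + (2 * Csq c0 C0 + 1) / r) ≤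
    2 / 3 * (D.g * C4 c0 C0) * ((2 / 100) / r + (2 * Csq c0 C0 + 1) / r) := by gcongr
  have h5 := mul_le_mul_of_nonneg_left h3 hg.le
  have h6 : 2 / 3 * (D.g * C4 c0 C0) * ((2 / 100) / r + (2 * Csq c0 C0 + 1) / r) + D.g * ((256 / 100) / r) ≤ C5 c0 C0 / r * D.g := by
    have e : C5 c0 C0 / r * D.g - (2 / 3 * (D.g * C4 c0 C0) * ((2 / 100) / r + (2 * Csq c0 C0 + 1) / r) + D.g * ((256 / 100) / r)) =
      (D.g / r) * (1 / 3 * C4 c0 C0 * (2 * Csq c0 C0 + 1) - 4 / 300 * C4 c0 C0 - 256 / 100) := by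
      unfold C5; field_simp; ring
    have e2 : 0 ≤ 1 / 3 * C4 c0 C0 * (2 * Csq c0 C0 + 1) - 4 / 300 * C4 c0 C0 - 256 / 100 := by nlinarith only [hC4, hCs]
    have := mul_nonneg (by positivity : 0 ≤ D.g / r) e2
    linarith
  linarith

lemma stage1 {B r t : ℝ} (hS : D.Sm B) (hBC : 3 + 4 * C0 ≤ 2 * B) (hr : 1 ≤ r) (hrB : r ≤ B) (ht : 0 ≤ t) (ht2 : t ≤ 2) (hr5 : C5 c0 C0 < r)
    (hθ : ∀ s, 0 ≤ s → s ≤ t → s * (1 - D.th s) ≤ 1 - D.g * r ^ 2) (x : V) :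
    D.H t x ≤ t * D.ff (1 - D.g * r ^ 2) x + C5 c0 C0 / r * D.g := by
  have hg := D.g_pos
  set f := D.ff (1 - D.g * r ^ 2) with hf
  set Φ : ℝ → ℝ := fun s => Finset.univ.sup' ⟨(0:V), Finset.mem_univ _⟩ (fun y => D.H s y - s * f y) with hΦ
  have hcont : Continuous Φ := Continuous.finset_sup'_apply _ fun y _ => (D.H_cont y).sub (continuous_id.mul continuous_const)
  have hle : ∀ s c, Φ s ≤ c ↔ ∀ y, D.H s y ≤ s * f y + c := by
    intro s c
    refine (Finset.sup'_le_iff _ _).trans ?_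
    constructor
    · intro h y; have := h y (Finset.mem_univ y); linarith
    · intro h y _; have := h y; linarith
  set η := C5 c0 C0 / r with hη
  have hr0 : 0 < r := by linarith
  have hη1 : η < 1 := by rw [hη, div_lt_one hr0]; exact hr5
  have hη0 : 0 ≤ η := by
    have := D.Csq_ge; have := C3_nonneg c0 C0
    rw [hη]; unfold C5 C4; positivity
  have himp : ∀ s, 0 ≤ s → s ≤ t → Φ s ≤ D.g → Φ s ≤ η * D.g := by
    intro s h0 h1 h
    rw [hle] at h ⊢
    exact D.boot hS hBC hr hrB h0 (h1.trans ht2) (hθ s h0 h1) h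
  have h00 : Φ 0 ≤ 0 := by rw [hle]; intro y; simp [H]
  suffices Φ t ≤ η * D.g from (hle t _).1 this x
  by_contra hcon
  push Not at hcon
  have hgt : D.g < Φ t := by
    by_contra h; push Not at h; exact absurd (himp t ht le_rfl h) (not_le.2 hcon)
  have hmid : D.g ∈ Set.Icc (Φ 0) (Φ t) := ⟨by linarith, hgt.le⟩
  obtain ⟨s, hs, hse⟩ := intermediate_value_Icc ht hcont.continuousOn hmid
  have := himp s hs.1 hs.2 hse.le
  rw [hse] at this
  nlinarith

end KD

end PartP11b

section PartP11c
namespace KD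
variable {V : Type} [Fintype V] [DecidableEq V] [AddCommGroup V] {c0 C0 : ℝ} (D : KD V c0 C0)

/-- from a bound on H to a bound on theta -/
lemma th_of_H {B r β E1 : ℝ} (hS : D.Sm B) (hBC : 1 + C0 ≤ B) (hr : 1 ≤ r) (hrB : r ≤ B) (hβ : 0 ≤ β)
    (hβ1 : β ≤ 1 + D.g * (D.cg + B)) (hE : 0 ≤ E1) (h : ∀ x, D.H β x ≤ β * D.ff (1 - D.g * r ^ 2) x + E1) :
    D.th β ≤ D.g * (D.cg + 2 + C0) + 2 * E1 := by
  have hgr : D.g * r ^ 2 ≤ 1 / 2 := by linarith [hS.r hr hrB]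
  have hg := D.g_pos
  have hcg := D.cg_nonneg
  have hC0 := D.C0_ge
  have hle := hS.le
  have hsq := hS.sq
  set X := D.cg + B with hX
  have h1 := conv_mono D.k_nonneg h 0
  rw [conv_add, conv_smul, conv_const, D.k_sum] at h1
  have h2 := D.Kff_zero hr hgr
  have h0 := conv_nonneg D.k_nonneg (D.ff0 hr hgr) 0
  have h3 : D.th β ≤ β ^ 2 * conv D.k (D.ff (1 - D.g * r ^ 2)) 0 + β * E1 := by
    have := mul_le_mul_of_nonneg_left h1 hβ
    change D.th β ≤ _ at this
    linarith
  have hβ2 : β ^ 2 ≤ 1 + 3 * (D.g * X) := by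
    have : 0 ≤ D.g * X := by have : 0 ≤ X := by linarith
                             positivity
    nlinarith only [hβ1, hβ, hle, this]
  have h4 : β ^ 2 * conv D.k (D.ff (1 - D.g * r ^ 2)) 0 ≤ (1 + 3 * (D.g * X)) * (D.g * (D.cg + 1 + C0)) :=
    mul_le_mul hβ2 h2 h0 (by nlinarith)
  have h5 : β * E1 ≤ 2 * E1 := mul_le_mul_of_nonneg_right (by linarith) hE
  have h6 : 3 * (D.g * X) * (D.g * (D.cg + 1 + C0)) ≤ D.g * 1 := by
    have hX0 : 0 ≤ X := by linarith
    calc 3 * (D.g * X) * (D.g * (D.cg + 1 + C0)) ≤ 3 * (D.g * X) * (D.g * X) := by gcongr; linarith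
      _ = D.g * (3 * (D.g * X ^ 2)) := by ring
      _ ≤ D.g * 1 := by gcongr; linarith
  linarith

lemma caseB1 {B r r2 A Q β : ℝ} (hS : D.Sm B) (hA : A ≤ B) (hQ : Q ≤ B) (hM : r ^ 2 ≤ B) (hr2 : 1 ≤ r2) (hr2B : r2 ≤ B)
    (hr22 : 2 * (r ^ 2 + 3 + 8 * C0) ≤ r2 ^ 2) (hβ : 0 ≤ β) (hβ1 : β ≤ 1 + D.g * (D.cg + A)) (hth : D.th β ≤ D.g * (D.cg + Q))
    (h : β * (1 - D.th β) = 1 - D.g * r ^ 2) :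
    D.g * (D.cg - (1 + 8 * C0 / c0 ^ 2 * r2)) ≤ D.th β ∧ 1 + D.g * (D.cg - (1 + 8 * C0 / c0 ^ 2 * r2) - r ^ 2 - 1) ≤ β
    ∧ 1 - D.g * r ^ 2 ≤ β := by
  have hg := D.g_pos
  have hcg := D.cg_nonneg
  have hC0 := D.C0_ge
  have hle := hS.le
  have hsq := hS.sq
  have hB := hS.1
  have ht0 := D.th_nonneg hβ
  set X := D.cg + B with hX
  have hβ2 : β ≤ 1 + D.g * X := hβ1.trans (by gcongr; linarith)
  have hth2 : D.th β ≤ D.g * X := hth.trans (by gcongr; linarith)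
  have hlow : 1 - D.g * r ^ 2 ≤ β := by rw [← h]; nlinarith
  have hgM : D.g * r ^ 2 ≤ D.g * X := by gcongr; linarith
  have habs : |β - 1| ≤ D.g * X := by rw [abs_le]; constructor <;> linarith
  have e : 1 - β + D.th β = D.g * r ^ 2 - D.th β * (β - 1) := by linear_combination (-1) * h
  have hp : |D.th β * (β - 1)| ≤ D.g := by
    rw [abs_mul, abs_of_nonneg ht0]
    calc D.th β * |β - 1| ≤ (D.g * X) * (D.g * X) := mul_le_mul hth2 habs (abs_nonneg _) (ht0.trans hth2)
      _ = D.g * (D.g * X ^ 2) := by ring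
      _ ≤ D.g * 1 := by gcongr; linarith
      _ = D.g := mul_one _
  have hgM0 : 0 ≤ D.g * r ^ 2 := by positivity
  have hp' := abs_le.1 hp
  have habs2 : |1 - β + D.th β| ≤ D.g * r ^ 2 + D.g := by
    rw [e, abs_le]; constructor <;> linarith [hp'.1, hp'.2]
  have hmul := mul_le_mul_of_nonneg_left hr22 hg.le
  obtain ⟨-, h2, -⟩ := D.CRpack hS hβ habs hth2 hr2 hr2B (by linarith)
  refine ⟨by linarith, ?_, hlow⟩
  have := (abs_le.1 habs2).2
  linarith

lemma rho_small {B β : ℝ} (hS : D.Sm B) (hβ : 0 ≤ β) (hβ2 : β ≤ 2) (hthX : D.th β ≤ D.g * (D.cg + B)) :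
    β * D.rho β ≤ D.g * D.g * (1 / 25) := by
  have hg := D.g_pos
  have hcg := D.cg_nonneg
  have hB := hS.1
  have h := D.rho_le hβ (by linarith) hthX
  have h2 : D.γ * (D.cg + B) ^ 3 ≤ 1 / 100 := by
    have h1 := hS.2
    have : 0 ≤ D.γ * (D.cg + B) ^ 3 := by have := D.γ_pos; positivity
    nlinarith only [h1, this, hB]
  have h4 : β * D.rho β ≤ 2 * (2 * (D.γ * D.g ^ 2 * (D.cg + B) ^ 3)) := mul_le_mul hβ2 h (D.rho_nonneg hβ) (by norm_num)
  calc β * D.rho β ≤ _ := h4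
    _ = D.g * D.g * (4 * (D.γ * (D.cg + B) ^ 3)) := by ring
    _ ≤ D.g * D.g * (1 / 25) := by gcongr; linarith

lemma caseB_coef {B Q β t A CM : ℝ} (hS : D.Sm B) (hA0 : 0 ≤ A) (hCM1 : 1 ≤ CM) (hQ2 : 12 * (A + CM + 1) ≤ Q) (hQB : Q ≤ B)
    (ht : 0 ≤ t) (htb : t ≤ β) (hβ1 : β ≤ 1 + D.g * (D.cg + A)) (hth : D.th β = D.g * (D.cg + Q)) (b1 : D.g * (D.cg - CM) ≤ D.th t) :
    β * (1 - D.th β / 3 - 2 / 3 * (β ^ 2 * conv D.k (conv D.k (D.G t)) 0)) ≤ 1 - D.g * (Q / 4) := by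
  have hg := D.g_pos
  have hcg := D.cg_nonneg
  have hle := hS.le
  have hB := hS.1
  have hβ : 0 ≤ β := ht.trans htb
  have a1 : D.th t ≤ β ^ 2 * conv D.k (conv D.k (D.G t)) 0 := by
    unfold th; rw [D.TT_eq]
    have := conv_nonneg D.k_nonneg (conv_nonneg D.k_nonneg (D.G_nonneg ht)) 0
    gcongr
  have a2 : 1 - D.th β / 3 - 2 / 3 * (β ^ 2 * conv D.k (conv D.k (D.G t)) 0) ≤ 1 - D.g * (D.cg + Q / 3 - 2 / 3 * CM) := by
    rw [hth]; linarith
  have hZ : 0 ≤ D.cg + Q / 3 - 2 / 3 * CM := by linarith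
  have hZ1 : D.g * (D.cg + Q / 3 - 2 / 3 * CM) ≤ 1 := by
    have : D.g * (D.cg + Q / 3 - 2 / 3 * CM) ≤ D.g * (D.cg + B) := mul_le_mul_of_nonneg_left (by linarith) hg.le
    linarith
  calc _ ≤ β * (1 - D.g * (D.cg + Q / 3 - 2 / 3 * CM)) := mul_le_mul_of_nonneg_left a2 hβ
    _ ≤ (1 + D.g * (D.cg + A)) * (1 - D.g * (D.cg + Q / 3 - 2 / 3 * CM)) := mul_le_mul_of_nonneg_right hβ1 (by linarith)
    _ = 1 - D.g * (Q / 3 - 2 / 3 * CM - A) - D.g * (D.cg + A) * (D.g * (D.cg + Q / 3 - 2 / 3 * CM)) := by ring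
    _ ≤ 1 - D.g * (Q / 3 - 2 / 3 * CM - A) := by
        have : 0 ≤ D.g * (D.cg + A) * (D.g * (D.cg + Q / 3 - 2 / 3 * CM)) := by positivity
        linarith
    _ ≤ 1 - D.g * (Q / 4) := by
        have : D.g * (Q / 4) ≤ D.g * (Q / 3 - 2 / 3 * CM - A) := mul_le_mul_of_nonneg_left (by linarith) hg.le
        linarith

lemma sq_mul_le {p q : ℝ} (hp : 0 ≤ p) (hq : 0 ≤ q) : p ^ 2 * q ≤ p ^ 3 + q ^ 3 := by
  rcases le_total p q with h | h
  · have h1 : p ^ 2 * q ≤ q ^ 2 * q := by gcongr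
    have h2 : 0 ≤ p ^ 3 := by positivity
    linarith [show q ^ 2 * q = q ^ 3 by ring]
  · have h1 : p ^ 2 * q ≤ p ^ 2 * p := by gcongr
    have h2 : 0 ≤ q ^ 3 := by positivity
    linarith [show p ^ 2 * p = p ^ 3 by ring]

lemma caseB_U {r r3 η P : ℝ} (hr : 1 ≤ r) (hgr : D.g * r ^ 2 ≤ 1 / 2) (hr31 : 1 ≤ r3) (hgr3 : D.g * r3 ^ 2 ≤ 1 / 2) (hη0 : 0 ≤ η) (hη1 : η ≤ 1)
    (hP : 0 ≤ P) {H' HH : V → ℝ}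
    (hH'0 : ∀ u, 0 ≤ H' u) (hH'le : ∀ u, H' u ≤ 2 * D.ff (1 - D.g * r ^ 2) u + (2 * η) * D.g)
    (hH : ∀ u, HH u ≤ 6 * D.ff (1 - D.g * r3 ^ 2) u + D.g * P) :
    ∑ u, H' u ^ 2 * HH u ≤ D.g * (6 * (33 * C3 c0 C0 + 128) + P * (8 * Csq c0 C0 / r + 32 * η ^ 2)) := by
  have hg := D.g_pos
  set f3 := D.ff (1 - D.g * r3 ^ 2) with hf3
  have hU1 : ∑ u, H' u ^ 2 ≤ 8 * Csq c0 C0 / r + 32 * η ^ 2 := by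
    have := D.sum_square hr hgr hH'0 (by norm_num) (by linarith) hH'le
    rw [← Csq] at this
    calc _ ≤ _ := this
      _ = _ := by ring
  have hU2 : ∑ u, H' u ^ 3 ≤ D.g * (32 * C3 c0 C0 + 128) := by
    have := D.sum_cube hr hgr hH'0 (by norm_num) (by linarith) hH'le
    refine this.trans ?_
    have : η ^ 3 ≤ 1 := pow_le_one₀ hη0 hη1
    gcongr D.g * ?_
    nlinarith only [this]
  have hU3 : ∑ u, H' u ^ 2 * f3 u ≤ D.g * (33 * C3 c0 C0 + 128) := by
    have : ∀ u ∈ Finset.univ, H' u ^ 2 * f3 u ≤ H' u ^ 3 + f3 u ^ 3 := fun u _ => sq_mul_le (hH'0 u) (D.ff0 hr31 hgr3 u)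
    refine (Finset.sum_le_sum this).trans ?_
    rw [Finset.sum_add_distrib]
    have := D.ff_cube hr31 hgr3
    linarith
  have : ∀ u ∈ Finset.univ, H' u ^ 2 * HH u ≤ 6 * (H' u ^ 2 * f3 u) + (D.g * P) * H' u ^ 2 := fun u _ => by
    have := mul_le_mul_of_nonneg_left (hH u) (sq_nonneg (H' u))
    linarith
  refine (Finset.sum_le_sum this).trans ?_
  rw [Finset.sum_add_distrib, ← Finset.mul_sum, ← Finset.mul_sum]
  have p := mul_le_mul_of_nonneg_left hU1 (by positivity : 0 ≤ D.g * P)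
  linarith

lemma caseB2 {B Q β : ℝ} (hS : D.Sm B) (hQ1 : 1 + 4 * C0 ≤ Q) (hQB : Q ≤ B) (hr3B : Real.sqrt (8 * Q) ≤ B) (hβ : 0 ≤ β) (hβ2 : β ≤ 2)
    (h1 : |β - 1| ≤ D.g * (D.cg + B)) (hth : D.th β = D.g * (D.cg + Q)) (hd : |1 - β + D.th β| ≤ 2 * (D.g * Q)) (x : V) :
    D.H β x ≤ 6 * D.ff (1 - D.g * Real.sqrt (8 * Q) ^ 2) x + D.g * ((3 + 24 * C0 / c0 ^ 2) * Q) := by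
  have hg := D.g_pos
  have hcg := D.cg_nonneg
  have hC0 := D.C0_ge
  have hc0 := D.c0_pos
  have hB := hS.1
  have hQ5 : 5 ≤ Q := by linarith
  have hr : 1 ≤ Real.sqrt (8 * Q) := by rw [Real.one_le_sqrt]; linarith
  have hrs : Real.sqrt (8 * Q) ^ 2 = 8 * Q := Real.sq_sqrt (by linarith)
  have hgr : D.g * Real.sqrt (8 * Q) ^ 2 ≤ 1 / 2 := by linarith [hS.r hr hr3B]
  have hr3 : Real.sqrt (8 * Q) ≤ 3 * Q := by
    rw [Real.sqrt_le_left (by linarith)]; nlinarith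
  have hthX : D.th β ≤ D.g * (D.cg + B) := by rw [hth]; gcongr
  obtain ⟨h3, -, -⟩ := D.CRpack hS hβ h1 hthX hr hr3B (by
    rw [hrs]; have := mul_le_mul_of_nonneg_left hQ1 hg.le; linarith)
  have hH := D.H_le hβ x
  have hk := D.k_le_ff hr hgr x
  have hk0 := D.k_nonneg x
  have hρ : β * D.rho β ≤ D.g := by
    have h := D.rho_small hS hβ hβ2 hthX
    have := D.g_lt
    nlinarith only [h, this, hg]
  have hx := h3 x
  have hKr : 8 * C0 / c0 ^ 2 * Real.sqrt (8 * Q) ≤ 8 * C0 / c0 ^ 2 * (3 * Q) := by gcongr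
  have hKg := mul_le_mul_of_nonneg_left hKr hg.le
  have hbk : β * D.k x ≤ 2 * D.ff (1 - D.g * Real.sqrt (8 * Q) ^ 2) x := mul_le_mul hβ2 hk hk0 (by norm_num)
  have e : D.g * ((3 + 24 * C0 / c0 ^ 2) * Q) = D.g * (8 * C0 / c0 ^ 2 * (3 * Q)) + 3 * (D.g * Q) := by ring
  have hgQ : D.g ≤ D.g * Q := by nlinarith
  rw [e]
  rw [hth] at hx
  linarith

set_option maxHeartbeats 1600000 in
lemma caseB {B r r2 A Q β t C1 C6 C7 CM : ℝ} (hS : D.Sm B) (hA0 : 0 ≤ A)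
    (hC1 : C1 = 3 + 24 * C0 / c0 ^ 2) (hC6 : C6 = 1 + 6 * Csq c0 C0 + 4 * C1) (hC7 : C7 = 6 * (33 * C3 c0 C0 + 128))
    (hCM : CM = 1 + 8 * C0 / c0 ^ 2 * r2)
    (hr : 1 ≤ r) (hr5 : C5 c0 C0 < r) (hδ : C6 * C1 * (8 * Csq c0 C0 / r + 32 * (C5 c0 C0 / r) ^ 2) ≤ 1 / 4)
    (hr2 : 1 ≤ r2) (hr22 : 2 * (r ^ 2 + 3 + 8 * C0) ≤ r2 ^ 2)
    (hQ1 : 1 + 4 * C0 ≤ Q) (hQ2 : 12 * (A + CM + 1) + r ^ 2 ≤ Q) (hQ3 : 2 * (C0 + 4 + 2 * (C6 * C7)) < Q)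
    (hBA : A ≤ B) (hBQ : C1 * Q ≤ B) (hrB : r ^ 2 ≤ B) (hr2B : r2 ≤ B) (hr3B : Real.sqrt (8 * Q) ≤ B) (hBC : 1 + 2 * C0 ≤ B)
    (hBM : CM + r ^ 2 + 1 ≤ B)
    (ht : 0 ≤ t) (htb : t ≤ β) (hβ1 : β ≤ 1 + D.g * (D.cg + A)) (hth : D.th β = D.g * (D.cg + Q))
    (hteq : t * (1 - D.th t) = 1 - D.g * r ^ 2)
    (hHt : ∀ x, D.H t x ≤ t * D.ff (1 - D.g * r ^ 2) x + C5 c0 C0 / r * D.g) : False := by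
  have hg := D.g_pos
  have hγ := D.γ_pos
  have hcg := D.cg_nonneg
  have hC0 := D.C0_ge
  have hc0 := D.c0_pos
  have hle := hS.le
  have hsq := hS.sq
  have hB := hS.1
  have hCs := D.Csq_ge
  have hC3 := C3_nonneg c0 C0
  have hβ : 0 ≤ β := ht.trans htb
  have hrr : r ≤ r ^ 2 := le_self_pow₀ hr (by norm_num)
  have hgr : D.g * r ^ 2 ≤ 1 / 2 := by linarith [hS.r hr (hrr.trans hrB)]
  have hgr4 : D.g * r ^ 2 ≤ 1 / 4 := hS.r hr (hrr.trans hrB)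
  have hKr0 : 0 ≤ 8 * C0 / c0 ^ 2 * r2 := by positivity
  have hC1' : 3 ≤ C1 := by rw [hC1]; have : 0 ≤ 24 * C0 / c0 ^ 2 := by positivity
                           linarith
  have hC6' : 1 ≤ C6 := by linarith
  have hC7' : 0 ≤ C7 := by rw [hC7]; linarith
  have hCM1 : 1 ≤ CM := by linarith
  have hQB : Q ≤ B := le_trans (le_mul_of_one_le_left (by linarith) (by linarith)) hBQ
  have hr4 : 0 ≤ r ^ 2 := by positivity
  have htle : D.th t ≤ D.g * (D.cg + Q) := by rw [← hth]; exact D.th_mono ht htb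
  obtain ⟨b1, b2, b3⟩ := D.caseB1 hS hBA hQB hrB hr2 hr2B hr22 ht (htb.trans hβ1) htle hteq
  rw [← hCM] at b1 b2
  have hβX : β ≤ 1 + D.g * (D.cg + B) := hβ1.trans (by gcongr)
  have hβ2 : β ≤ 2 := by linarith
  have habs : |β - 1| ≤ D.g * (D.cg + B) := by
    have : D.g * r ^ 2 ≤ D.g * (D.cg + B) := by gcongr; linarith
    rw [abs_le]; constructor <;> linarith
  have hQ0 : 0 ≤ Q := by linarith
  have hd : |1 - β + D.th β| ≤ 2 * (D.g * Q) := by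
    have a1 : D.g * (CM + r ^ 2 + 1) ≤ D.g * Q := by gcongr; linarith
    have a2 : D.g * A ≤ D.g * Q := by gcongr; linarith
    rw [hth, abs_le]; constructor <;> nlinarith only [a1, a2, b2, hβ1, htb, hg, hQ0]
  have hH := D.caseB2 hS hQ1 hQB hr3B hβ hβ2 habs hth hd
  rw [← hC1] at hH
  have hQ5 : 5 ≤ Q := by linarith
  set r3 := Real.sqrt (8 * Q) with hr3
  have hr31 : 1 ≤ r3 := by rw [hr3, Real.one_le_sqrt]; linarith
  have hgr3 : D.g * r3 ^ 2 ≤ 1 / 2 := by linarith [hS.r hr31 hr3B]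
  set f3 := D.ff (1 - D.g * r3 ^ 2) with hf3
  -- r4
  set r4 := Real.sqrt (Q / 4) with hr4
  have hr41 : 1 ≤ r4 := by rw [hr4, Real.one_le_sqrt]; linarith
  have hr4s : r4 ^ 2 = Q / 4 := Real.sq_sqrt (by linarith)
  have hr4B : r4 ≤ B := by
    refine le_trans ?_ hr3B
    exact Real.sqrt_le_sqrt (by linarith)
  have hgr4' : D.g * r4 ^ 2 ≤ 1 / 2 := by linarith [hS.r hr41 hr4B]
  set f4 := D.ff (1 - D.g * r4 ^ 2) with hf4
  have hHn := D.H_nonneg hβ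
  -- bounds on H
  have hS1 : ∀ x, D.H β x ≤ 1 := fun x => by
    have h := D.ff_le hr31 hgr3 x
    have a1 : D.g * (D.cg + 1 + 2 * C0) ≤ D.g * (D.cg + B) := by gcongr D.g * ?_; linarith
    have a2 : D.g * (C1 * Q) ≤ D.g * (D.cg + B) := by gcongr; linarith
    linarith [hH x]
  have hS2 : ∀ x, conv f4 (D.H β) x ≤ 6 * Csq c0 C0 + 4 * C1 := fun x => by
    have h := conv_mono (D.ff0 hr41 hgr4') hH x
    rw [conv_add, conv_smul, conv_const, D.ff_sum' hr41 hgr4', hr4s] at h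
    have h1 := conv_cs (D.ff_sq hr41 hgr4') (D.ff_sq hr31 hgr3) x
    have e : D.g * (C1 * Q) * (D.g * (Q / 4))⁻¹ = 4 * C1 := by field_simp
    rw [← hr4s] at h
    rw [← hr4s] at e
    rw [e] at h
    rw [← Csq] at h1
    have q1 : Csq c0 C0 / r4 ≤ Csq c0 C0 := div_le_self (by linarith) hr41
    have q2 : Csq c0 C0 / r3 ≤ Csq c0 C0 := div_le_self (by linarith) hr31
    linarith
  -- the coefficient
  have hcoef : β * (1 - D.th β / 3 - 2 / 3 * (β ^ 2 * conv D.k (conv D.k (D.G t)) 0)) ≤ 1 - D.g * r4 ^ 2 := by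
    rw [hr4s]; exact D.caseB_coef hS hA0 hCM1 (by linarith) hQB ht htb hβ1 hth b1
  -- H'
  set η := C5 c0 C0 / r with hη
  have hr0 : 0 < r := by linarith
  have hη1 : η ≤ 1 := by rw [hη, div_le_one hr0]; exact hr5.le
  have hη0 : 0 ≤ η := by
    rw [hη]; unfold C5 C4; positivity
  set H' : V → ℝ := fun u => β * conv D.k (D.G t) u with hH'
  have hH'0 : ∀ u, 0 ≤ H' u := fun u => mul_nonneg hβ (conv_nonneg D.k_nonneg (D.G_nonneg ht) u)
  have ht34 : 3 / 4 ≤ t := by linarith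
  have hH'le : ∀ u, H' u ≤ 2 * D.ff (1 - D.g * r ^ 2) u + (2 * η) * D.g := fun u => by
    refine le_of_mul_le_mul_left ?_ (by linarith : 0 < t)
    have h1 := mul_le_mul_of_nonneg_left (hHt u) hβ
    have e : t * H' u = β * D.H t u := by rw [hH']; unfold H; ring
    rw [e]
    have hf0 := D.ff0 hr hgr u
    have p1 : β * (t * D.ff (1 - D.g * r ^ 2) u) ≤ 2 * (t * D.ff (1 - D.g * r ^ 2) u) := by gcongr
    have p2 : β * (η * D.g) ≤ (2 * t) * (η * D.g) := by gcongr; linarith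
    linarith
  have hU : ∑ u, H' u ^ 2 * D.H β u ≤ D.g * (C7 + C1 * Q * (8 * Csq c0 C0 / r + 32 * η ^ 2)) := by
    rw [hC7]
    exact D.caseB_U hr hgr hr31 hgr3 hη0 hη1 (mul_nonneg (by linarith) hQ0) hH'0 hH'le hH
  have hUnn : ∀ u, 0 ≤ H' u ^ 2 * D.H β u := fun u => mul_nonneg (sq_nonneg _) (hHn u)
  have hG : ∀ y, D.G β y ≤ del y + (1 - D.g * r4 ^ 2) * conv D.k (D.G β) y + (2 / 3 * conv (fun u => H' u ^ 2 * D.H β u) (D.G β) y + D.rho β) := by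
    intro y
    have h := D.G_skel ht htb y
    have h2 := conv_nonneg D.k_nonneg (D.G_nonneg hβ) y
    have := mul_le_mul_of_nonneg_right hcoef h2
    linarith
  have hstep := D.step hβ hr41 hgr4' hUnn hG hS1 hS2
  have hρ : β * D.rho β * (D.g * r4 ^ 2)⁻¹ ≤ D.g := by
    have hthX : D.th β ≤ D.g * (D.cg + B) := by rw [hth]; exact mul_le_mul_of_nonneg_left (by linarith) hg.le
    have h := D.rho_small hS hβ hβ2 hthX
    have h5 : D.g ≤ D.g * r4 ^ 2 := le_mul_of_one_le_right hg.le (one_le_pow₀ hr41)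
    rw [← div_eq_mul_inv, div_le_iff₀ (by linarith)]
    have h6 : D.g * D.g ≤ D.g * (D.g * r4 ^ 2) := mul_le_mul_of_nonneg_left h5 hg.le
    have h7 : 0 ≤ D.g * D.g := mul_nonneg hg.le hg.le
    linarith
  set S := ∑ u, H' u ^ 2 * D.H β u with hSdef
  have hS0 : 0 ≤ S := Finset.sum_nonneg fun u _ => hUnn u
  have hstep2 : ∀ x, D.H β x ≤ β * D.ff (1 - D.g * r4 ^ 2) x + (2 / 3 * S * C6 + D.g) := fun x => by
    have := hstep x
    rw [show 1 + (6 * Csq c0 C0 + 4 * C1) = C6 by rw [hC6]; ring] at this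
    linarith
  have hfin := D.th_of_H hS (by linarith) hr41 hr4B hβ hβX (by positivity) hstep2
  rw [hth] at hfin
  have h1 : S * C6 ≤ D.g * (C7 + C1 * Q * (8 * Csq c0 C0 / r + 32 * η ^ 2)) * C6 := by gcongr
  have h2 : D.g * (C7 + C1 * Q * (8 * Csq c0 C0 / r + 32 * η ^ 2)) * C6 ≤ D.g * (C6 * C7 + Q / 4) := by
    have := mul_le_mul_of_nonneg_left hδ hQ0
    have e : D.g * (C7 + C1 * Q * (8 * Csq c0 C0 / r + 32 * η ^ 2)) * C6 =
      D.g * (C6 * C7 + Q * (C6 * C1 * (8 * Csq c0 C0 / r + 32 * η ^ 2))) := by ring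
    rw [e]; gcongr; linarith
  have h3 : D.g * (D.cg + Q) ≤ D.g * (D.cg + (C0 + 4 + 4 / 3 * (C6 * C7) + Q / 3)) := by
    linarith
  have h4 := le_of_mul_le_mul_left h3 hg
  have : 0 ≤ C6 * C7 := by positivity
  linarith

end KD

end PartP11c

section PartP11d
namespace KD
variable {V : Type} [Fintype V] [DecidableEq V] [AddCommGroup V] {c0 C0 : ℝ} (D : KD V c0 C0)

lemma th_at_zero : D.th 0 = 0 := by unfold th TT; rw [zero_mul]

lemma th_lt {B r r2 A Q β0 C1 C6 C7 CM : ℝ} (hS : D.Sm B) (hA0 : 0 ≤ A)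
    (hC1 : C1 = 3 + 24 * C0 / c0 ^ 2) (hC6 : C6 = 1 + 6 * Csq c0 C0 + 4 * C1) (hC7 : C7 = 6 * (33 * C3 c0 C0 + 128))
    (hCM : CM = 1 + 8 * C0 / c0 ^ 2 * r2)
    (hr : 1 ≤ r) (hr5 : C5 c0 C0 < r) (hδ : C6 * C1 * (8 * Csq c0 C0 / r + 32 * (C5 c0 C0 / r) ^ 2) ≤ 1 / 4)
    (hr2 : 1 ≤ r2) (hr22 : 2 * (r ^ 2 + 3 + 8 * C0) ≤ r2 ^ 2)
    (hQ1 : 1 + 4 * C0 ≤ Q) (hQ2 : 12 * (A + CM + 1) + r ^ 2 ≤ Q) (hQ3 : 2 * (C0 + 4 + 2 * (C6 * C7)) < Q)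
    (hQ4 : C0 + 4 < Q)
    (hBA : A ≤ B) (hBQ : C1 * Q ≤ B) (hrB : r ^ 2 ≤ B) (hr2B : r2 ≤ B) (hr3B : Real.sqrt (8 * Q) ≤ B) (hBC : 1 + 2 * C0 ≤ B)
    (hBC2 : 3 + 4 * C0 ≤ 2 * B)
    (hBM : CM + r ^ 2 + 1 ≤ B) (hβ0 : 0 ≤ β0) (hβ1 : β0 ≤ 1 + D.g * (D.cg + A)) : D.th β0 < D.g * (D.cg + Q) := by
  by_contra hcon
  push Not at hcon
  have hg := D.g_pos
  have hcg := D.cg_nonneg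
  have hC0 := D.C0_ge
  have hle := hS.le
  have hX : D.g * (D.cg + A) ≤ D.g * (D.cg + B) := mul_le_mul_of_nonneg_left (by linarith) hg.le
  have hrr : r ≤ r ^ 2 := le_self_pow₀ hr (by norm_num)
  have hrB' := hrr.trans hrB
  obtain ⟨b, ⟨hb0, hbb⟩, hb⟩ := intermediate_value_Icc hβ0 D.th_cont.continuousOn
    ⟨by rw [D.th_at_zero]; exact mul_nonneg hg.le (by linarith), hcon⟩
  have hb1 := hbb.trans hβ1
  have hr0 : 0 < r := by linarith
  by_cases hA : ∀ s, 0 ≤ s → s ≤ b → s * (1 - D.th s) ≤ 1 - D.g * r ^ 2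
  · have h := D.stage1 hS hBC2 hr hrB' hb0 (by linarith) hr5 hA
    have hη : C5 c0 C0 / r * D.g ≤ D.g := by
      have : C5 c0 C0 / r ≤ 1 := by rw [div_le_one hr0]; exact hr5.le
      calc _ ≤ 1 * D.g := mul_le_mul_of_nonneg_right this hg.le
        _ = _ := one_mul _
    have h2 := D.th_of_H (E1 := D.g) hS (by linarith) hr hrB' hb0 (by linarith) hg.le (fun x => (h x).trans (by linarith))
    rw [hb] at h2
    have h3 : D.g * (D.cg + Q) ≤ D.g * (D.cg + (C0 + 4)) := by linarith
    have h4 := le_of_mul_le_mul_left h3 hg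
    linarith
  · push Not at hA
    obtain ⟨s0, hs0, hs0b, hs0u⟩ := hA
    have huc : Continuous (fun s => s * (1 - D.th s)) := continuous_id.mul (continuous_const.sub D.th_cont)
    set K := Set.Icc 0 s0 ∩ {s | 1 - D.g * r ^ 2 ≤ s * (1 - D.th s)} with hK
    have hKc : IsCompact K := isCompact_Icc.inter_right (isClosed_le continuous_const huc)
    obtain ⟨t, ⟨⟨ht0, hts⟩, htu⟩, htl⟩ := hKc.exists_isLeast ⟨s0, ⟨hs0, le_rfl⟩, hs0u.le⟩
    simp only [Set.mem_setOf_eq] at htu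
    have hgr := hS.r hr hrB'
    obtain ⟨t', ⟨h1, h2⟩, h3⟩ := intermediate_value_Icc ht0 huc.continuousOn ⟨by simp only [zero_mul]; linarith, htu⟩
    simp only at h3
    have h4 : t ≤ t' := htl ⟨⟨h1, h2.trans hts⟩, h3.ge⟩
    have h5 : t' = t := le_antisymm h2 h4
    rw [h5] at h3
    have htb := hts.trans hs0b
    have hst := D.stage1 hS hBC2 hr hrB' ht0 (by linarith) hr5 (fun s hs hst => by
      by_contra hc
      push Not at hc
      have := htl ⟨⟨hs, hst.trans hts⟩, hc.le⟩
      have : s = t := le_antisymm hst this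
      rw [this, h3] at hc
      exact lt_irrefl _ hc)
    exact D.caseB hS hA0 hC1 hC6 hC7 hCM hr hr5 hδ hr2 hr22 hQ1 hQ2 hQ3 hBA hBQ hrB hr2B hr3B hBC hBM ht0 htb hb1 hb h3 hst

lemma susc {B A Q r β : ℝ} (hS : D.Sm B) (hAB : |A| ≤ B) (hQB : Q ≤ B) (hQ : 0 ≤ Q) (hr : 1 ≤ r) (hrB : r ≤ B)
    (hr2 : 2 * (Q + |A| + 4 + 24 * C0) ≤ r ^ 2)
    (hβ : β = 1 + D.g * (D.cg + A)) (hth : D.th β < D.g * (D.cg + Q)) :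
    0 ≤ β ∧ ∑ x, D.G β x ≤ (8 * (Q + 1 + 8 * C0 / c0 ^ 2 * r)) / D.g := by
  have hg := D.g_pos
  have hcg := D.cg_nonneg
  have hC0 := D.C0_ge
  have hle := hS.le
  have hsq := hS.sq
  have hA := abs_le.1 hAB
  have hA' := neg_abs_le A
  have hA'' := le_abs_self A
  have hQX : D.g * (D.cg + Q) ≤ D.g * (D.cg + B) := mul_le_mul_of_nonneg_left (by linarith) hg.le
  have h1 : |β - 1| ≤ D.g * (D.cg + B) := by
    rw [hβ, add_sub_cancel_left, abs_mul, abs_of_pos hg]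
    refine mul_le_mul_of_nonneg_left ?_ hg.le
    rw [abs_le]; constructor <;> linarith
  have h1' := abs_le.1 h1
  have hβ0 : 0 ≤ β := by linarith
  have hβ2 : β ≤ 2 := by linarith
  have ht0 := D.th_nonneg hβ0
  have hthX : D.th β ≤ D.g * (D.cg + B) := hth.le.trans hQX
  have hdd := D.dd_ge hβ0
  have hdq := D.dd_eq hS hβ0 h1 hthX
  have hlow : -(D.g * (2 + 16 * C0)) ≤ 1 - β + D.th β := by
    have e1 : D.th β ^ 2 ≤ D.g / 100 := by
      calc D.th β ^ 2 ≤ (D.g * (D.cg + B)) ^ 2 := by gcongr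
        _ = D.g * (D.g * (D.cg + B) ^ 2) := by ring
        _ ≤ D.g * (1 / 100) := by gcongr
        _ = _ := by ring
    have e2 : D.th β ^ 2 * β ≤ (D.g / 100) * 2 := mul_le_mul e1 hβ2 hβ0 (by positivity)
    have e3 : β ^ 2 * C0 * D.g ≤ 4 * C0 * D.g := by
      have : β ^ 2 ≤ 4 := by nlinarith only [hβ0, hβ2]
      gcongr
    have e4 : D.ee β = 3 * (D.th β ^ 2 * β) + 4 * (β ^ 2 * C0 * D.g) := by unfold ee; ring
    have := (abs_le.1 hdq).2
    linarith
  have habs : |1 - β + D.th β| ≤ D.g * (Q + |A| + 2 + 16 * C0) := by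
    have q1 : 0 ≤ D.g * (Q + |A|) := by have := abs_nonneg A; positivity
    have q2 : D.g * (-A) ≤ D.g * |A| := mul_le_mul_of_nonneg_left (by linarith) hg.le
    rw [abs_le]; constructor
    · linarith
    · rw [hβ] at hth ⊢; nlinarith only [hth, q2, hg, hC0]
  have hmul := mul_le_mul_of_nonneg_left hr2 hg.le
  obtain ⟨-, -, h3⟩ := D.CRpack hS hβ0 h1 hthX hr hrB (by nlinarith only [habs, hmul, hg, hC0])
  refine ⟨hβ0, ?_⟩
  rw [D.n_inv] at h3
  rw [le_div_iff₀ hg]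
  have h5 : D.g * ((∑ x, D.G β x) * D.g) ≤ D.g * (8 * (Q + 1 + 8 * C0 / c0 ^ 2 * r)) := by
    nlinarith only [h3, hth]
  exact le_of_mul_le_mul_left h5 hg

end KD

open KD in
/-- the susceptibility bound -/
theorem susc_bound {c0 C0 : ℝ} (hc0 : 0 < c0) (hC0 : 1 ≤ C0) (A : ℝ) : ∃ B C : ℝ, 0 ≤ C ∧ 100 ≤ B ∧
    ∀ (V : Type) [Fintype V] [DecidableEq V] [AddCommGroup V] (D : KD V c0 C0), D.Sm B →
      0 ≤ 1 + D.g * (D.cg + A) ∧ ∑ x, D.G (1 + D.g * (D.cg + A)) x ≤ C / D.g := by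
  have hCs : 1 ≤ Csq c0 C0 := by
    unfold Csq; have : 0 ≤ 5 * C0 / c0 ^ 2 := by positivity
    linarith
  have hC3 := C3_nonneg c0 C0
  have hC5 : 0 ≤ C5 c0 C0 := by unfold C5 C4; positivity
  obtain ⟨C1, hC1⟩ : ∃ C1, C1 = 3 + 24 * C0 / c0 ^ 2 := ⟨_, rfl⟩
  have hC1' : 3 ≤ C1 := by rw [hC1]; have : 0 ≤ 24 * C0 / c0 ^ 2 := by positivity
                           linarith
  obtain ⟨C6, hC6⟩ : ∃ C6, C6 = 1 + 6 * Csq c0 C0 + 4 * C1 := ⟨_, rfl⟩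
  have hC6' : 1 ≤ C6 := by linarith
  obtain ⟨C7, hC7⟩ : ∃ C7, C7 = 6 * (33 * C3 c0 C0 + 128) := ⟨_, rfl⟩
  have hC7' : 0 ≤ C7 := by linarith
  set W := C6 * C1 * (8 * Csq c0 C0 + 32 * C5 c0 C0 ^ 2) with hW
  have hW0 : 0 ≤ W := by positivity
  obtain ⟨r, hr⟩ : ∃ r, r = 1 + C5 c0 C0 + 4 * W := ⟨_, rfl⟩
  have hr1 : 1 ≤ r := by linarith
  have hr0 : 0 < r := by linarith
  have hr5 : C5 c0 C0 < r := by linarith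
  have hδ : C6 * C1 * (8 * Csq c0 C0 / r + 32 * (C5 c0 C0 / r) ^ 2) ≤ 1 / 4 := by
    have h1 : (C5 c0 C0 / r) ^ 2 ≤ C5 c0 C0 ^ 2 / r := by
      rw [div_pow]
      exact div_le_div_of_nonneg_left (by positivity) hr0 (le_self_pow₀ hr1 (by norm_num))
    calc _ ≤ C6 * C1 * (8 * Csq c0 C0 / r + 32 * (C5 c0 C0 ^ 2 / r)) := by gcongr
      _ = W / r := by rw [hW]; ring
      _ ≤ 1 / 4 := by rw [div_le_iff₀ hr0]; linarith
  obtain ⟨r2, hr2⟩ : ∃ r2, r2 = 2 * (r ^ 2 + 3 + 8 * C0) := ⟨_, rfl⟩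
  have hrr : 0 ≤ r ^ 2 := by positivity
  have hr21 : 1 ≤ r2 := by linarith
  have hr22 : 2 * (r ^ 2 + 3 + 8 * C0) ≤ r2 ^ 2 := by
    rw [← hr2]; exact le_self_pow₀ hr21 (by norm_num)
  obtain ⟨CM, hCM⟩ : ∃ CM, CM = 1 + 8 * C0 / c0 ^ 2 * r2 := ⟨_, rfl⟩
  have hCM1 : 1 ≤ CM := by
    have : 0 ≤ 8 * C0 / c0 ^ 2 * r2 := by positivity
    linarith
  have hA := abs_nonneg A
  have h67 : 0 ≤ C6 * C7 := by positivity
  obtain ⟨Q, hQ⟩ : ∃ Q, Q = 12 * (|A| + CM + 1) + r ^ 2 + 4 * C0 + 4 * (C6 * C7) + 20 := ⟨_, rfl⟩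
  have hQ0 : 0 ≤ Q := by linarith
  obtain ⟨r5, hr5'⟩ : ∃ r5, r5 = 2 * (Q + |A| + 4 + 24 * C0) := ⟨_, rfl⟩
  have hr51 : 1 ≤ r5 := by linarith
  have hs := Real.sqrt_nonneg (8 * Q)
  have hCQ : 0 ≤ C1 * Q := by positivity
  have hQQ : Q ≤ C1 * Q := le_mul_of_one_le_left hQ0 (by linarith)
  refine ⟨100 + |A| + C1 * Q + r ^ 2 + r2 + Real.sqrt (8 * Q) + 4 * C0 + CM + r5, 8 * (Q + 1 + 8 * C0 / c0 ^ 2 * r5), by positivity, by linarith [Real.sqrt_nonneg (8*Q)], ?_⟩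
  intro V _ _ _ D hS
  have hle := hS.le
  have hg := D.g_pos
  have hcg := D.cg_nonneg
  have hAA : D.g * (D.cg + A) ≤ D.g * (D.cg + |A|) := mul_le_mul_of_nonneg_left (by linarith [le_abs_self A]) hg.le
  have hβ0 : 0 ≤ 1 + D.g * (D.cg + A) := by
    have : D.g * (-(D.cg + (100 + |A| + C1 * Q + r ^ 2 + r2 + Real.sqrt (8 * Q) + 4 * C0 + CM + r5))) ≤ D.g * (D.cg + A) :=
      mul_le_mul_of_nonneg_left (by linarith [neg_abs_le A]) hg.le
    linarith
  have hth := D.th_lt (A := |A|) (Q := Q) (β0 := 1 + D.g * (D.cg + A)) hS hA hC1 hC6 hC7 hCM hr1 hr5 hδ hr21 hr22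
    (by linarith) (by linarith) (by linarith) (by linarith) (by linarith) (by linarith) (by linarith) (by linarith) (by linarith)
    (by linarith) (by linarith) (by linarith) hβ0 (by linarith)
  exact D.susc hS (by linarith) (by linarith) hQ0 hr51 (by linarith) (by rw [← hr5']; exact le_self_pow₀ hr51 (by norm_num)) rfl hth

end PartP11d

section PartP12
section LatFacts
variable (N : ℕ) [NeZero N]

lemma N_pos : (0 : ℝ) < N := by exact_mod_cast Nat.pos_of_ne_zero (NeZero.ne N)

lemma latRep_eq (v : ZMod (2 * N)) : latRep N v = v.valMinAbs := by
  unfold latRep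
  rw [ZMod.valMinAbs_def_pos]
  have : 2 * N / 2 = N := by omega
  rw [this]
  simp only [Nat.cast_le, Nat.cast_mul, Nat.cast_ofNat]

lemma latRep_cast (v : ZMod (2 * N)) : ((latRep N v : ℤ) : ZMod (2 * N)) = v := by
  rw [latRep_eq]; exact ZMod.coe_valMinAbs v

lemma latRep_inj : Function.Injective (latRep N) := fun a b h => by
  rw [← latRep_cast N a, h, latRep_cast]

lemma latRep_zero : latRep N 0 = 0 := by rw [latRep_eq]; simp

lemma latRep_ne {v : ZMod (2 * N)} (h : v ≠ 0) : latRep N v ≠ 0 := fun e => h (latRep_inj N (e.trans (latRep_zero N).symm))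

lemma latRep_abs_le (v : ZMod (2 * N)) : |(latRep N v : ℝ)| ≤ N := by
  have h := ZMod.valMinAbs_mem_Ioc v
  rw [← latRep_eq] at h
  have h1 := h.1
  have h2 := h.2
  push_cast at h1 h2
  rw [← Int.cast_abs]
  have : |latRep N v| ≤ (N : ℤ) := by rw [abs_le]; constructor <;> omega
  exact_mod_cast this

lemma latRep_neg_abs (v : ZMod (2 * N)) : |(latRep N (-v) : ℝ)| = |(latRep N v : ℝ)| := by
  have h := ZMod.natAbs_valMinAbs_neg v
  rw [← latRep_eq, ← latRep_eq] at h
  rw [← Int.cast_abs, ← Int.cast_abs, Int.abs_eq_natAbs, Int.abs_eq_natAbs, h]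

lemma latRep_nat {p : ℕ} (hp : p ≤ N) : latRep N (p : ZMod (2 * N)) = p := by
  have hN := Nat.pos_of_ne_zero (NeZero.ne N)
  unfold latRep
  rw [ZMod.val_natCast, Nat.mod_eq_of_lt (by omega)]
  rw [if_pos (by exact_mod_cast hp)]

/-- cosine on the discrete circle -/
def cosZ (v : ZMod (2 * N)) : ℝ := Real.cos (Real.pi * (v.val : ℝ) / N)

lemma cosZ_int (m : ℤ) : cosZ N (m : ZMod (2 * N)) = Real.cos (Real.pi * (m : ℝ) / N) := by
  have hN := N_pos N
  unfold cosZ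
  have h1 : (((m : ZMod (2 * N)).val : ℤ)) = m % ((2 * N : ℕ) : ℤ) := by
    rw [ZMod.val_intCast]
  have h2 := Int.emod_add_mul_ediv m ((2 * N : ℕ) : ℤ)
  rw [← h1] at h2
  have h3 : (m : ℝ) = ((m : ZMod (2 * N)).val : ℝ) + (2 * N) * ((m / ((2 * N : ℕ) : ℤ) : ℤ) : ℝ) := by
    have := congrArg (fun z : ℤ => (z : ℝ)) h2
    push_cast at this ⊢
    linarith
  rw [h3]
  rw [← Real.cos_add_int_mul_two_pi _ (m / ((2 * N : ℕ) : ℤ))]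
  congr 1
  field_simp

lemma cosZ_add_sub (a b : ZMod (2 * N)) : cosZ N (a + b) + cosZ N (a - b) = 2 * (cosZ N a * cosZ N b) := by
  obtain ⟨m, rfl⟩ := ZMod.intCast_surjective a
  obtain ⟨n, rfl⟩ := ZMod.intCast_surjective b
  rw [← Int.cast_add, ← Int.cast_sub, cosZ_int, cosZ_int, cosZ_int, cosZ_int]
  push_cast
  rw [mul_add, mul_sub, add_div, sub_div, Real.cos_add, Real.cos_sub]
  ring

lemma cosZ_zero : cosZ N 0 = 1 := by
  have := cosZ_int N 0
  simpa using this

lemma cosZ_ne {v : ZMod (2 * N)} (h : v ≠ 0) : cosZ N v ≠ 1 := by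
  intro e
  apply h
  unfold cosZ at e
  rw [Real.cos_eq_one_iff] at e
  obtain ⟨n, hn⟩ := e
  have hN := N_pos N
  have hpi := Real.pi_pos
  have h1 : (n : ℝ) * (2 * N) = v.val := by
    field_simp at hn
    linarith
  have h2 : n * (2 * N : ℕ) = ((v.val : ℕ) : ℤ) := by
    have : ((n * (2 * N : ℕ) : ℤ) : ℝ) = (((v.val : ℕ) : ℤ) : ℝ) := by push_cast; exact h1
    exact_mod_cast this
  have hv : ((v.val : ℕ) : ZMod (2 * N)) = v := ZMod.natCast_zmod_val v
  have h3 : (((v.val : ℕ) : ℤ) : ZMod (2 * N)) = 0 := by rw [← h2, Int.cast_mul, Int.cast_natCast, ZMod.natCast_self, mul_zero]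
  rw [← hv]; exact_mod_cast h3

def coL (ω z : Lat N) : ℝ := cosZ N (ω.1 * z.1 + ω.2 * z.2)

lemma coL_eq (ω z : Lat N) : coL N ω z = Real.cos (Real.pi * (((latRep2 N ω).1 : ℝ) * (latRep N z.1 : ℝ) / N + ((latRep2 N ω).2 : ℝ) * (latRep N z.2 : ℝ) / N)) := by
  unfold coL latRep2
  conv_lhs => rw [← latRep_cast N ω.1, ← latRep_cast N ω.2, ← latRep_cast N z.1, ← latRep_cast N z.2]
  rw [← Int.cast_mul, ← Int.cast_mul, ← Int.cast_add, cosZ_int]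
  congr 1
  push_cast
  ring

lemma coL_mul (ω x y : Lat N) : coL N ω (x + y) + coL N ω (x - y) = 2 * (coL N ω x * coL N ω y) := by
  unfold coL
  rw [← cosZ_add_sub]
  congr 2 <;> simp only [Prod.fst_add, Prod.snd_add, Prod.fst_sub, Prod.snd_sub] <;> ring

lemma coL_sum (ω : Lat N) : ∑ y, coL N ω y = if ω = 0 then (Fintype.card (Lat N) : ℝ) else 0 := by
  split_ifs with h
  · subst h
    simp [coL, cosZ_zero]
  · have key : ∀ y, (∑ x, coL N ω x) = (∑ x, coL N ω x) * coL N ω y := fun y => by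
      have h1 : ∑ x, coL N ω (x + y) = ∑ x, coL N ω x := Equiv.sum_comp (Equiv.addRight y) (fun x => coL N ω x)
      have h2 : ∑ x, coL N ω (x - y) = ∑ x, coL N ω x := Equiv.sum_comp (Equiv.subRight y) (fun x => coL N ω x)
      have h3 : ∑ x, (coL N ω (x + y) + coL N ω (x - y)) = ∑ x, 2 * (coL N ω x * coL N ω y) :=
        Finset.sum_congr rfl fun x _ => coL_mul N ω x y
      rw [Finset.sum_add_distrib, h1, h2, ← Finset.mul_sum, ← Finset.sum_mul] at h3
      linarith
    have : ∃ y, coL N ω y ≠ 1 := by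
      by_cases h1 : ω.1 = 0
      · refine ⟨(0, 1), ?_⟩
        have h2 : ω.2 ≠ 0 := fun h2 => h (Prod.ext h1 h2)
        unfold coL; simpa using cosZ_ne N h2
      · refine ⟨(1, 0), ?_⟩
        unfold coL; simpa using cosZ_ne N h1
    obtain ⟨y, hy⟩ := this
    have := key y
    have h5 : (∑ x, coL N ω x) * (1 - coL N ω y) = 0 := by linarith
    rcases mul_eq_zero.1 h5 with h6 | h6
    · exact h6
    · exact absurd (by linarith) hy

/-- size of a frequency -/
def wL (ω : Lat N) : ℝ := max |(latRep N ω.1 : ℝ)| |(latRep N ω.2 : ℝ)|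

lemma one_le_latRep {v : ZMod (2 * N)} (h : v ≠ 0) : 1 ≤ |(latRep N v : ℝ)| := by
  rw [← Int.cast_abs]
  exact_mod_cast Int.one_le_abs (latRep_ne N h)

lemma wL_ge {ω : Lat N} (h : ω ≠ 0) : 1 ≤ wL N ω := by
  unfold wL
  by_cases h1 : ω.1 = 0
  · exact le_max_of_le_right (one_le_latRep N fun h2 => h (Prod.ext h1 h2))
  · exact le_max_of_le_left (one_le_latRep N h1)

lemma wL_le (ω : Lat N) : wL N ω ≤ N := max_le (latRep_abs_le N _) (latRep_abs_le N _)

end LatFacts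

lemma sum_one_dim {s : ℝ} (hs : 1 < s) : ∃ C : ℝ, 0 ≤ C ∧ ∀ (N : ℕ) [NeZero N],
    ∑ v : ZMod (2 * N), (max 1 |(latRep N v : ℝ)|) ^ (-s) ≤ C := by
  have h1 : Summable (fun m : ℤ => |(m : ℝ)| ^ (-s)) := Real.summable_abs_int_rpow hs
  have h2 : Summable (fun m : ℤ => if m = 0 then (1 : ℝ) else 0) := by
    apply summable_of_ne_finset_zero (s := {0})
    intro b hb
    simp at hb
    simp [hb]
  have h3 := h1.add h2
  refine ⟨∑' m : ℤ, (|(m : ℝ)| ^ (-s) + if m = 0 then (1 : ℝ) else 0), tsum_nonneg (fun m => by positivity), fun N _ => ?_⟩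
  · have := h3.sum_le_tsum (Finset.univ.map ⟨latRep N, latRep_inj N⟩) (fun m _ => by positivity)
    rw [Finset.sum_map] at this
    refine le_trans (Finset.sum_le_sum fun v _ => ?_) this
    simp only [Function.Embedding.coeFn_mk]
    by_cases hv : v = 0
    · subst hv
      simp [latRep_zero, Real.zero_rpow (by linarith : -s ≠ 0)]
    · rw [if_neg (latRep_ne N hv), max_eq_right (one_le_latRep N hv), add_zero]

lemma sum_two_dim {s : ℝ} (hs : 1 < s) : ∃ C : ℝ, 0 ≤ C ∧ ∀ (N : ℕ) [NeZero N],
    ∑ ω ∈ Finset.univ.erase (0 : Lat N), (wL N ω) ^ (-(2 * s)) ≤ C := by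
  obtain ⟨C, hC, h⟩ := sum_one_dim hs
  refine ⟨C * C, by positivity, fun N _ => ?_⟩
  calc ∑ ω ∈ Finset.univ.erase (0 : Lat N), (wL N ω) ^ (-(2 * s))
      ≤ ∑ ω ∈ Finset.univ.erase (0 : Lat N), (max 1 |(latRep N ω.1 : ℝ)|) ^ (-s) * (max 1 |(latRep N ω.2 : ℝ)|) ^ (-s) := by
        refine Finset.sum_le_sum fun ω hω => ?_
        have hw := wL_ge N (Finset.ne_of_mem_erase hω)
        have e : -(2 * s) = -s + -s := by ring
        rw [e, Real.rpow_add (by linarith)]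
        have q1 : max 1 |(latRep N ω.1 : ℝ)| ≤ wL N ω := max_le hw (le_max_left _ _)
        have q2 : max 1 |(latRep N ω.2 : ℝ)| ≤ wL N ω := max_le hw (le_max_right _ _)
        have p : 0 ≤ wL N ω := by linarith
        apply mul_le_mul
        · exact Real.rpow_le_rpow_of_nonpos (by positivity) q1 (by linarith)
        · exact Real.rpow_le_rpow_of_nonpos (by positivity) q2 (by linarith)
        · positivity
        · positivity
    _ ≤ ∑ ω : Lat N, (max 1 |(latRep N ω.1 : ℝ)|) ^ (-s) * (max 1 |(latRep N ω.2 : ℝ)|) ^ (-s) :=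
        Finset.sum_le_sum_of_subset_of_nonneg (Finset.erase_subset _ _) (fun _ _ _ => by positivity)
    _ = (∑ v : ZMod (2 * N), (max 1 |(latRep N v : ℝ)|) ^ (-s)) * (∑ v : ZMod (2 * N), (max 1 |(latRep N v : ℝ)|) ^ (-s)) := by
        rw [Fintype.sum_prod_type, Finset.sum_mul_sum]
    _ ≤ C * C := by
        have := h N
        gcongr

end PartP12

section PartP12b
lemma enorm2_axis {r : ℝ} (hr : 0 ≤ r) : enorm2 (r, 0) = r := by
  unfold enorm2; simp [Real.sqrt_sq hr]

lemma profile_low (𝔎 : KacProfile) : ∃ r η κ0 : ℝ, 0 ≤ r ∧ r ≤ 3 ∧ 0 < η ∧ η ≤ 1 ∧ 0 < κ0 ∧ κ0 ≤ 1 ∧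
    ∀ p q : ℝ, r < p → p < r + η → 0 < q → q < η → κ0 ≤ 𝔎.f (p, q) := by
  obtain ⟨x, hx⟩ := 𝔎.nontriv
  have hpos : 0 < 𝔎.f x := lt_of_le_of_ne (𝔎.mem x).1 (Ne.symm hx)
  set r := enorm2 x with hr
  have hr0 : 0 ≤ r := Real.sqrt_nonneg _
  have hr3 : r ≤ 3 := by
    by_contra h
    exact hx (𝔎.supp x (by linarith))
  have he : 𝔎.f (r, 0) = 𝔎.f x := 𝔎.radial _ _ (by rw [enorm2_axis hr0])
  have hc : ContinuousAt 𝔎.f (r, 0) := 𝔎.smooth.continuous.continuousAt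
  rw [Metric.continuousAt_iff] at hc
  obtain ⟨δ, hδ, h⟩ := hc (𝔎.f x / 2) (by linarith)
  refine ⟨r, min δ 1, 𝔎.f x / 2, hr0, hr3, by positivity, min_le_right _ _, by linarith, by linarith [(𝔎.mem x).2], ?_⟩
  intro p q h1 h2 h3 h4
  have hm := min_le_left δ (1 : ℝ)
  have := h (x := (p, q)) (by
    rw [Prod.dist_eq, max_lt_iff, Real.dist_eq, Real.dist_eq]
    simp only
    rw [abs_of_pos (by linarith), abs_of_pos (by linarith)]
    constructor <;> linarith)
  rw [Real.dist_eq, he] at this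
  have := (abs_lt.1 this).1
  linarith

section
variable (N : ℕ) [NeZero N]

lemma gam_pos : 0 < gam N := by unfold gam; have := N_pos N; positivity
lemma gam_sq : gam N ^ 2 = (N : ℝ)⁻¹ := by unfold gam; have := N_pos N; rw [Real.sq_sqrt (by positivity)]
lemma gam_sq_mul : gam N ^ 2 * N = 1 := by rw [gam_sq]; have := N_pos N; field_simp

lemma box_sum_le {F : Lat N → ℝ} (hF : ∀ z, 0 ≤ F z) {p q M : ℕ} (hp : p + M ≤ N + 1) (hq : q + M ≤ N + 1) :
    ∑ i ∈ Finset.range M, ∑ j ∈ Finset.range M, F (((p + i : ℕ) : ZMod (2 * N)), ((q + j : ℕ) : ZMod (2 * N))) ≤ ∑ z, F z := by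
  rw [← Finset.sum_product']
  rw [← Finset.sum_image (f := F) (g := fun x : ℕ × ℕ => ((((p + x.1 : ℕ) : ZMod (2 * N)), ((q + x.2 : ℕ) : ZMod (2 * N))) : Lat N))]
  · exact Finset.sum_le_univ_sum_of_nonneg hF
  · rintro ⟨a, b⟩ hab ⟨a', b'⟩ hab' h
    simp only [Finset.coe_product, Set.mem_prod, Finset.coe_range, Set.mem_Iio] at hab hab'
    simp only [Prod.mk.injEq] at h
    have h1 := congrArg (latRep N) h.1
    have h2 := congrArg (latRep N) h.2
    rw [latRep_nat N (by omega), latRep_nat N (by omega)] at h1 h2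
    simp only [Prod.mk.injEq]
    omega

lemma card_small (M : ℕ) : ((Finset.univ.filter (fun v : ZMod (2 * N) => |latRep N v| ≤ (M : ℤ))).card) ≤ 2 * M + 1 := by
  have : ((Finset.univ.filter (fun v : ZMod (2 * N) => |latRep N v| ≤ (M : ℤ))).card) ≤ (Finset.Icc (-(M : ℤ)) M).card := by
    apply Finset.card_le_card_of_injOn (latRep N)
    · intro v hv
      simp only [Finset.coe_filter, Finset.mem_univ, true_and, Set.mem_setOf_eq] at hv
      simp only [Finset.coe_Icc, Set.mem_Icc]
      exact abs_le.1 hv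
    · exact (latRep_inj N).injOn
  refine this.trans ?_
  simp; omega

lemma prof_zero (𝔎 : KacProfile) {a b : ℝ} (h : 3 < |a| ∨ 3 < |b|) : 𝔎.f (a, b) = 0 := by
  apply 𝔎.supp
  unfold enorm2
  simp only
  rcases h with h | h
  · refine lt_of_lt_of_le h (Real.abs_le_sqrt ?_); nlinarith [sq_nonneg b]
  · refine lt_of_lt_of_le h (Real.abs_le_sqrt ?_); nlinarith [sq_nonneg a]

lemma kG_nonneg (𝔎 : KacProfile) {c γ : ℝ} (hc : 0 ≤ c) (z : Lat N) : 0 ≤ kGamma 𝔎 N c γ z := by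
  unfold kGamma
  split_ifs
  · exact le_rfl
  · have := (𝔎.mem (γ * (latRep N z.1 : ℝ), γ * (latRep N z.2 : ℝ))).1
    positivity

lemma kG_le (𝔎 : KacProfile) {c γ : ℝ} (hc : 0 ≤ c) (z : Lat N) : kGamma 𝔎 N c γ z ≤ c * γ ^ 2 := by
  unfold kGamma
  split_ifs
  · positivity
  · have := (𝔎.mem (γ * (latRep N z.1 : ℝ), γ * (latRep N z.2 : ℝ))).2
    exact mul_le_of_le_one_right (by positivity) this

lemma kG_even (𝔎 : KacProfile) (c γ : ℝ) (z : Lat N) : kGamma 𝔎 N c γ (-z) = kGamma 𝔎 N c γ z := by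
  unfold kGamma
  simp only [neg_eq_zero]
  split_ifs
  · rfl
  · congr 1
    apply 𝔎.radial
    unfold enorm2
    simp only [Prod.fst_neg, Prod.snd_neg, mul_pow]
    rw [← sq_abs (latRep N (-z.1) : ℝ), ← sq_abs (latRep N (-z.2) : ℝ), latRep_neg_abs, latRep_neg_abs, sq_abs, sq_abs]

lemma c_low (𝔎 : KacProfile) {c : ℝ} (hc : 0 < c) (hg1 : gam N ≤ 1) (hs : ∑ z : Lat N, kGamma 𝔎 N c (gam N) z = 1) : 1 / 49 ≤ c := by
  set γ := gam N with hγ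
  have hγ0 : 0 < γ := gam_pos N
  set M := ⌊3 / γ⌋₊ with hM
  have hMle : (M : ℝ) ≤ 3 / γ := Nat.floor_le (by positivity)
  set S := Finset.univ.filter (fun v : ZMod (2 * N) => |latRep N v| ≤ (M : ℤ)) with hS
  have hout : ∀ v : ZMod (2 * N), v ∉ S → 3 < |γ * (latRep N v : ℝ)| := fun v hv => by
    simp only [hS, Finset.mem_filter, Finset.mem_univ, true_and, not_le] at hv
    have h1 : ((M : ℝ) + 1) ≤ |(latRep N v : ℝ)| := by
      rw [← Int.cast_abs]
      have : (M : ℤ) + 1 ≤ |latRep N v| := by omega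
      exact_mod_cast this
    have h2 : 3 / γ < M + 1 := Nat.lt_floor_add_one _
    rw [abs_mul, abs_of_pos hγ0]
    rw [div_lt_iff₀ hγ0] at h2
    nlinarith
  have h1 : ∑ z : Lat N, kGamma 𝔎 N c γ z ≤ ∑ z ∈ S ×ˢ S, c * γ ^ 2 := by
    rw [← Finset.sum_subset (Finset.subset_univ (S ×ˢ S))]
    · exact Finset.sum_le_sum fun z _ => kG_le N 𝔎 hc.le z
    · intro z _ hz
      unfold kGamma
      split_ifs
      · rfl
      · rw [prof_zero 𝔎, mul_zero]
        rw [Finset.mem_product, not_and_or] at hz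
        rcases hz with h | h
        · left; exact hout _ h
        · right; exact hout _ h
  rw [hs, Finset.sum_const, nsmul_eq_mul, Finset.card_product] at h1
  have h2 : (S.card : ℝ) ≤ 7 / γ := by
    have : (S.card : ℝ) ≤ 2 * M + 1 := by exact_mod_cast card_small N M
    have : (1 : ℝ) ≤ 1 / γ := by rw [le_div_iff₀ hγ0]; linarith
    have e : 7 / γ = 2 * (3 / γ) + 1 / γ := by ring
    linarith
  push_cast at h1
  have h3 : (S.card : ℝ) * S.card * (c * γ ^ 2) ≤ (7 / γ) * (7 / γ) * (c * γ ^ 2) := by gcongr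
  have e : (7 / γ) * (7 / γ) * (c * γ ^ 2) = 49 * c := by field_simp; ring
  linarith

lemma cos_pair (a d : ℝ) : 1 - Real.cos d ≤ 2 * ((1 - Real.cos a) + (1 - Real.cos (a + d))) := by
  have e : Real.cos d = Real.cos (a + d) * Real.cos a + Real.sin (a + d) * Real.sin a := by
    rw [← Real.cos_sub]; congr 1; ring
  rw [e]
  nlinarith [Real.sin_sq_add_cos_sq a, Real.sin_sq_add_cos_sq (a + d), sq_nonneg (Real.cos (a + d) + Real.cos a - 2), sq_nonneg (Real.sin (a + d) + Real.sin a)]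

lemma cosZ_pair (a d : ZMod (2 * N)) : 1 - cosZ N d ≤ 2 * ((1 - cosZ N a) + (1 - cosZ N (a + d))) := by
  obtain ⟨m, rfl⟩ := ZMod.intCast_surjective a
  obtain ⟨n, rfl⟩ := ZMod.intCast_surjective d
  rw [← Int.cast_add, cosZ_int, cosZ_int, cosZ_int]
  push_cast
  have := cos_pair (Real.pi * (m : ℝ) / N) (Real.pi * (n : ℝ) / N)
  rw [← add_div, ← mul_add] at this
  exact this

lemma pair_sum {u : ℕ → ℝ} (hu : ∀ i, 0 ≤ u i) {L h : ℕ} (hh : h ≤ L) {δ : ℝ} (hd : ∀ i, δ ≤ 2 * (u i + u (i + h))) :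
    L * δ / 4 ≤ ∑ i ∈ Finset.range (2 * L), u i := by
  have h1 : ∑ i ∈ Finset.range L, u i ≤ ∑ i ∈ Finset.range (2 * L), u i :=
    Finset.sum_le_sum_of_subset_of_nonneg (Finset.range_mono (by omega)) fun i _ _ => hu i
  have h2 : ∑ i ∈ Finset.range L, u (i + h) ≤ ∑ i ∈ Finset.range (2 * L), u i := by
    rw [← Finset.sum_image (f := u) (g := fun i => i + h) (fun a _ b _ e => by simpa using e)]
    refine Finset.sum_le_sum_of_subset_of_nonneg ?_ fun i _ _ => hu i
    intro x hx
    simp only [Finset.mem_image, Finset.mem_range] at hx ⊢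
    omega
  have h3 : ∑ i ∈ Finset.range L, δ ≤ ∑ i ∈ Finset.range L, 2 * (u i + u (i + h)) := Finset.sum_le_sum fun i _ => hd i
  rw [← Finset.mul_sum, Finset.sum_add_distrib, Finset.sum_const, Finset.card_range, nsmul_eq_mul] at h3
  linarith

lemma cosZ_le_one (v : ZMod (2 * N)) : cosZ N v ≤ 1 := Real.cos_le_one _

lemma freq_low {v : ZMod (2 * N)} {L : ℕ} (hv : v ≠ 0) (hL : 1 ≤ L) : ∃ h : ℕ, h ≤ L ∧
    2 * min (1 / 4) ((|(latRep N v : ℝ)| * L / N) ^ 2) ≤ 1 - cosZ N (v * (h : ZMod (2 * N))) := by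
  have hN := N_pos N
  obtain ⟨w, hw⟩ : ∃ w, w = (latRep N v).natAbs := ⟨_, rfl⟩
  have hwr : |(latRep N v : ℝ)| = w := by rw [← Int.cast_abs, Int.abs_eq_natAbs, hw]; rfl
  have hw1 : 1 ≤ w := by have := one_le_latRep N hv; rw [hwr] at this; exact_mod_cast this
  have hwN : w ≤ N := by have := latRep_abs_le N v; rw [hwr] at this; exact_mod_cast this
  have key : ∀ h : ℕ, w * h ≤ N → 2 * ((w * h : ℝ) / N) ^ 2 ≤ 1 - cosZ N (v * (h : ZMod (2 * N))) := fun h hle => by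
    have e : v * (h : ZMod (2 * N)) = ((latRep N v * h : ℤ) : ZMod (2 * N)) := by
      push_cast; rw [latRep_cast]
    rw [e, cosZ_int]
    have hx : |Real.pi * ((latRep N v * h : ℤ) : ℝ) / N| = Real.pi * ((w * h : ℝ) / N) := by
      push_cast
      rw [abs_div, abs_mul, abs_mul, hwr, abs_of_pos Real.pi_pos, Nat.abs_cast, Nat.abs_cast]; ring
    have hx1 : (w * h : ℝ) / N ≤ 1 := by rw [div_le_one hN]; exact_mod_cast hle
    have := Real.cos_le_one_sub_mul_cos_sq (x := Real.pi * ((latRep N v * h : ℤ) : ℝ) / N) (by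
      rw [hx]; nlinarith [Real.pi_pos])
    rw [← sq_abs (Real.pi * ((latRep N v * h : ℤ) : ℝ) / N), hx] at this
    have e2 : 2 / Real.pi ^ 2 * (Real.pi * ((w * h : ℝ) / N)) ^ 2 = 2 * ((w * h : ℝ) / N) ^ 2 := by
      have := Real.pi_pos
      field_simp
    linarith
  rw [hwr]
  by_cases hc : w * L ≤ N
  · refine ⟨L, le_rfl, ?_⟩
    have := key L hc
    linarith [min_le_right (1 / 4 : ℝ) (((w : ℝ) * L / N) ^ 2)]
  · refine ⟨N / w, ?_, ?_⟩
    · by_contra hcon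
      push Not at hcon
      apply hc
      calc w * L ≤ w * (N / w) := Nat.mul_le_mul_left _ hcon.le
        _ ≤ N := Nat.mul_div_le N w
    · have := key (N / w) (Nat.mul_div_le N w)
      have h1 : N < w * (N / w + 1) := Nat.lt_mul_div_succ N (by omega)
      have h2 : 1 ≤ N / w := (Nat.one_le_div_iff (by omega)).2 hwN
      have h3 : N ≤ 2 * (w * (N / w)) := by nlinarith
      have h4 : (N : ℝ) ≤ 2 * ((w : ℝ) * ((N / w : ℕ) : ℝ)) := by exact_mod_cast h3
      have h5 : (1 / 2 : ℝ) ≤ (w : ℝ) * ((N / w : ℕ) : ℝ) / N := by rw [le_div_iff₀ hN]; linarith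
      have h6 : (1 / 4 : ℝ) ≤ ((w : ℝ) * ((N / w : ℕ) : ℝ) / N) ^ 2 := by nlinarith
      linarith [min_le_left (1 / 4 : ℝ) (((w : ℝ) * L / N) ^ 2)]

lemma box_cos {ω : Lat N} (hω : ω ≠ 0) {p q L : ℕ} (hL : 1 ≤ L) :
    (L : ℝ) ^ 2 * min (1 / 4) ((wL N ω * L / N) ^ 2) ≤
      ∑ i ∈ Finset.range (2 * L), ∑ j ∈ Finset.range (2 * L), (1 - coL N ω (((p + i : ℕ) : ZMod (2 * N)), ((q + j : ℕ) : ZMod (2 * N)))) := by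
  have hw := wL_ge N hω
  have hnn : ∀ v, 0 ≤ 1 - cosZ N v := fun v => by linarith [cosZ_le_one N v]
  rcases le_total |(latRep N ω.2 : ℝ)| |(latRep N ω.1 : ℝ)| with h | h
  · have e : wL N ω = |(latRep N ω.1 : ℝ)| := max_eq_left h
    rw [e] at hw ⊢
    have hv : ω.1 ≠ 0 := fun h0 => by rw [h0, latRep_zero] at hw; norm_num at hw
    obtain ⟨m, hm, hd⟩ := freq_low N hv hL
    rw [Finset.sum_comm]
    have : ∀ j ∈ Finset.range (2 * L), (L : ℝ) * (2 * min (1 / 4) ((|(latRep N ω.1 : ℝ)| * L / N) ^ 2)) / 4 ≤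
        ∑ i ∈ Finset.range (2 * L), (1 - coL N ω (((p + i : ℕ) : ZMod (2 * N)), ((q + j : ℕ) : ZMod (2 * N)))) := fun j _ => by
      refine pair_sum (fun i => hnn _) hm (fun i => hd.trans ?_)
      refine (cosZ_pair N (ω.1 * ((p + i : ℕ) : ZMod (2 * N)) + ω.2 * ((q + j : ℕ) : ZMod (2 * N))) (ω.1 * (m : ZMod (2 * N)))).trans (le_of_eq ?_)
      dsimp only
      congr 4
      push_cast; ring
    refine le_trans (le_of_eq ?_) (Finset.sum_le_sum this)
    rw [Finset.sum_const, Finset.card_range, nsmul_eq_mul]; push_cast; ring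
  · have e : wL N ω = |(latRep N ω.2 : ℝ)| := max_eq_right h
    rw [e] at hw ⊢
    have hv : ω.2 ≠ 0 := fun h0 => by rw [h0, latRep_zero] at hw; norm_num at hw
    obtain ⟨m, hm, hd⟩ := freq_low N hv hL
    have : ∀ i ∈ Finset.range (2 * L), (L : ℝ) * (2 * min (1 / 4) ((|(latRep N ω.2 : ℝ)| * L / N) ^ 2)) / 4 ≤
        ∑ j ∈ Finset.range (2 * L), (1 - coL N ω (((p + i : ℕ) : ZMod (2 * N)), ((q + j : ℕ) : ZMod (2 * N)))) := fun i _ => by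
      refine pair_sum (fun j => hnn _) hm (fun j => hd.trans ?_)
      refine (cosZ_pair N (ω.1 * ((p + i : ℕ) : ZMod (2 * N)) + ω.2 * ((q + j : ℕ) : ZMod (2 * N))) (ω.2 * (m : ZMod (2 * N)))).trans (le_of_eq ?_)
      dsimp only
      congr 4
      push_cast; ring
    refine le_trans (le_of_eq ?_) (Finset.sum_le_sum this)
    rw [Finset.sum_const, Finset.card_range, nsmul_eq_mul]; push_cast; ring

end

end PartP12b

section PartP12c
section
variable (N : ℕ) [NeZero N]

lemma box_exists (𝔎 : KacProfile) {r η κ0 : ℝ} (hr0 : 0 ≤ r) (hr3 : r ≤ 3) (hη : 0 < η) (hη1 : η ≤ 1)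
    (hlow : ∀ p q : ℝ, r < p → p < r + η → 0 < q → q < η → κ0 ≤ 𝔎.f (p, q)) (hγ : gam N ≤ η / 8)
    {c : ℝ} (hc : 0 < c) :
    ∃ p q L : ℕ, 1 ≤ L ∧ η / 8 ≤ gam N * L ∧ p + 2 * L ≤ N + 1 ∧ q + 2 * L ≤ N + 1 ∧
      ∀ i j : ℕ, i < 2 * L → j < 2 * L →
        c * gam N ^ 2 * κ0 ≤ kGamma 𝔎 N c (gam N) (((p + i : ℕ) : ZMod (2 * N)), ((q + j : ℕ) : ZMod (2 * N))) := by
  have hg := gam_pos N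
  have hgN := gam_sq_mul N
  have hNp := N_pos N
  set γ := gam N with hγdef
  set L := ⌊η / (4 * γ)⌋₊ with hL
  set p := ⌊r / γ⌋₊ + 1 with hp
  have hL1 : (L : ℝ) ≤ η / (4 * γ) := Nat.floor_le (by positivity)
  have hL2 : η / (4 * γ) < L + 1 := Nat.lt_floor_add_one _
  have hp1 : ((p : ℕ) : ℝ) ≤ r / γ + 1 := by
    have := Nat.floor_le (a := r / γ) (by positivity)
    rw [hp]; push_cast; linarith
  have hp2 : r / γ < ((p : ℕ) : ℝ) := by
    have := Nat.lt_floor_add_one (r / γ)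
    rw [hp]; push_cast; linarith
  have hL1' : 4 * (γ * L) ≤ η := by
    rw [le_div_iff₀ (by positivity)] at hL1; linarith
  have hL2' : η < 4 * (γ * L) + 4 * γ := by
    rw [div_lt_iff₀ (by positivity)] at hL2; linarith
  have hp1' : γ * p ≤ r + γ := by
    have := mul_le_mul_of_nonneg_left hp1 hg.le
    have e : γ * (r / γ + 1) = r + γ := by field_simp
    linarith
  have hp2' : r < γ * p := by
    rw [div_lt_iff₀ hg] at hp2; linarith
  have hγL : η / 8 ≤ γ * L := by linarith
  have hL0 : 1 ≤ L := by
    rcases Nat.eq_zero_or_pos L with h | h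
    · rw [h] at hγL; push_cast at hγL; linarith
    · exact h
  have hsz : p + 2 * L ≤ N + 1 := by
    have h1 : γ * (p + 2 * L : ℝ) ≤ γ * (N + 1) := by
      have h4 : 4 ≤ γ * N := by
        by_contra h
        push Not at h
        have : γ * (γ * N) < γ * 4 := mul_lt_mul_of_pos_left h hg
        nlinarith
      nlinarith
    have := le_of_mul_le_mul_left h1 hg
    exact_mod_cast this
  refine ⟨p, 1, L, hL0, hγL, hsz, ?_, ?_⟩
  · have : 1 ≤ p := by omega
    omega
  · intro i j hi hj
    have hi' : (i : ℝ) + 1 ≤ 2 * L := by exact_mod_cast hi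
    have hj' : (j : ℝ) + 1 ≤ 2 * L := by exact_mod_cast hj
    have hi2 := mul_le_mul_of_nonneg_left hi' hg.le
    have hj2 := mul_le_mul_of_nonneg_left hj' hg.le
    have hp0 : 1 ≤ p := by omega
    have e1 : latRep N ((p + i : ℕ) : ZMod (2 * N)) = (p + i : ℕ) := latRep_nat N (by omega)
    have e2 : latRep N ((1 + j : ℕ) : ZMod (2 * N)) = (1 + j : ℕ) := latRep_nat N (by omega)
    unfold kGamma
    rw [if_neg]
    · dsimp only
      rw [e1, e2]
      have hii : 0 ≤ γ * i := by positivity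
      have hjj : 0 ≤ γ * j := by positivity
      refine mul_le_mul_of_nonneg_left (hlow _ _ ?_ ?_ ?_ ?_) (by positivity) <;> push_cast <;> nlinarith
    · intro h0
      have := congrArg (latRep N) (congrArg Prod.snd h0)
      dsimp only at this
      rw [e2] at this
      simp only [Prod.snd_zero, latRep_zero] at this
      omega

lemma card_lat : (Fintype.card (Lat N) : ℝ) = 4 * (N : ℝ) ^ 2 := by
  rw [Fintype.card_prod, ZMod.card]; push_cast; ring

end

lemma exists_KD (𝔎 : KacProfile) : ∃ c0 C0 η : ℝ, 0 < c0 ∧ c0 ≤ 1 ∧ 1 ≤ C0 ∧ 0 < η ∧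
    ∀ (N : ℕ) [NeZero N], gam N ≤ η → ∀ c : ℝ, 0 < c → (∑ z : Lat N, kGamma 𝔎 N c (gam N) z) = 1 →
      ∃ D : KD (Lat N) c0 C0, D.γ = gam N ∧ D.k = kGamma 𝔎 N c (gam N) ∧ D.co = coL N ∧ D.w = wL N := by
  obtain ⟨r, η, κ0, hr0, hr3, hη, hη1, hκ, hκ1, hlow⟩ := profile_low 𝔎
  obtain ⟨Cs, hCs, hsum⟩ := sum_two_dim (s := 3 / 2) (by norm_num)
  have hc0 : 0 < κ0 * η ^ 4 / (49 * 4096) := by positivity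
  have hη4 : η ^ 4 ≤ 1 := pow_le_one₀ hη.le hη1
  have hc01 : κ0 * η ^ 4 / (49 * 4096) ≤ 1 := by
    rw [div_le_one (by norm_num)]
    nlinarith [mul_le_mul hκ1 hη4 (by positivity) (by norm_num)]
  refine ⟨κ0 * η ^ 4 / (49 * 4096), 1 + 16 / (κ0 * η ^ 2) + Cs, η / 8, hc0, hc01, ?_, by positivity, ?_⟩
  · have : 0 ≤ 16 / (κ0 * η ^ 2) := by positivity
    linarith
  intro N _ hγ c hc hs
  have hg := gam_pos N
  have hgN := gam_sq_mul N
  have hNp := N_pos N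
  obtain ⟨p, q, L, hL1, hLη, hpN, hqN, hk⟩ := box_exists N 𝔎 hr0 hr3 hη hη1 hlow hγ hc
  have hclow := c_low N 𝔎 hc (by linarith) hs
  have h16 : 0 ≤ 16 / (κ0 * η ^ 2) := by positivity
  have hLsq : η ^ 2 / 64 ≤ (gam N * L) ^ 2 := by
    have := pow_le_pow_left₀ (by positivity) hLη 2
    linarith [this, show (η / 8) ^ 2 = η ^ 2 / 64 by ring]
  have hcup : c ≤ 16 / (κ0 * η ^ 2) := by
    have h1 := box_sum_le N (kG_nonneg N 𝔎 (γ := gam N) hc.le) hpN hqN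
    rw [hs] at h1
    have h2 : ∑ i ∈ Finset.range (2 * L), ∑ j ∈ Finset.range (2 * L), c * gam N ^ 2 * κ0 ≤
        ∑ i ∈ Finset.range (2 * L), ∑ j ∈ Finset.range (2 * L), kGamma 𝔎 N c (gam N) (((p + i : ℕ) : ZMod (2 * N)), ((q + j : ℕ) : ZMod (2 * N))) :=
      Finset.sum_le_sum fun i hi => Finset.sum_le_sum fun j hj => hk i j (Finset.mem_range.1 hi) (Finset.mem_range.1 hj)
    replace h2 := h2.trans h1
    simp only [Finset.sum_const, Finset.card_range, nsmul_eq_mul] at h2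
    push_cast at h2
    rw [le_div_iff₀ (by positivity)]
    have h3 : c * κ0 * (η ^ 2 / 64) ≤ c * κ0 * (gam N * L) ^ 2 := mul_le_mul_of_nonneg_left hLsq (by positivity)
    nlinarith
  refine ⟨{ γ := gam N, k := kGamma 𝔎 N c (gam N), co := coL N, w := wL N, c0_pos := hc0, c0_le := hc01, C0_ge := by linarith,
            γ_pos := hg, γ_lt := by linarith, hn := ?_, k_nonneg := kG_nonneg N 𝔎 hc.le, k_zero := if_pos rfl,
            k_even := kG_even N 𝔎 c _, k_sum := hs, k_le := ?_, co_symm := ?_, co_zero := ?_, co_abs := ?_, co_mul := coL_mul N,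
            co_sum := coL_sum N, w_ge := fun x hx => wL_ge N hx, w_sum := ?_, gap := ?_ }, rfl, rfl, rfl, rfl⟩
  · rw [card_lat]
    calc 4 * (N : ℝ) ^ 2 * gam N ^ 4 = 4 * (gam N ^ 2 * N) ^ 2 := by ring
      _ = 4 := by rw [hgN]; norm_num
  · intro x
    refine (kG_le N 𝔎 hc.le x).trans (mul_le_mul_of_nonneg_right ?_ (by positivity))
    linarith
  · intro x y
    unfold coL
    congr 1; ring
  · intro x
    unfold coL
    simp [cosZ_zero]
  · intro x y
    exact Real.abs_cos_le_one _
  · have := hsum N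
    refine le_trans (le_of_eq ?_) (this.trans (by linarith))
    refine Finset.sum_congr rfl fun x hx => ?_
    have hw : 0 ≤ wL N x := by linarith [wL_ge N (Finset.ne_of_mem_erase hx)]
    rw [show -(2 * (3 / 2 : ℝ)) = -((3 : ℕ) : ℝ) by norm_num, Real.rpow_neg hw, Real.rpow_natCast]
  · intro ω hω
    have e : 1 - ∑ y, kGamma 𝔎 N c (gam N) y * coL N ω y = ∑ y, kGamma 𝔎 N c (gam N) y * (1 - coL N ω y) := by
      simp only [mul_sub, mul_one, Finset.sum_sub_distrib, hs]
    rw [e]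
    have hco : ∀ y, 0 ≤ 1 - coL N ω y := fun y => by unfold coL; linarith [cosZ_le_one N (ω.1 * y.1 + ω.2 * y.2)]
    have h1 := box_sum_le N (F := fun y => kGamma 𝔎 N c (gam N) y * (1 - coL N ω y))
      (fun y => mul_nonneg (kG_nonneg N 𝔎 hc.le y) (hco y)) hpN hqN
    refine le_trans ?_ h1
    have h2 : ∑ i ∈ Finset.range (2 * L), ∑ j ∈ Finset.range (2 * L), c * gam N ^ 2 * κ0 * (1 - coL N ω (((p + i : ℕ) : ZMod (2 * N)), ((q + j : ℕ) : ZMod (2 * N)))) ≤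
        ∑ i ∈ Finset.range (2 * L), ∑ j ∈ Finset.range (2 * L), kGamma 𝔎 N c (gam N) (((p + i : ℕ) : ZMod (2 * N)), ((q + j : ℕ) : ZMod (2 * N))) * (1 - coL N ω (((p + i : ℕ) : ZMod (2 * N)), ((q + j : ℕ) : ZMod (2 * N)))) :=
      Finset.sum_le_sum fun i hi => Finset.sum_le_sum fun j hj => mul_le_mul_of_nonneg_right (hk i j (Finset.mem_range.1 hi) (Finset.mem_range.1 hj)) (hco _)
    refine le_trans ?_ h2
    simp only [← Finset.mul_sum]
    have h3 := box_cos N hω (p := p) (q := q) hL1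
    have hK : 0 ≤ c * gam N ^ 2 * κ0 := by positivity
    refine le_trans ?_ (mul_le_mul_of_nonneg_left h3 hK)
    have hw := wL_ge N hω
    have e2 : wL N ω * L / N = gam N * wL N ω * (gam N * L) := by
      rw [div_eq_iff hNp.ne']
      calc wL N ω * L = wL N ω * L * (gam N ^ 2 * N) := by rw [hgN, mul_one]
        _ = _ := by ring
    rw [e2]
    have h4 : η ^ 2 / 64 * min 1 (gam N ^ 2 * wL N ω ^ 2) ≤ min (1 / 4) ((gam N * wL N ω * (gam N * L)) ^ 2) := by
      have hη2 : η ^ 2 ≤ 1 := pow_le_one₀ hη.le hη1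
      refine le_min ?_ ?_
      · calc η ^ 2 / 64 * min 1 (gam N ^ 2 * wL N ω ^ 2) ≤ η ^ 2 / 64 * 1 := by gcongr; exact min_le_left _ _
          _ ≤ 1 / 4 := by linarith
      · calc η ^ 2 / 64 * min 1 (gam N ^ 2 * wL N ω ^ 2) ≤ (gam N * L) ^ 2 * (gam N ^ 2 * wL N ω ^ 2) :=
              mul_le_mul hLsq (min_le_right _ _) (by positivity) (by positivity)
          _ = _ := by ring
    have hm : 0 ≤ min 1 (gam N ^ 2 * wL N ω ^ 2) := by positivity
    calc κ0 * η ^ 4 / (49 * 4096) * min 1 (gam N ^ 2 * wL N ω ^ 2)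
        = 1 / 49 * κ0 * ((η ^ 2 / 64) * (η ^ 2 / 64 * min 1 (gam N ^ 2 * wL N ω ^ 2))) := by ring
      _ ≤ c * κ0 * ((gam N * L) ^ 2 * min (1 / 4) ((gam N * wL N ω * (gam N * L)) ^ 2)) := by
          gcongr
      _ = _ := by ring

end PartP12c

section PartP12d
lemma cg_growth (c0 C0 : ℝ) (hc0 : 0 < c0) (hC0 : 1 ≤ C0) : ∃ K : ℝ, 0 ≤ K ∧ ∀ (N : ℕ) [NeZero N] (D : KD (Lat N) c0 C0),
    D.w = wL N → D.cg ≤ K * (N : ℝ) ^ (1 / 10 : ℝ) := by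
  obtain ⟨Cs, hCs, hsum⟩ := sum_two_dim (s := 21 / 20) (by norm_num)
  refine ⟨(4 * C0 + Cs) / (4 * c0), by positivity, fun N _ D hw => ?_⟩
  have hNp := N_pos N
  have hN1 : (1 : ℝ) ≤ N := by exact_mod_cast Nat.pos_of_ne_zero (NeZero.ne N)
  have hg := D.g_pos
  have h1 : ∀ ω ∈ Finset.univ.erase (0 : Lat N), D.κ ω ^ 2 * D.γ ^ 2 / (1 - D.κ ω) ≤
      1 / c0 * (D.g * D.κ ω ^ 2 + (N : ℝ) ^ (1 / 10 : ℝ) * (wL N ω) ^ (-(2 * (21 / 20 : ℝ)))) := fun ω hω => by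
    have hω0 := Finset.ne_of_mem_erase hω
    have hw1 := wL_ge N hω0
    have hwp : 0 < wL N ω := by linarith
    have hgap := D.κ_gap ω hω0
    rw [hw] at hgap
    have hmin : 0 < min 1 (D.g * wL N ω ^ 2) := by positivity
    have h2 : (wL N ω ^ 2)⁻¹ ≤ (N : ℝ) ^ (1 / 10 : ℝ) * (wL N ω) ^ (-(2 * (21 / 20 : ℝ))) := by
      have e : (wL N ω ^ 2)⁻¹ = wL N ω ^ (1 / 10 : ℝ) * (wL N ω) ^ (-(2 * (21 / 20 : ℝ))) := by
        rw [← Real.rpow_add hwp, ← Real.rpow_natCast, ← Real.rpow_neg hwp.le]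
        norm_num
      rw [e]
      gcongr
      exact wL_le N ω
    calc D.κ ω ^ 2 * D.γ ^ 2 / (1 - D.κ ω) ≤ D.κ ω ^ 2 * D.γ ^ 2 / (c0 * min 1 (D.g * wL N ω ^ 2)) :=
          div_le_div_of_nonneg_left (by positivity) (by positivity) hgap
      _ = 1 / c0 * (D.κ ω ^ 2 * (D.g / min 1 (D.g * wL N ω ^ 2))) := by
          unfold KD.g; field_simp
      _ ≤ 1 / c0 * (D.κ ω ^ 2 * (D.g + (wL N ω ^ 2)⁻¹)) := by
          gcongr
          rcases min_choice 1 (D.g * wL N ω ^ 2) with h | h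
          · rw [h, div_one]; have : 0 ≤ (wL N ω ^ 2)⁻¹ := by positivity
            linarith
          · rw [h]
            have : D.g / (D.g * wL N ω ^ 2) = (wL N ω ^ 2)⁻¹ := by field_simp
            linarith
      _ ≤ _ := by
          gcongr
          rw [mul_add, mul_comm]
          have := mul_le_mul (D.κ_sq_le ω) h2 (by positivity) (by norm_num)
          linarith
  have h2 := Finset.sum_le_sum h1
  rw [← Finset.mul_sum, Finset.sum_add_distrib, ← Finset.mul_sum, ← Finset.mul_sum] at h2
  have h3 : D.g * ∑ ω ∈ Finset.univ.erase (0 : Lat N), D.κ ω ^ 2 ≤ 4 * C0 := by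
    have := D.κ_sum'
    rw [D.n_inv] at this
    have : D.g * (D.g * ∑ ω ∈ Finset.univ.erase (0 : Lat N), D.κ ω ^ 2) ≤ D.g * (4 * C0) := by linarith
    exact le_of_mul_le_mul_left this hg
  have hN10 : (1 : ℝ) ≤ (N : ℝ) ^ (1 / 10 : ℝ) := Real.one_le_rpow hN1 (by norm_num)
  have h4 := mul_le_mul_of_nonneg_left (hsum N) (by linarith : 0 ≤ (N : ℝ) ^ (1 / 10 : ℝ))
  unfold KD.cg
  have h5 : 1 / c0 * (D.g * ∑ ω ∈ Finset.univ.erase (0 : Lat N), D.κ ω ^ 2 + (N : ℝ) ^ (1 / 10 : ℝ) * ∑ ω ∈ Finset.univ.erase (0 : Lat N), (wL N ω) ^ (-(2 * (21 / 20 : ℝ))))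
      ≤ 1 / c0 * (4 * C0 * (N : ℝ) ^ (1 / 10 : ℝ) + (N : ℝ) ^ (1 / 10 : ℝ) * Cs) := by
    refine mul_le_mul_of_nonneg_left (add_le_add ?_ h4) (by positivity)
    exact h3.trans (le_mul_of_one_le_right (by linarith) hN10)
  calc _ ≤ 1 / 4 * (1 / c0 * (4 * C0 * (N : ℝ) ^ (1 / 10 : ℝ) + (N : ℝ) ^ (1 / 10 : ℝ) * Cs)) := by
        have := h2.trans h5
        linarith
    _ = _ := by field_simp

lemma ev_Sm (c0 C0 : ℝ) (hc0 : 0 < c0) (hC0 : 1 ≤ C0) {B : ℝ} (hB : 100 ≤ B) : ∃ N₀ : ℕ, ∀ (N : ℕ) [NeZero N], N₀ ≤ N →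
    ∀ (D : KD (Lat N) c0 C0), D.w = wL N → D.γ = gam N → D.Sm B := by
  obtain ⟨K, hK, h⟩ := cg_growth c0 C0 hc0 hC0
  have ht : Filter.Tendsto (fun N : ℕ => (K + B) ^ 3 * B * (N : ℝ) ^ (-(1 / 5 : ℝ))) Filter.atTop (nhds ((K + B) ^ 3 * B * 0)) :=
    ((tendsto_rpow_neg_atTop (by norm_num : (0 : ℝ) < 1 / 5)).comp tendsto_natCast_atTop_atTop).const_mul _
  rw [mul_zero] at ht
  obtain ⟨N₀, h0⟩ := Filter.eventually_atTop.1 (ht.eventually (ge_mem_nhds (show (0 : ℝ) < 1 by norm_num)))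
  refine ⟨N₀, fun N _ hN D hw hγ => ⟨hB, ?_⟩⟩
  refine le_trans ?_ (h0 N hN)
  have hNp := N_pos N
  have hN1 : (1 : ℝ) ≤ N := by exact_mod_cast Nat.pos_of_ne_zero (NeZero.ne N)
  have hN10 : (1 : ℝ) ≤ (N : ℝ) ^ (1 / 10 : ℝ) := Real.one_le_rpow hN1 (by norm_num)
  have hcg := h N D hw
  have hcg0 := D.cg_nonneg
  have h1 : D.cg + B ≤ (K + B) * (N : ℝ) ^ (1 / 10 : ℝ) := by nlinarith
  have hgN : gam N = (N : ℝ) ^ (-(1 / 2 : ℝ)) := by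
    unfold gam; rw [Real.sqrt_eq_rpow, Real.inv_rpow hNp.le, Real.rpow_neg hNp.le]
  have e3 : (N : ℝ) ^ (-(1 / 5 : ℝ)) = (N : ℝ) ^ (-(1 / 2 : ℝ)) * ((N : ℝ) ^ (1 / 10 : ℝ)) ^ 3 := by
    rw [← Real.rpow_natCast, ← Real.rpow_mul hNp.le, ← Real.rpow_add hNp]; norm_num
  rw [hγ, hgN, e3]
  calc (N : ℝ) ^ (-(1 / 2 : ℝ)) * (D.cg + B) ^ 3 * B ≤ (N : ℝ) ^ (-(1 / 2 : ℝ)) * ((K + B) * (N : ℝ) ^ (1 / 10 : ℝ)) ^ 3 * B := by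
        gcongr
    _ = _ := by ring

lemma lat_susc (𝔎 : KacProfile) (A : ℝ) : ∃ C : ℝ, 0 ≤ C ∧ ∃ N₀ : ℕ, ∀ (N : ℕ) [NeZero N], N₀ ≤ N → ∀ c : ℝ, 0 < c →
    (∑ z : Lat N, kGamma 𝔎 N c (gam N) z) = 1 →
    0 ≤ betaCrit 𝔎 N c A ∧
    (∀ x y, G2 (fun e : Lat N × Lat N => betaCrit 𝔎 N c A / 2 * kGamma 𝔎 N c (gam N) (e.1 - e.2)) x y =
      G2 (fun e : Lat N × Lat N => betaCrit 𝔎 N c A / 2 * kGamma 𝔎 N c (gam N) (e.1 - e.2)) 0 (y - x)) ∧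
    ∑ x, G2 (fun e : Lat N × Lat N => betaCrit 𝔎 N c A / 2 * kGamma 𝔎 N c (gam N) (e.1 - e.2)) 0 x ≤ C * N := by
  obtain ⟨c0, C0, η, hc0, hc01, hC0, hη, hKD⟩ := exists_KD 𝔎
  obtain ⟨B, C, hC, hB, hsus⟩ := susc_bound hc0 hC0 A
  obtain ⟨N₁, hN₁⟩ := ev_Sm c0 C0 hc0 hC0 hB
  have ht : Filter.Tendsto (fun N : ℕ => gam N) Filter.atTop (nhds 0) := by
    unfold gam
    have := (tendsto_inv_atTop_zero.comp (tendsto_natCast_atTop_atTop (R := ℝ))).sqrt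
    rw [Real.sqrt_zero] at this
    exact this
  obtain ⟨N₂, hN₂⟩ := Filter.eventually_atTop.1 (ht.eventually (ge_mem_nhds hη))
  refine ⟨C, hC, max N₁ N₂, fun N _ hN c hc hs => ?_⟩
  obtain ⟨D, h1, h2, h3, h4⟩ := hKD N (hN₂ N (le_of_max_le_right hN)) c hc hs
  have hS := hN₁ N (le_of_max_le_left hN) D h4 h1
  have hκ : ∀ ω, D.κ ω = kHat N (kGamma 𝔎 N c (gam N)) (latRep2 N ω) := fun ω => by
    unfold KD.κ KD.hat kHat
    rw [h2, h3]
    exact Finset.sum_congr rfl fun z _ => by rw [coL_eq]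
  have hcg : D.cg = cGamma N (kGamma 𝔎 N c (gam N)) (gam N) := by
    unfold KD.cg cGamma
    congr 1
    rw [← Finset.add_sum_erase Finset.univ _ (Finset.mem_univ (0 : Lat N)), if_pos rfl, zero_add]
    refine Finset.sum_congr rfl fun z hz => ?_
    rw [if_neg (Finset.ne_of_mem_erase hz), hκ, h1, inv_mul_eq_div, div_div_eq_mul_div]
  have hβ : 1 + D.g * (D.cg + A) = betaCrit 𝔎 N c A := by
    unfold betaCrit KD.g; rw [hcg, h1]
  obtain ⟨hb, hsum⟩ := hsus (Lat N) D hS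
  rw [hβ] at hb hsum
  have hJ : (fun e : Lat N × Lat N => betaCrit 𝔎 N c A / 2 * kGamma 𝔎 N c (gam N) (e.1 - e.2)) = D.JJ (betaCrit 𝔎 N c A) := by
    funext e; unfold KD.JJ; rw [h2]
  rw [hJ]
  refine ⟨hb, fun x y => D.G2_eq _ x y, hsum.trans (le_of_eq ?_)⟩
  unfold KD.g
  rw [h1, gam_sq, div_inv_eq_mul]

end PartP12d

section PartP13
section
variable {V : Type} [Fintype V] [DecidableEq V]

def Wb (J : V × V → ℝ) (b : ℝ) (s : V → Bool) : ℝ := wt J s * Real.exp (b * ∑ x, sp s x)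

lemma Wb_pos (J : V × V → ℝ) (b : ℝ) (s : V → Bool) : 0 < Wb J b s := mul_pos (wt_pos J s) (Real.exp_pos _)

lemma avb_eq (J : V × V → ℝ) (b : ℝ) (F : (V → Bool) → ℝ) : avb J b F = (∑ s, Wb J b s)⁻¹ * ∑ s, Wb J b s * F s := by
  unfold avb Wb; rw [div_eq_inv_mul]

lemma Zb_pos (J : V × V → ℝ) (b : ℝ) : 0 < ∑ s, Wb J b s :=
  Finset.sum_pos (fun s _ => Wb_pos J b s) ⟨fun _ => true, Finset.mem_univ _⟩

lemma avb_add (J : V × V → ℝ) (b : ℝ) (F G : (V → Bool) → ℝ) : avb J b (fun s => F s + G s) = avb J b F + avb J b G := by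
  simp only [avb_eq, mul_add, Finset.sum_add_distrib]

lemma avb_const_mul (J : V × V → ℝ) (b c : ℝ) (F : (V → Bool) → ℝ) : avb J b (fun s => c * F s) = c * avb J b F := by
  simp only [avb_eq]
  rw [mul_left_comm]
  congr 1
  rw [Finset.mul_sum]
  exact Finset.sum_congr rfl fun s _ => by ring

lemma avb_sum {ι : Type*} (J : V × V → ℝ) (b : ℝ) (I : Finset ι) (F : ι → (V → Bool) → ℝ) :
    avb J b (fun s => ∑ i ∈ I, F i s) = ∑ i ∈ I, avb J b (F i) := by
  simp only [avb_eq, Finset.mul_sum]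
  rw [Finset.sum_comm]

lemma avb_const (J : V × V → ℝ) (b c : ℝ) : avb J b (fun _ => c) = c := by
  rw [avb_eq, ← Finset.sum_mul, ← mul_assoc, inv_mul_cancel₀ (Zb_pos J b).ne', one_mul]

lemma avb_cov (J : V × V → ℝ) (b m : ℝ) (hm : ∀ x, avb J b (fun s => sp s x) = m) (x y : V) :
    avb J b (fun s => (sp s x - m) * (sp s y - m)) =
      avb J b (fun s => sp s x * sp s y) - avb J b (fun s => sp s x) * avb J b (fun s => sp s y) := by
  have e : (fun s : V → Bool => (sp s x - m) * (sp s y - m)) = fun s => (sp s x * sp s y + (-m) * sp s x) + ((-m) * sp s y + m * m) := by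
    funext s; ring
  rw [e, avb_add, avb_add, avb_add, avb_const_mul, avb_const_mul, avb_const, hm, hm]
  ring

lemma second_moment {J : V × V → ℝ} (hJ : ∀ e, 0 ≤ J e) {b : ℝ} (hb : 0 ≤ b) {m : ℝ} (hm : ∀ x, avb J b (fun s => sp s x) = m)
    (a : V → ℝ) {M g : ℝ} (ha : ∀ x, |a x| ≤ M) :
    avb J b (fun s => (g * ∑ x, (sp s x - m) * a x) ^ 2) ≤ g ^ 2 * M ^ 2 * ∑ x, ∑ y, G2 J x y := by
  have e : (fun s : V → Bool => (g * ∑ x, (sp s x - m) * a x) ^ 2) =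
      fun s => g ^ 2 * ∑ x, ∑ y, (a x * a y) * ((sp s x - m) * (sp s y - m)) := by
    funext s
    rw [mul_pow, sq (∑ x, (sp s x - m) * a x), Finset.sum_mul_sum]
    congr 1
    exact Finset.sum_congr rfl fun x _ => Finset.sum_congr rfl fun y _ => by ring
  rw [e, avb_const_mul, avb_sum, mul_assoc]
  refine mul_le_mul_of_nonneg_left ?_ (sq_nonneg g)
  rw [Finset.mul_sum]
  refine Finset.sum_le_sum fun x _ => ?_
  rw [avb_sum, Finset.mul_sum]
  refine Finset.sum_le_sum fun y _ => ?_
  rw [avb_const_mul, avb_cov J b m hm]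
  obtain ⟨h0, h1⟩ := field_bound hJ hb x y
  have hM : 0 ≤ M := (abs_nonneg _).trans (ha x)
  have haa : a x * a y ≤ M ^ 2 := by
    calc a x * a y ≤ |a x * a y| := le_abs_self _
      _ = |a x| * |a y| := abs_mul _ _
      _ ≤ M * M := mul_le_mul (ha x) (ha y) (abs_nonneg _) hM
      _ = M ^ 2 := by ring
  exact (mul_le_mul_of_nonneg_right haa h0).trans (mul_le_mul_of_nonneg_left h1 (by positivity))

variable [AddCommGroup V]

lemma avb_shift {J : V × V → ℝ} (b : ℝ) (x : V) (hJ : ∀ e, J (e.1 + x, e.2 + x) = J e) :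
    avb J b (fun s => sp s x) = avb J b (fun s => sp s 0) := by
  let T : (V → Bool) ≃ (V → Bool) := (Equiv.addRight x).arrowCongr (Equiv.refl Bool)
  have hT : ∀ s z, sp (T s) z = sp s (z - x) := fun s z => by
    show spin ((T s) z) = spin (s (z - x))
    simp [T, Equiv.arrowCongr, sub_eq_add_neg]
  have hW : ∀ s, Wb J b (T s) = Wb J b s := fun s => by
    unfold Wb wt bd
    congr 2
    · rw [← Equiv.sum_comp ((Equiv.addRight x).prodCongr (Equiv.addRight x))]
      refine Finset.sum_congr rfl fun e _ => ?_
      simp only [hT, Equiv.prodCongr_apply, Prod.map, Equiv.coe_addRight, add_sub_cancel_right]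
      rw [hJ]
    · congr 1
      rw [← Equiv.sum_comp (Equiv.addRight x)]
      refine Finset.sum_congr rfl fun e _ => ?_
      simp only [hT, Equiv.coe_addRight, add_sub_cancel_right]
  rw [avb_eq, avb_eq]
  congr 1
  rw [← Equiv.sum_comp T]
  refine Finset.sum_congr rfl fun s _ => ?_
  rw [hW, hT, sub_self]

end

lemma gibbsE_eq (N : ℕ) [NeZero N] (kk : Lat N → ℝ) (β b : ℝ) (F : (Lat N → ℝ) → ℝ) :
    gibbsE N kk β b F = avb (fun e : Lat N × Lat N => β / 2 * kk (e.1 - e.2)) b (fun s => F (fun x => sp s x)) := by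
  have h : ∀ s : Lat N → Bool, Real.exp (hamil N kk β b (fun x => spin (s x))) =
      Wb (fun e : Lat N × Lat N => β / 2 * kk (e.1 - e.2)) b s := fun s => by
    unfold hamil Wb wt bd
    rw [← Real.exp_add]
    refine congrArg Real.exp (congrArg₂ (· + ·) ?_ rfl)
    refine Eq.trans ?_ (Fintype.sum_prod_type (α₁ := Lat N) (α₂ := Lat N) _).symm
    rw [Finset.mul_sum]
    refine Finset.sum_congr rfl fun x _ => ?_
    rw [Finset.mul_sum]
    refine Finset.sum_congr rfl fun y _ => ?_
    unfold sp
    ring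
  unfold gibbsE
  simp only [h]
  rw [avb_eq, div_eq_inv_mul]
  rfl

end PartP13

section PartP14
lemma box_compact : IsCompact box := isCompact_Icc.prod isCompact_Icc
lemma box_meas : MeasurableSet box := measurableSet_Icc.prod measurableSet_Icc

lemma box_vol : (volume : Measure (ℝ × ℝ)).real box = 4 := by
  unfold box Measure.real
  rw [Measure.volume_eq_prod, Measure.prod_prod, Real.volume_Icc, ENNReal.toReal_mul, ENNReal.toReal_ofReal (by norm_num)]
  norm_num

lemma box_convex : Convex ℝ box := (convex_Icc _ _).prod (convex_Icc _ _)

lemma fderiv_bdd {φ : ℝ × ℝ → ℝ} (hφ : ContDiff ℝ 1 φ)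
    (hper : ∀ x : ℝ × ℝ, φ (x.1 + 2, x.2) = φ x ∧ φ (x.1, x.2 + 2) = φ x) :
    BddAbove (Set.range fun x => ‖fderiv ℝ φ x‖) := by
  have p1 : Function.Periodic (fun x => ‖fderiv ℝ φ x‖) ((2, 0) : ℝ × ℝ) := fun x => by
    have e : (fun y : ℝ × ℝ => φ (y + (2, 0))) = φ := by
      funext y
      have := (hper y).1
      rwa [show y + ((2, 0) : ℝ × ℝ) = (y.1 + 2, y.2) by ext <;> simp]
    have := fderiv_comp_add_right (𝕜 := ℝ) (f := φ) (x := x) (2, 0)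
    rw [e] at this
    simp only [this]
  have p2 : Function.Periodic (fun x => ‖fderiv ℝ φ x‖) ((0, 2) : ℝ × ℝ) := fun x => by
    have e : (fun y : ℝ × ℝ => φ (y + (0, 2))) = φ := by
      funext y
      have := (hper y).2
      rwa [show y + ((0, 2) : ℝ × ℝ) = (y.1, y.2 + 2) by ext <;> simp]
    have := fderiv_comp_add_right (𝕜 := ℝ) (f := φ) (x := x) (0, 2)
    rw [e] at this
    simp only [this]
  have hc : Continuous (fderiv ℝ φ) := hφ.continuous_fderiv (by norm_num)
  obtain ⟨K, hK⟩ := box_compact.exists_bound_of_continuousOn hc.continuousOn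
  refine ⟨K, ?_⟩
  rintro _ ⟨x, rfl⟩
  have h1 := p1.sub_zsmul_eq (x := x) (round (x.1 / 2))
  have h2 := p2.sub_zsmul_eq (x := x - round (x.1 / 2) • ((2, 0) : ℝ × ℝ)) (round (x.2 / 2))
  simp only at h1 h2 ⊢
  rw [← h1, ← h2]
  apply hK
  have a1 := abs_le.1 (abs_sub_round (x.1 / 2))
  have a2 := abs_le.1 (abs_sub_round (x.2 / 2))
  refine ⟨⟨?_, ?_⟩, ⟨?_, ?_⟩⟩ <;> simp <;> linarith [a1.1, a1.2, a2.1, a2.2]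

lemma sup_bound {φ : ℝ × ℝ → ℝ} (hφ : ContDiff ℝ 1 φ)
    (hper : ∀ x : ℝ × ℝ, φ (x.1 + 2, x.2) = φ x ∧ φ (x.1, x.2 + 2) = φ x) {x : ℝ × ℝ} (hx : x ∈ box) :
    |φ x| ≤ 2 * ((∫ y in box, |φ y|) + ⨆ y : ℝ × ℝ, ‖fderiv ℝ φ y‖) := by
  set K := ⨆ y : ℝ × ℝ, ‖fderiv ℝ φ y‖ with hK
  have hb := fderiv_bdd hφ hper
  have hK0 : 0 ≤ K := Real.iSup_nonneg fun _ => norm_nonneg _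
  have hI : 0 ≤ ∫ y in box, |φ y| := integral_nonneg fun _ => abs_nonneg _
  have hinte : IntegrableOn (fun y => |φ y|) box := (hφ.continuous.abs.continuousOn).integrableOn_compact box_compact
  have hpt : ∀ y ∈ box, |φ x| - 2 * K ≤ |φ y| := fun y hy => by
    have h := box_convex.norm_image_sub_le_of_norm_fderiv_le (𝕜 := ℝ) (f := φ) (C := K)
      (fun z _ => (hφ.differentiable (by norm_num)) z) (fun z _ => le_ciSup hb z) hy hx
    have hd : ‖x - y‖ ≤ 2 := by
      rw [Prod.norm_def, max_le_iff, Real.norm_eq_abs, Real.norm_eq_abs, abs_le, abs_le]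
      obtain ⟨⟨u1, u2⟩, ⟨u3, u4⟩⟩ := hx
      obtain ⟨⟨v1, v2⟩, ⟨v3, v4⟩⟩ := hy
      simp only [Prod.fst_sub, Prod.snd_sub]
      refine ⟨⟨?_, ?_⟩, ⟨?_, ?_⟩⟩ <;> linarith
    rw [Real.norm_eq_abs] at h
    have := abs_sub_abs_le_abs_sub (φ x) (φ y)
    nlinarith
  have h1 := setIntegral_mono_on (μ := volume) (f := fun _ => |φ x| - 2 * K) (g := fun y => |φ y|)
    (integrableOn_const box_compact.measure_lt_top.ne) hinte box_meas hpt
  rw [setIntegral_const, box_vol, smul_eq_mul] at h1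
  linarith

section
variable (N : ℕ) [NeZero N]

lemma cell_one (v : ZMod (2 * N)) :
    (volume : Measure ℝ) {t | t ∈ Set.Icc (-1 : ℝ) 1 ∧ ((⌊(N : ℝ) * t⌋ : ℤ) : ZMod (2 * N)) = v} ≤ ENNReal.ofReal ((N : ℝ)⁻¹) := by
  have hN := N_pos N
  obtain ⟨r, hr⟩ : ∃ r : ℤ, ∀ m : ℤ, -(N : ℤ) ≤ m → m < N → (m : ZMod (2 * N)) = v → m = r := by
    by_cases h : ∃ m : ℤ, -(N : ℤ) ≤ m ∧ m < N ∧ (m : ZMod (2 * N)) = v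
    · obtain ⟨m, h1, h2, h3⟩ := h
      refine ⟨m, fun m' h1' h2' h3' => ?_⟩
      have h4 := (ZMod.intCast_eq_intCast_iff_dvd_sub m m' (2 * N)).1 (h3.trans h3'.symm)
      push_cast at h4
      have := Int.eq_zero_of_abs_lt_dvd h4 (by rw [abs_lt]; constructor <;> omega)
      omega
    · push Not at h
      exact ⟨0, fun m h1 h2 h3 => absurd h3 (h m h1 h2)⟩
  have hsub : {t | t ∈ Set.Icc (-1 : ℝ) 1 ∧ ((⌊(N : ℝ) * t⌋ : ℤ) : ZMod (2 * N)) = v} ⊆ Set.Icc ((r : ℝ) / N) ((r + 1 : ℝ) / N) ∪ {1} := by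
    rintro t ⟨⟨h1, h2⟩, h3⟩
    rcases eq_or_lt_of_le h2 with h | h
    · right; exact h
    · left
      have e := hr ⌊(N : ℝ) * t⌋ (Int.le_floor.2 (by push_cast; nlinarith)) (Int.floor_lt.2 (by push_cast; nlinarith)) h3
      have f1 := Int.floor_le ((N : ℝ) * t)
      have f2 := Int.lt_floor_add_one ((N : ℝ) * t)
      rw [e] at f1 f2
      exact ⟨by rw [div_le_iff₀ hN]; linarith, by rw [le_div_iff₀ hN]; linarith⟩
  refine (measure_mono hsub).trans ((measure_union_le _ _).trans ?_)
  rw [Real.volume_Icc, Real.volume_singleton, add_zero]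
  apply ENNReal.ofReal_le_ofReal
  apply le_of_eq
  field_simp; ring

def cell (x : ℝ × ℝ) : Lat N := (((⌊(N : ℝ) * x.1⌋ : ℤ) : ZMod (2*N)), ((⌊(N : ℝ) * x.2⌋ : ℤ) : ZMod (2*N)))

lemma cell_meas (z : Lat N) : MeasurableSet {x : ℝ × ℝ | cell N x = z} := by
  have h1 : Measurable fun t : ℝ => ⌊(N : ℝ) * t⌋ := Int.measurable_floor.comp (measurable_const_mul _)
  have e : {x : ℝ × ℝ | cell N x = z} = (Prod.fst ⁻¹' ((fun t : ℝ => ⌊(N : ℝ) * t⌋) ⁻¹' {m : ℤ | (m : ZMod (2 * N)) = z.1})) ∩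
      (Prod.snd ⁻¹' ((fun t : ℝ => ⌊(N : ℝ) * t⌋) ⁻¹' {m : ℤ | (m : ZMod (2 * N)) = z.2})) := by
    ext x
    simp [cell, Prod.ext_iff]
  rw [e]
  exact (measurable_fst (h1 trivial)).inter (measurable_snd (h1 trivial))

lemma cell_vol (z : Lat N) : (volume : Measure (ℝ × ℝ)) (box ∩ {x | cell N x = z}) ≤ ENNReal.ofReal (((N : ℝ)⁻¹) ^ 2) := by
  have hsub : box ∩ {x | cell N x = z} ⊆ {t | t ∈ Set.Icc (-1 : ℝ) 1 ∧ ((⌊(N : ℝ) * t⌋ : ℤ) : ZMod (2 * N)) = z.1} ×ˢ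
      {t | t ∈ Set.Icc (-1 : ℝ) 1 ∧ ((⌊(N : ℝ) * t⌋ : ℤ) : ZMod (2 * N)) = z.2} := by
    rintro x ⟨⟨h1, h2⟩, h3⟩
    have h4 := congrArg Prod.fst h3
    have h5 := congrArg Prod.snd h3
    exact ⟨⟨h1, h4⟩, ⟨h2, h5⟩⟩
  refine (measure_mono hsub).trans ?_
  rw [Measure.volume_eq_prod, Measure.prod_prod, ENNReal.ofReal_pow (inv_nonneg.2 (N_pos N).le), sq]
  exact mul_le_mul' (cell_one N z.1) (cell_one N z.2)

def aCell (φ : ℝ × ℝ → ℝ) (z : Lat N) : ℝ := ∫ x in box ∩ {x | cell N x = z}, φ x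

lemma aCell_le {φ : ℝ × ℝ → ℝ} {M : ℝ} (hM0 : 0 ≤ M) (hM : ∀ x ∈ box, |φ x| ≤ M) (z : Lat N) : |aCell N φ z| ≤ M * ((N : ℝ)⁻¹) ^ 2 := by
  have h := norm_setIntegral_le_of_norm_le_const (μ := volume) (f := φ) (s := box ∩ {x | cell N x = z}) (C := M)
    ((cell_vol N z).trans_lt ENNReal.ofReal_lt_top) (fun x hx => hM x hx.1)
  refine h.trans (mul_le_mul_of_nonneg_left ?_ hM0)
  exact ENNReal.toReal_le_of_le_ofReal (by positivity) (cell_vol N z)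

lemma step_integral {φ : ℝ × ℝ → ℝ} (hφ : Continuous φ) (g m : ℝ) (σ : Lat N → ℝ) :
    ∫ x in box, g * (stepField N σ x - m) * φ x = g * ∑ z, (σ z - m) * aCell N φ z := by
  have hinte : IntegrableOn φ box := hφ.continuousOn.integrableOn_compact box_compact
  have e : (fun x => g * (stepField N σ x - m) * φ x) = fun x => ∑ z, (g * (σ z - m)) * Set.indicator {x | cell N x = z} φ x := by
    funext x
    rw [Finset.sum_eq_single (cell N x)]
    · rw [Set.indicator_of_mem (by rfl)]; rfl
    · intro z _ hz
      rw [Set.indicator_of_notMem (fun h => hz h.symm), mul_zero]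
    · intro h; exact absurd (Finset.mem_univ _) h
  rw [e, integral_finsetSum]
  · rw [Finset.mul_sum]
    refine Finset.sum_congr rfl fun z _ => ?_
    rw [integral_const_mul, setIntegral_indicator (cell_meas N z)]
    unfold aCell
    ring
  · intro z _
    exact (hinte.integrable.indicator (cell_meas N z)).const_mul _

end

lemma main_aux (𝔎 : KacProfile) (A : ℝ) (b : ℕ → ℝ) (hb : ∀ N, 0 ≤ b N) :
    ∃ C : ℝ, ∀ φ : ℝ × ℝ → ℝ, ContDiff ℝ 1 φ →
      (∀ x : ℝ × ℝ, φ (x.1 + 2, x.2) = φ x ∧ φ (x.1, x.2 + 2) = φ x) →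
      ∀ δ : ℝ, 0 < δ →
      ∃ N₀ : ℕ, ∀ (N : ℕ) [NeZero N], N₀ ≤ N → ∀ c : ℝ, 0 < c →
        (∑ z : Lat N, kGamma 𝔎 N c (gam N) z) = 1 →
        gibbsE N (kGamma 𝔎 N c (gam N)) (betaCrit 𝔎 N c A) (b N)
          (fun σ => (∫ x in box, (gam N)⁻¹ *
            (stepField N σ x -
              gibbsE N (kGamma 𝔎 N c (gam N)) (betaCrit 𝔎 N c A) (b N) (fun σ' => σ' 0)) *
            φ x) ^ 2)
        ≤ C * ((∫ x in box, |φ x|) + ⨆ x : ℝ × ℝ, ‖fderiv ℝ φ x‖) ^ 2 + δ := by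
  obtain ⟨C, hC, N₀, h⟩ := lat_susc 𝔎 A
  refine ⟨16 * C, fun φ hφ hper δ hδ => ⟨N₀, fun N _ hN c hc hs => ?_⟩⟩
  obtain ⟨hβ, hG, hsum⟩ := h N hN c hc hs
  have hNp := N_pos N
  set S := (∫ x in box, |φ x|) + ⨆ x : ℝ × ℝ, ‖fderiv ℝ φ x‖ with hS
  have hS0 : 0 ≤ S := add_nonneg (integral_nonneg fun _ => abs_nonneg _) (Real.iSup_nonneg fun _ => norm_nonneg _)
  set J : Lat N × Lat N → ℝ := fun e => betaCrit 𝔎 N c A / 2 * kGamma 𝔎 N c (gam N) (e.1 - e.2) with hJ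
  have hJ0 : ∀ e, 0 ≤ J e := fun e => mul_nonneg (by linarith) (kG_nonneg N 𝔎 hc.le _)
  obtain ⟨m, hm⟩ : ∃ m, m = avb J (b N) (fun s => sp s 0) := ⟨_, rfl⟩
  have hmx : ∀ x, avb J (b N) (fun s => sp s x) = m := fun x => by
    rw [hm]
    exact avb_shift (b N) x (fun e => by simp only [hJ, add_sub_add_right_eq_sub])
  have hm0 : gibbsE N (kGamma 𝔎 N c (gam N)) (betaCrit 𝔎 N c A) (b N) (fun σ' => σ' 0) = m := by
    rw [gibbsE_eq, hm]
  rw [hm0, gibbsE_eq]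
  simp only [step_integral N hφ.continuous]
  refine (second_moment hJ0 (hb N) hmx (aCell N φ) (M := 2 * S * ((N : ℝ)⁻¹) ^ 2)
    (aCell_le N (by positivity) fun x hx => sup_bound hφ hper hx)).trans ?_
  have h1 : ∑ x, ∑ y, G2 J x y ≤ 4 * (N : ℝ) ^ 2 * (C * N) := by
    have : ∀ x ∈ (Finset.univ : Finset (Lat N)), ∑ y, G2 J x y ≤ C * N := fun x _ => by
      simp only [hG x]
      exact (Equiv.sum_comp (Equiv.subRight x) (fun y => G2 J 0 y)).le.trans hsum
    refine (Finset.sum_le_sum this).trans (le_of_eq ?_)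
    rw [Finset.sum_const, nsmul_eq_mul, Finset.card_univ, card_lat]
  have h2 := mul_le_mul_of_nonneg_left h1 (show 0 ≤ (gam N)⁻¹ ^ 2 * (2 * S * ((N : ℝ)⁻¹) ^ 2) ^ 2 by positivity)
  refine h2.trans ?_
  rw [inv_pow, gam_sq, inv_inv]
  have e : (N : ℝ) * (2 * S * ((N : ℝ)⁻¹) ^ 2) ^ 2 * (4 * (N : ℝ) ^ 2 * (C * N)) = 16 * C * S ^ 2 := by
    field_simp; ring
  rw [e]
  linarith

end PartP14

open scoped NNReal

/-- tightness with external field: for nonnegative fields `b_γ ≥ 0`,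
the pairing of `X̃_γ = γ^{-1}(σ_{⌊ε^{-1}·⌋} - m_γ)` with a `C¹` test function `φ` has second
moment asymptotically bounded by `C (‖φ‖_{L¹} + ‖∇φ‖_∞)²`. -/
theorem statement2 (𝔎 : KacProfile) (A : ℝ) (b : ℕ → ℝ) (hb : ∀ N, 0 ≤ b N) :
    ∃ C : ℝ, ∀ φ : ℝ × ℝ → ℝ, ContDiff ℝ 1 φ →
      (∀ x : ℝ × ℝ, φ (x.1 + 2, x.2) = φ x ∧ φ (x.1, x.2 + 2) = φ x) →
      ∀ δ : ℝ, 0 < δ →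
      ∃ N₀ : ℕ, ∀ (N : ℕ) [NeZero N], N₀ ≤ N → ∀ c : ℝ, 0 < c →
        (∑ z : Lat N, kGamma 𝔎 N c (gam N) z) = 1 →
        gibbsE N (kGamma 𝔎 N c (gam N)) (betaCrit 𝔎 N c A) (b N)
          (fun σ => (∫ x in box, (gam N)⁻¹ *
            (stepField N σ x -
              gibbsE N (kGamma 𝔎 N c (gam N)) (betaCrit 𝔎 N c A) (b N) (fun σ' => σ' 0)) *
            φ x) ^ 2)
        ≤ C * ((∫ x in box, |φ x|) + ⨆ x : ℝ × ℝ, ‖fderiv ℝ φ x‖) ^ 2 + δ := main_aux 𝔎 A b hb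

end IsingKac
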